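/- Let D, O ⊂ ℝ^d be open sets such that D is connected, O is bounded, and ∂D ∩ Ō is a Lipschitz boundary, and let ℓ ∈ ℕ, ℓ ≥ 1, p ∈ (1,∞). Then there exist a bounded linear map E : W^{ℓ,p}(D;ℝ^N) → W^{ℓ,p}(O;ℝ^N) and a constant c = c(d,p,D,O) such that for all u ∈ W^{ℓ,p}(D;ℝ^N): (1) E u = u a.e. in D∩O; (2) ‖E u‖_{L^p(O;ℝ^N)} ≤ c‖u‖_{L^p(D;ℝ^N)}; (3) ‖∇^ℓ(E u)‖_{L^p(O)} ≤ c‖∇^ℓ u‖_{L^p(D)}. -/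

import Mathlib

open MeasureTheory Filter Topology Metric Set
open scoped ENNReal NNReal

noncomputable section

attribute [local instance] Classical.propDecidable

namespace HC

abbrev Rd (d : ℕ) := Fin d → ℝ
abbrev Vec (N : ℕ) := Fin N → ℝ

/-- Euclidean inner product on `ℝ^N`. -/
def dot {N : ℕ} (u v : Vec N) : ℝ := ∑ j, u j * v j

/-- Euclidean norm on `ℝ^N`. -/
def eN {N : ℕ} (ξ : Vec N) : ℝ := Real.sqrt (∑ j, ξ j ^ 2)

/-- The open unit cube `Q = (0,1)^d`. -/
def Qcube (d : ℕ) : Set (Rd d) := {x | ∀ i, x i ∈ Set.Ioo (0 : ℝ) 1}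

/-- Translation by an integer vector. -/
def tr {d : ℕ} (z : Fin d → ℤ) (x : Rd d) : Rd d := fun i => x i + (z i : ℝ)

/-- The cell `ε (S + z)`. -/
def cell {d : ℕ} (ε : ℝ) (z : Fin d → ℤ) (S : Set (Rd d)) : Set (Rd d) :=
  (fun y : Rd d => fun i => ε * (y i + (z i : ℝ))) '' S

/-- The union of the soft inclusions `Ω_{0,ε}`. -/
def softPart {d : ℕ} (ε : ℝ) (Ω D0 : Set (Rd d)) : Set (Rd d) :=
  ⋃ z ∈ {z : Fin d → ℤ | cell ε z D0 ⊆ Ω}, cell ε z D0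

/-- The stiff matrix `Ω_{1,ε}`. -/
def stiffPart {d : ℕ} (ε : ℝ) (Ω D0 : Set (Rd d)) : Set (Rd d) := Ω \ softPart ε Ω D0

/-- `Ω̂_ε`, the union of the ε-cubes contained in `Ω`. -/
def hatOmega {d : ℕ} (ε : ℝ) (Ω : Set (Rd d)) : Set (Rd d) :=
  ⋃ z ∈ {z : Fin d → ℤ | cell ε z (Qcube d) ⊆ Ω}, cell ε z (Qcube d)

/-- `Q`-periodicity of a map defined on `ℝ^d`. -/
def Zper {d : ℕ} {α : Type*} (u : Rd d → α) : Prop :=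
  ∀ (x : Rd d) (z : Fin d → ℤ), u (tr z x) = u x

/-- A local Lipschitz-graph description of `Ω` near the point `x`:  after an orthogonal
change of coordinates, `Ω` is locally the epigraph of a Lipschitz function. -/
def LipschitzGraphAt {d : ℕ} (Ω : Set (Rd d)) (x : Rd d) : Prop :=
  ∃ (L : Rd d ≃ₗ[ℝ] Rd d) (i : Fin d) (φ : Rd d → ℝ) (K : ℝ≥0) (r : ℝ),
    0 < r ∧ (∀ y z : Rd d, dot (L y) (L z) = dot y z) ∧ LipschitzWith K φ ∧
    (∀ y t, φ (Function.update y i t) = φ y) ∧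
    (∀ y ∈ Metric.ball x r, (y ∈ Ω ↔ φ (L y) < L y i))

/-- `Ω` has Lipschitz boundary. -/
def HasLipschitzBoundary {d : ℕ} (Ω : Set (Rd d)) : Prop :=
  ∀ x ∈ frontier Ω, LipschitzGraphAt Ω x

/-- Compact containment `Ω' ⋐ Ω`. -/
def CpctIn {d : ℕ} (Ω' Ω : Set (Rd d)) : Prop :=
  IsOpen Ω' ∧ IsCompact (closure Ω') ∧ closure Ω' ⊆ Ω

/-- The standing geometric assumptions: `d ≥ 2`, `Ω` bounded connected open Lipschitz,
`D₀ ⋐ Q` open connected Lipschitz. -/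
def GoodSetting (d : ℕ) (Ω D0 : Set (Rd d)) : Prop :=
  2 ≤ d ∧ IsOpen Ω ∧ IsConnected Ω ∧ Bornology.IsBounded Ω ∧ HasLipschitzBoundary Ω ∧
    IsOpen D0 ∧ IsConnected D0 ∧ HasLipschitzBoundary D0 ∧
    IsCompact (closure D0) ∧ closure D0 ⊆ Qcube d

/-! ## First-order constant-coefficient operators -/

/-- The pointwise value of the formal adjoint:
`(𝒜*ψ)(x) = - ∑ i (A^{(i)})^T ∂ψ/∂x_i (x)`. -/
def adjApply {d N M : ℕ} (A : Fin d → (Vec N →ₗ[ℝ] Vec M)) (ψ : Rd d → Vec M)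
    (x : Rd d) : Vec N :=
  fun n => -∑ i, dot (A i (Pi.single n 1)) (fderiv ℝ ψ x (Pi.single i 1))

/-- Smooth test functions compactly supported in `O`. -/
def TestOn {d M : ℕ} (O : Set (Rd d)) (ψ : Rd d → Vec M) : Prop :=
  ContDiff ℝ (⊤ : ℕ∞) ψ ∧ HasCompactSupport ψ ∧ tsupport ψ ⊆ O

/-- `𝒜 u = 0` in `W^{-1,p}(O)`, i.e. distributionally on `O`. -/
def AFreeOn {d N M : ℕ} (A : Fin d → (Vec N →ₗ[ℝ] Vec M)) (O : Set (Rd d))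
    (u : Rd d → Vec N) : Prop :=
  ∀ ψ : Rd d → Vec M, TestOn O ψ → ∫ x in O, dot (u x) (adjApply A ψ x) = 0

/-- `𝒜 u = 0` on the torus `𝕋^d` (with `Q`-periodic test functions). -/
def AFreeTorus {d N M : ℕ} (A : Fin d → (Vec N →ₗ[ℝ] Vec M)) (u : Rd d → Vec N) : Prop :=
  ∀ ψ : Rd d → Vec M, ContDiff ℝ (⊤ : ℕ∞) ψ → Zper ψ →
    ∫ x in Qcube d, dot (u x) (adjApply A ψ x) = 0

/-- The symbol `𝔸[ω] = ∑ i ω_i A^{(i)}`. -/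
def symb {d N M : ℕ} (A : Fin d → (Vec N →ₗ[ℝ] Vec M)) (ω : Rd d) : Vec N →ₗ[ℝ] Vec M :=
  ∑ i, ω i • A i

/-- Murat's constant rank condition. -/
def ConstantRank {d N M : ℕ} (A : Fin d → (Vec N →ₗ[ℝ] Vec M)) : Prop :=
  ∃ r : ℕ, ∀ ω : Rd d, ω ≠ 0 → Module.finrank ℝ (LinearMap.range (symb A ω)) = r

/-! ## Lp spaces and convergences -/

def MemLpOn {d N : ℕ} (p : ℝ) (O : Set (Rd d)) (u : Rd d → Vec N) : Prop :=
  MemLp u (ENNReal.ofReal p) (volume.restrict O)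

def LpNormOn {d N : ℕ} (p : ℝ) (O : Set (Rd d)) (u : Rd d → Vec N) : ℝ :=
  (eLpNorm (fun x => eN (u x)) (ENNReal.ofReal p) (volume.restrict O)).toReal

/-- The conjugate exponent `p' = p/(p-1)`. -/
def conjExp (p : ℝ) : ℝ := p / (p - 1)

/-- Weak convergence in `L^p(O; ℝ^N)` of a family along a filter. -/
def WeakLpTendsto {d N : ℕ} (p : ℝ) (O : Set (Rd d)) {ι : Type*} (l : Filter ι)
    (u : ι → Rd d → Vec N) (v : Rd d → Vec N) : Prop :=
  ∀ g : Rd d → Vec N, MemLpOn (conjExp p) O g →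
    Tendsto (fun k => ∫ x in O, dot (u k x) (g x)) l (𝓝 (∫ x in O, dot (v x) (g x)))

/-- `p`-equiintegrability of a family in `L^p(O)`. -/
def PEquiintegrable {d N : ℕ} (p : ℝ) (O : Set (Rd d)) {ι : Type*}
    (u : ι → Rd d → Vec N) : Prop :=
  ∀ η : ℝ, 0 < η → ∃ m : ℝ, 0 < m ∧ ∀ (k : ι) (E : Set (Rd d)), MeasurableSet E → E ⊆ O →
    volume E < ENNReal.ofReal m → ∫ x in E, eN (u k x) ^ p < η

/-- Membership in `L^p(Ω × Q; ℝ^N)`. -/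
def MemLpProd {d N : ℕ} (p : ℝ) (Ω : Set (Rd d)) (v : Rd d → Rd d → Vec N) : Prop :=
  MemLp (fun q : Rd d × Rd d => v q.1 q.2) (ENNReal.ofReal p)
    ((volume.restrict Ω).prod (volume.restrict (Qcube d)))

def LpNormProd {d N : ℕ} (p : ℝ) (Ω : Set (Rd d)) (v : Rd d → Rd d → Vec N) : ℝ :=
  (eLpNorm (fun q : Rd d × Rd d => eN (v q.1 q.2)) (ENNReal.ofReal p)
    ((volume.restrict Ω).prod (volume.restrict (Qcube d)))).toReal

/-- `p`-equiintegrability of a family in `L^p(Ω × Q)`. -/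
def PEquiintegrableProd {d N : ℕ} (p : ℝ) (Ω : Set (Rd d)) {ι : Type*}
    (w : ι → Rd d → Rd d → Vec N) : Prop :=
  ∀ η : ℝ, 0 < η → ∃ m : ℝ, 0 < m ∧ ∀ (k : ι) (E : Set (Rd d × Rd d)), MeasurableSet E →
    ((volume.restrict Ω).prod (volume.restrict (Qcube d))) E < ENNReal.ofReal m →
    ∫ q in E, eN (w k q.1 q.2) ^ p
        ∂((volume.restrict Ω).prod (volume.restrict (Qcube d))) < η

/-! ## Two-scale convergence and unfolding -/

/-- `x ↦ sup_{y ∈ Q̄} |g(x,y)|`. -/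
def perSup {d N : ℕ} (g : Rd d → Rd d → Vec N) (x : Rd d) : ℝ :=
  sSup ((fun y => eN (g x y)) '' closure (Qcube d))

/-- Test functions for two-scale convergence: elements of `L^{p'}(Ω; C_per(ℝ^d;ℝ^N))`. -/
def TwoScaleTest {d N : ℕ} (p : ℝ) (Ω : Set (Rd d)) (g : Rd d → Rd d → Vec N) : Prop :=
  (∀ x, Continuous (g x)) ∧ (∀ x, Zper (g x)) ∧
    MemLp (perSup g) (ENNReal.ofReal (conjExp p)) (volume.restrict Ω)

/-- Weak two-scale convergence in `L^p`, along a filter `l` with scales `η`. -/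
def WeakTwoScale {d N : ℕ} (p : ℝ) (Ω : Set (Rd d)) {ι : Type*} (l : Filter ι) (η : ι → ℝ)
    (u : ι → Rd d → Vec N) (v : Rd d → Rd d → Vec N) : Prop :=
  ∀ g : Rd d → Rd d → Vec N, TwoScaleTest p Ω g →
    Tendsto (fun k => ∫ x in Ω, dot (u k x) (g x ((η k)⁻¹ • x))) l
      (𝓝 (∫ x in Ω, ∫ y in Qcube d, dot (v x y) (g x y)))

/-- Strong two-scale convergence in `L^p`. -/
def StrongTwoScale {d N : ℕ} (p : ℝ) (Ω : Set (Rd d)) {ι : Type*} (l : Filter ι) (η : ι → ℝ)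
    (u : ι → Rd d → Vec N) (v : Rd d → Rd d → Vec N) : Prop :=
  WeakTwoScale p Ω l η u v ∧ Tendsto (fun k => LpNormOn p Ω (u k)) l (𝓝 (LpNormProd p Ω v))

/-- The unfolding operator `S_ε v (x,y) = ṽ(ε⌊x/ε⌋ + εy)`, where `ṽ` is the extension of `v`
by `0` outside `Ω`. -/
def unfold {d N : ℕ} (ε : ℝ) (Ω : Set (Rd d)) (v : Rd d → Vec N) :
    Rd d → Rd d → Vec N :=
  fun x y => Set.indicator Ω v (fun i => ε * ((⌊x i / ε⌋ : ℝ) + y i))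

/-! ## The energy densities and their hypotheses -/

def H1soft {N : ℕ} (f0 : ℝ → Vec N → ℝ) : Prop := ∀ ε : ℝ, 0 < ε → Continuous (f0 ε)

def H1stiff {d N : ℕ} (f1 : Rd d → Vec N → ℝ) : Prop :=
  (∀ ξ, Measurable fun x => f1 x ξ) ∧ ∀ x, Continuous (f1 x)

def H2 {d N : ℕ} (f1 : Rd d → Vec N → ℝ) : Prop :=
  ∀ (x : Rd d) (z : Fin d → ℤ) (ξ : Vec N), f1 (tr z x) ξ = f1 x ξ

def H3soft {N : ℕ} (p a lam Lam : ℝ) (f0 : ℝ → Vec N → ℝ) : Prop :=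
  0 < a ∧ 0 < lam ∧ 0 < Lam ∧
    ∀ ε : ℝ, 0 < ε → ∀ ξ, lam * (-a + eN ξ ^ p) ≤ f0 ε ξ ∧ f0 ε ξ ≤ Lam * (1 + eN ξ ^ p)

def H3stiff {d N : ℕ} (p a lam Lam : ℝ) (f1 : Rd d → Vec N → ℝ) : Prop :=
  0 < a ∧ 0 < lam ∧ 0 < Lam ∧
    ∀ (x : Rd d) (ξ : Vec N), lam * (-a + eN ξ ^ p) ≤ f1 x ξ ∧ f1 x ξ ≤ Lam * (1 + eN ξ ^ p)

def H4soft {N : ℕ} (p mu : ℝ) (f0 : ℝ → Vec N → ℝ) : Prop :=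
  0 < mu ∧ ∀ ε : ℝ, 0 < ε → ∀ ξ ζ : Vec N,
    |f0 ε ξ - f0 ε ζ| ≤ mu * (1 + eN ξ ^ (p - 1) + eN ζ ^ (p - 1)) * eN (ξ - ζ)

def H4stiff {d N : ℕ} (p mu : ℝ) (f1 : Rd d → Vec N → ℝ) : Prop :=
  0 < mu ∧ ∀ (x : Rd d) (ξ ζ : Vec N),
    |f1 x ξ - f1 x ζ| ≤ mu * (1 + eN ξ ^ (p - 1) + eN ζ ^ (p - 1)) * eN (ξ - ζ)

def H5 {N : ℕ} (f0 : ℝ → Vec N → ℝ) (f0lim : Vec N → ℝ) : Prop :=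
  ∀ ξ, Tendsto (fun ε => f0 ε ξ) (𝓝[>] (0 : ℝ)) (𝓝 (f0lim ξ))

/-! ## The admissible class: Assumptions 1 and 2 -/

/-- Assumption 1 (null average). -/
def NullAverage {d N M : ℕ} (p : ℝ) (A : Fin d → (Vec N →ₗ[ℝ] Vec M))
    (D0 : Set (Rd d)) : Prop :=
  ∀ u : Rd d → Vec N, MemLp u (ENNReal.ofReal p) (volume.restrict (Qcube d)) → Zper u →
    (∀ᵐ y ∂volume.restrict (Qcube d \ D0), u y = 0) → AFreeTorus A u →
    (∫ y in Qcube d, u y) = 0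

/-- Assumption 2 (`𝒜`-free extension operators on the perforated domains). -/
def ExtensionProperty {d N M : ℕ} (p : ℝ) (A : Fin d → (Vec N →ₗ[ℝ] Vec M))
    (Ω D0 : Set (Rd d)) (c : ℝ) (E : ℝ → (Rd d → Vec N) → (Rd d → Vec N)) : Prop :=
  0 < c ∧
  (∀ ε : ℝ, 0 < ε → ∀ u : Rd d → Vec N, MemLpOn p Ω u → AFreeOn A Ω u →
    (∀ᵐ x ∂volume.restrict (stiffPart ε Ω D0), E ε u x = u x) ∧
    MemLpOn p Ω (E ε u) ∧
    LpNormOn p Ω (E ε u) ≤ c * LpNormOn p (stiffPart ε Ω D0) u ∧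
    AFreeOn A Ω (E ε u)) ∧
  (∀ u : ℝ → Rd d → Vec N, (∀ ε : ℝ, 0 < ε → MemLpOn p Ω (u ε) ∧ AFreeOn A Ω (u ε)) →
    PEquiintegrable p Ω (fun ε : {ε : ℝ // 0 < ε} => u ε.1) →
    PEquiintegrable p Ω (fun ε : {ε : ℝ // 0 < ε} => E ε.1 (u ε.1)))

/-- An admissible operator: constant rank together with Assumptions 1 and 2. -/
def Admissible {d N M : ℕ} (p : ℝ) (A : Fin d → (Vec N →ₗ[ℝ] Vec M))
    (Ω D0 : Set (Rd d)) : Prop :=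
  ConstantRank A ∧ NullAverage p A D0 ∧ ∃ c E, ExtensionProperty p A Ω D0 c E

/-! ## High-contrast convergence -/

/-- High-contrast convergence of a family `u` (with scales `η`) to `v`. -/
def HCTendsto {d N M : ℕ} (p : ℝ) (A : Fin d → (Vec N →ₗ[ℝ] Vec M)) (Ω D0 : Set (Rd d))
    {ι : Type*} (l : Filter ι) (η : ι → ℝ) (u : ι → Rd d → Vec N) (v : Rd d → Vec N) : Prop :=
  WeakLpTendsto p Ω l (fun k x => η k • u k x) 0 ∧
  ∃ ut : ι → Rd d → Vec N,
    (∀ k, MemLpOn p Ω (ut k) ∧ AFreeOn A Ω (ut k)) ∧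
    (∀ k, ∀ᵐ x ∂volume.restrict (stiffPart (η k) Ω D0), u k x = ut k x) ∧
    WeakLpTendsto p Ω l ut v

/-! ## The functionals -/

def U1 {d N M : ℕ} (p : ℝ) (A : Fin d → (Vec N →ₗ[ℝ] Vec M)) (Ω : Set (Rd d)) :
    Set (Rd d → Vec N) :=
  {u | MemLpOn p Ω u ∧ AFreeOn A Ω u}

def U0 {d N M : ℕ} (p : ℝ) (A : Fin d → (Vec N →ₗ[ℝ] Vec M)) (Ω D0 Ω' : Set (Rd d)) :
    Set (Rd d → Rd d → Vec N) :=
  {u | MemLpProd p Ω u ∧ (∀ x, Zper (u x)) ∧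
    (∀ x, ∀ᵐ y ∂volume.restrict (Qcube d \ D0), u x y = 0) ∧
    (∀ᵐ x ∂volume.restrict Ω', AFreeTorus A (u x))}

/-- The constant `α₀`. -/
def alpha0 {d N M : ℕ} (p : ℝ) (A : Fin d → (Vec N →ₗ[ℝ] Vec M)) (Ω D0 : Set (Rd d))
    (f0lim : Vec N → ℝ) : ℝ :=
  sSup {c : ℝ | ∃ Ω' : Set (Rd d), CpctIn Ω' Ω ∧
    c = sInf {e : ℝ | ∃ u ∈ U0 p A Ω D0 Ω', e = ∫ x in Ω', ∫ y in D0, f0lim (u x y)}}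

/-- The `ℤ^d`-periodization of `D₁ = Q ∖ D₀`. -/
def D1per {d : ℕ} (D0 : Set (Rd d)) : Set (Rd d) :=
  ⋃ z : Fin d → ℤ, tr z '' (Qcube d \ D0)

/-- The homogenized stiff energy density `f_hom`. -/
def fhom {d N M : ℕ} (p : ℝ) (A : Fin d → (Vec N →ₗ[ℝ] Vec M)) (D0 : Set (Rd d))
    (f1 : Rd d → Vec N → ℝ) (ξ : Vec N) : ℝ :=
  liminf (fun k : ℕ =>
    sInf {c : ℝ | ∃ v : Rd d → Vec N,
      MemLp v (ENNReal.ofReal p) (volume.restrict (Qcube d)) ∧ Zper v ∧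
      (∫ y in Qcube d, v y) = 0 ∧ AFreeTorus A v ∧
      c = ∫ y in Qcube d ∩ {y | (k : ℝ) • y ∈ D1per D0}, f1 ((k : ℝ) • y) (ξ + v y)}) atTop

/-- The high-contrast energy `F_ε`. -/
def Feps {d N M : ℕ} (p : ℝ) (A : Fin d → (Vec N →ₗ[ℝ] Vec M)) (Ω D0 : Set (Rd d))
    (f0 : ℝ → Vec N → ℝ) (f1 : Rd d → Vec N → ℝ) (ε : ℝ) (u : Rd d → Vec N) : EReal :=
  if u ∈ U1 p A Ω then
    (((∫ x in softPart ε Ω D0, f0 ε (ε • u x)) +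
      ∫ x in stiffPart ε Ω D0, f1 (ε⁻¹ • x) (u x) : ℝ) : EReal)
  else ⊤

/-- The soft energy `F_{0,ε}`. -/
def F0eps {d N M : ℕ} (p : ℝ) (A : Fin d → (Vec N →ₗ[ℝ] Vec M)) (Ω D0 : Set (Rd d))
    (f0 : ℝ → Vec N → ℝ) (ε : ℝ) (u : Rd d → Vec N) : EReal :=
  if u ∈ U1 p A Ω then ((∫ x in softPart ε Ω D0, f0 ε (ε • u x) : ℝ) : EReal) else ⊤

/-- The stiff energy `F_{1,ε}`. -/
def F1eps {d N M : ℕ} (p : ℝ) (A : Fin d → (Vec N →ₗ[ℝ] Vec M)) (Ω D0 : Set (Rd d))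
    (f1 : Rd d → Vec N → ℝ) (ε : ℝ) (u : Rd d → Vec N) : EReal :=
  if u ∈ U1 p A Ω then ((∫ x in stiffPart ε Ω D0, f1 (ε⁻¹ • x) (u x) : ℝ) : EReal) else ⊤

/-- The limiting functional `F = α₀ + ∫_Ω f_hom(u)`. -/
def Flim {d N M : ℕ} (p : ℝ) (A : Fin d → (Vec N →ₗ[ℝ] Vec M)) (Ω D0 : Set (Rd d))
    (f0lim : Vec N → ℝ) (f1 : Rd d → Vec N → ℝ) (u : Rd d → Vec N) : EReal :=
  if u ∈ U1 p A Ω then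
    ((alpha0 p A Ω D0 f0lim + ∫ x in Ω, fhom p A D0 f1 (u x) : ℝ) : EReal)
  else ⊤

/-- The limiting soft functional `F₀`. -/
def F0lim {d N M : ℕ} (p : ℝ) (A : Fin d → (Vec N →ₗ[ℝ] Vec M)) (Ω D0 : Set (Rd d))
    (f0lim : Vec N → ℝ) (u : Rd d → Vec N) : EReal :=
  if u =ᵐ[volume.restrict Ω] (0 : Rd d → Vec N) then ((alpha0 p A Ω D0 f0lim : ℝ) : EReal)
  else ⊤

/-- The limiting stiff functional `F₁`. -/
def F1lim {d N M : ℕ} (p : ℝ) (A : Fin d → (Vec N →ₗ[ℝ] Vec M)) (Ω D0 : Set (Rd d))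
    (f1 : Rd d → Vec N → ℝ) (u : Rd d → Vec N) : EReal :=
  if u ∈ U1 p A Ω then ((∫ x in Ω, fhom p A D0 f1 (u x) : ℝ) : EReal) else ⊤

/-! ## Higher-order operators, potentials, Sobolev spaces -/

/-- The pointwise value of the formal adjoint of the `k`-th order homogeneous operator
with coefficients `A`. -/
def adjOp {d k N M : ℕ} (A : (Fin k → Fin d) → (Vec N →ₗ[ℝ] Vec M)) (ψ : Rd d → Vec M)
    (x : Rd d) : Vec N :=
  fun n => (-1 : ℝ) ^ k * ∑ j : Fin k → Fin d,
    dot (A j (Pi.single n 1)) (iteratedFDeriv ℝ k ψ x (fun t => Pi.single (j t) 1))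

/-- `𝒜 u = 0` in `W^{-k,p}(O)` for a `k`-th order operator. -/
def AFreeOnK {d k N M : ℕ} (A : (Fin k → Fin d) → (Vec N →ₗ[ℝ] Vec M)) (O : Set (Rd d))
    (u : Rd d → Vec N) : Prop :=
  ∀ ψ : Rd d → Vec M, TestOn O ψ → ∫ x in O, dot (u x) (adjOp A ψ x) = 0

/-- The symbol of a `k`-th order homogeneous operator. -/
def symbK {d k N M : ℕ} (A : (Fin k → Fin d) → (Vec N →ₗ[ℝ] Vec M)) (ω : Rd d) :
    Vec N →ₗ[ℝ] Vec M :=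
  ∑ j : Fin k → Fin d, (∏ t, ω (j t)) • A j

def ConstantRankK {d k N M : ℕ} (A : (Fin k → Fin d) → (Vec N →ₗ[ℝ] Vec M)) : Prop :=
  ∃ r : ℕ, ∀ ω : Rd d, ω ≠ 0 → Module.finrank ℝ (LinearMap.range (symbK A ω)) = r

/-- `g` is the weak partial derivative `∂_j w` (for the `m`-tuple `j` of directions) on `U`. -/
def IsWeakDerivOn {d m M : ℕ} (U : Set (Rd d)) (j : Fin m → Fin d) (w g : Rd d → Vec M) :
    Prop :=
  ∀ φ : Rd d → ℝ, ContDiff ℝ (⊤ : ℕ∞) φ → HasCompactSupport φ → tsupport φ ⊆ U →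
    ∀ cc : Fin M, (∫ x in U, w x cc * iteratedFDeriv ℝ m φ x (fun t => Pi.single (j t) 1))
      = (-1 : ℝ) ^ m * ∫ x in U, g x cc * φ x

/-- Membership in the Sobolev space `W^{ℓ,p}(U; ℝ^M)`. -/
def MemW {d M : ℕ} (ℓ : ℕ) (p : ℝ) (U : Set (Rd d)) (w : Rd d → Vec M) : Prop :=
  MemLpOn p U w ∧ ∀ m : ℕ, m ≤ ℓ → ∀ j : Fin m → Fin d,
    ∃ g : Rd d → Vec M, MemLpOn p U g ∧ IsWeakDerivOn U j w g

/-- A choice of the weak derivative `∂_j w` on `U` (defaults to `0`). -/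
def wDeriv {d m M : ℕ} (p : ℝ) (U : Set (Rd d)) (j : Fin m → Fin d) (w : Rd d → Vec M) :
    Rd d → Vec M :=
  if h : ∃ g : Rd d → Vec M, MemLpOn p U g ∧ IsWeakDerivOn U j w g then h.choose else 0

/-- The `L^p(U)` norm of the `ℓ`-th order (weak) gradient `∇^ℓ w`. -/
def gradLp {d M : ℕ} (ℓ : ℕ) (p : ℝ) (U : Set (Rd d)) (w : Rd d → Vec M) : ℝ :=
  (eLpNorm (fun x => Real.sqrt (∑ j : Fin ℓ → Fin d, eN (wDeriv p U j w x) ^ 2))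
    (ENNReal.ofReal p) (volume.restrict U)).toReal

/-- The action `ℬ w = ∑_{|j|=ℓ} B^{(j)} ∂_j w` of an `ℓ`-th order operator on a Sobolev
function, through its weak derivatives. -/
def opApplyW {d ℓ M N : ℕ} (p : ℝ) (U : Set (Rd d))
    (B : (Fin ℓ → Fin d) → (Vec M →ₗ[ℝ] Vec N)) (w : Rd d → Vec M) : Rd d → Vec N :=
  fun x => ∑ j : Fin ℓ → Fin d, B j (wDeriv p U j w x)

/-- `U` is an `𝒜`-extension domain (for a `k`-th order operator `𝒜`). -/
def AExtensionDomainK {d k N M : ℕ} (p : ℝ) (A : (Fin k → Fin d) → (Vec N →ₗ[ℝ] Vec M))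
    (U : Set (Rd d)) : Prop :=
  ∃ (E : (Rd d → Vec N) → (Rd d → Vec N)) (c : ℝ), 0 < c ∧
    ∀ u : Rd d → Vec N, MemLpOn p U u → AFreeOnK A U u →
      (∀ᵐ x ∂volume.restrict U, E u x = u x) ∧
      MemLp (E u) (ENNReal.ofReal p) volume ∧
      LpNormOn p Set.univ (E u) ≤ c * LpNormOn p U u ∧
      AFreeOnK A Set.univ (E u)

/-- `U` is an `𝒜`-extension domain (first-order version). -/
def AExtensionDomain1 {d N M : ℕ} (p : ℝ) (A : Fin d → (Vec N →ₗ[ℝ] Vec M))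
    (U : Set (Rd d)) : Prop :=
  ∃ (E : (Rd d → Vec N) → (Rd d → Vec N)) (c : ℝ), 0 < c ∧
    ∀ u : Rd d → Vec N, MemLpOn p U u → AFreeOn A U u →
      (∀ᵐ x ∂volume.restrict U, E u x = u x) ∧
      MemLp (E u) (ENNReal.ofReal p) volume ∧
      LpNormOn p Set.univ (E u) ≤ c * LpNormOn p U u ∧
      AFreeOn A Set.univ (E u)

/-- The `W^{m,q}(ℝ^d)` norm of a smooth function. -/
def WmNorm {d M : ℕ} (m : ℕ) (q : ℝ) (ψ : Rd d → Vec M) : ℝ :=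
  ∑ j ∈ Finset.range (m + 1),
    (eLpNorm (fun x => ‖iteratedFDeriv ℝ j ψ x‖) (ENNReal.ofReal q) volume).toReal

/-- The `W^{-m,p}(ℝ^d)` norm of `𝒜 u`, via duality with `W^{m,p'}`. -/
def negNorm {d k N M : ℕ} (m : ℕ) (p : ℝ) (A : (Fin k → Fin d) → (Vec N →ₗ[ℝ] Vec M))
    (u : Rd d → Vec N) : ℝ :=
  sSup {c : ℝ | ∃ ψ : Rd d → Vec M, ContDiff ℝ (⊤ : ℕ∞) ψ ∧ HasCompactSupport ψ ∧
    WmNorm m (conjExp p) ψ ≤ 1 ∧ c = ∫ x, dot (u x) (adjOp A ψ x)}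

/-! ## Fourier-analytic material -/

/-- Fourier transform of a (complexified, vector-valued) function. -/
def ftC {d N : ℕ} (f : Rd d → (Fin N → ℂ)) (ω : Rd d) : Fin N → ℂ :=
  ∫ x : Rd d, Complex.exp (-(2 * Real.pi * Complex.I) * (∑ i, (x i : ℂ) * (ω i : ℂ))) • f x

/-- Complexification of a real vector-valued map. -/
def cplx {d N : ℕ} (u : Rd d → Vec N) : Rd d → (Fin N → ℂ) := fun x n => ((u x n : ℝ) : ℂ)

/-- Action on `ℂ^N` of (the complexification of) a real linear map on `ℝ^N`. -/
def matC {N : ℕ} (P : Vec N →ₗ[ℝ] Vec N) (v : Fin N → ℂ) : Fin N → ℂ :=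
  fun m => ∑ n, ((P (Pi.single n 1) m : ℝ) : ℂ) * v n

end HC

set_option linter.all false
set_option linter.deprecated false
set_option linter.unusedVariables false
set_option linter.style.haveILetI false
set_option linter.unnecessarySimpa false

namespace HC

/-! ## Test functions, weak derivatives, jets -/

/-- Smooth scalar functions. -/
abbrev Sm {d : ℕ} (φ : Rd d → ℝ) : Prop := ContDiff ℝ (⊤ : ℕ∞) φ

/-- Scalar test functions on `U`. -/
def Tst {d : ℕ} (U : Set (Rd d)) (φ : Rd d → ℝ) : Prop :=
  Sm φ ∧ HasCompactSupport φ ∧ tsupport φ ⊆ U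

/-- Classical partial derivative. -/
def pd {d : ℕ} (i : Fin d) (φ : Rd d → ℝ) : Rd d → ℝ := fun x => fderiv ℝ φ x (Pi.single i 1)

/-- Iterated classical partial derivative. -/
def pdl {d : ℕ} : List (Fin d) → (Rd d → ℝ) → Rd d → ℝ
  | [], φ => φ
  | i :: l, φ => pd i (pdl l φ)

/-- Weak partial derivative. -/
def WD {d : ℕ} (U : Set (Rd d)) (i : Fin d) (f g : Rd d → ℝ) : Prop :=
  ∀ φ, Tst U φ → ∫ x, f x * pd i φ x = -∫ x, g x * φ x

/-- `L^P(U)` norm. -/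
def nm {d : ℕ} (P : ℝ≥0∞) (U : Set (Rd d)) (f : Rd d → ℝ) : ℝ≥0∞ :=
  eLpNorm f P (volume.restrict U)

/-- `L^P(U)` membership -/
def ML {d : ℕ} (P : ℝ≥0∞) (U : Set (Rd d)) (f : Rd d → ℝ) : Prop :=
  MemLp f P (volume.restrict U)

/-- A jet of order `n` on `U`: a function together with all its weak derivatives. -/
structure Jet {d : ℕ} (P : ℝ≥0∞) (U : Set (Rd d)) (n : ℕ)
    (F : List (Fin d) → Rd d → ℝ) : Prop where
  mem : ∀ l, l.length ≤ n → ML P U (F l)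
  wd : ∀ l i, l.length < n → WD U i (F l) (F (i :: l))

section basics
variable {d : ℕ}

lemma Sm.pd {φ : Rd d → ℝ} (h : Sm φ) (i : Fin d) : Sm (pd i φ) := by
  have h1 : ContDiff ℝ (⊤ : ℕ∞) (fderiv ℝ φ) := by
    apply h.fderiv_right (m := ((⊤ : ℕ∞) : WithTop ℕ∞))
    simp
  exact h1.clm_apply contDiff_const

lemma Sm.pdl {φ : Rd d → ℝ} (h : Sm φ) (l : List (Fin d)) : Sm (pdl l φ) := by
  induction l with
  | nil => exact h
  | cons i l ih => exact ih.pd i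

lemma Sm.diff {φ : Rd d → ℝ} (h : Sm φ) : Differentiable ℝ φ :=
  h.differentiable (by simp)

lemma tsupport_pd (i : Fin d) (φ : Rd d → ℝ) : tsupport (pd i φ) ⊆ tsupport φ := by
  apply closure_minimal _ (isClosed_tsupport _)
  intro x hx
  have : fderiv ℝ φ x ≠ 0 := by
    intro h0
    apply hx
    simp [HC.pd, h0]
  exact support_fderiv_subset ℝ this

lemma Tst.pd {U : Set (Rd d)} {φ : Rd d → ℝ} (h : Tst U φ) (i : Fin d) : Tst U (pd i φ) :=
  ⟨h.1.pd i, h.2.1.mono' ((subset_tsupport _).trans (tsupport_pd i φ)),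
    (tsupport_pd i φ).trans h.2.2⟩

lemma Tst.pdl {U : Set (Rd d)} {φ : Rd d → ℝ} (h : Tst U φ) (l : List (Fin d)) :
    Tst U (pdl l φ) := by
  induction l with
  | nil => exact h
  | cons i l ih => exact ih.pd i

lemma Tst.mono {U V : Set (Rd d)} {φ : Rd d → ℝ} (h : Tst U φ) (hUV : U ⊆ V) : Tst V φ :=
  ⟨h.1, h.2.1, h.2.2.trans hUV⟩

lemma pd_comm {φ : Rd d → ℝ} (h : Sm φ) (i j : Fin d) : pd i (pd j φ) = pd j (pd i φ) := by
  funext x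
  have h1 : ContDiff ℝ (⊤ : ℕ∞) (fderiv ℝ φ) := by
    apply h.fderiv_right (m := ((⊤ : ℕ∞) : WithTop ℕ∞))
    simp
  have h2 : DifferentiableAt ℝ (fderiv ℝ φ) x := (h1.differentiable (by simp)) x
  have key : ∀ a b : Fin d, pd a (pd b φ) x
      = fderiv ℝ (fderiv ℝ φ) x (Pi.single a 1) (Pi.single b 1) := by
    intro a b
    unfold HC.pd
    rw [fderiv_clm_apply h2 (differentiableAt_const _)]
    simp
  rw [key, key]
  have hs : IsSymmSndFDerivAt ℝ φ x := by
    apply ContDiffAt.isSymmSndFDerivAt (n := ((⊤ : ℕ∞) : WithTop ℕ∞)) h.contDiffAt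
    simp only [minSmoothness_of_isRCLikeNormedField]
    exact WithTop.coe_le_coe.2 (le_top : (2 : ℕ∞) ≤ ⊤)
  exact hs _ _

lemma pdl_perm {φ : Rd d → ℝ} (h : Sm φ) {l l' : List (Fin d)} (hl : l.Perm l') :
    pdl l φ = pdl l' φ := by
  induction hl with
  | nil => rfl
  | cons x _ ih => simp only [pdl]; rw [ih]
  | swap x y l => simp only [pdl]; exact pd_comm (h.pdl l) _ _
  | trans _ _ ih1 ih2 => exact ih1.trans ih2

lemma pdl_append (l l' : List (Fin d)) (φ : Rd d → ℝ) : pdl (l ++ l') φ = pdl l (pdl l' φ) := by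
  induction l with
  | nil => rfl
  | cons i l ih => simp only [List.cons_append, pdl, ih]

lemma pdl_pd {φ : Rd d → ℝ} (h : Sm φ) (l : List (Fin d)) (i : Fin d) :
    pdl l (pd i φ) = pdl (i :: l) φ := by
  have : pdl (l ++ [i]) φ = pdl l (pd i φ) := by rw [pdl_append]; rfl
  rw [← this]
  exact pdl_perm h (by simpa using (List.perm_append_comm : (l ++ [i]).Perm ([i] ++ l)))

lemma pdl_iterated {φ : Rd d → ℝ} (h : Sm φ) (m : ℕ) (j : Fin m → Fin d) (x : Rd d) :
    iteratedFDeriv ℝ m φ x (fun t => Pi.single (j t) 1) = pdl (List.ofFn j) φ x := by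
  induction m generalizing x with
  | zero => simp [pdl]
  | succ m ih =>
    rw [List.ofFn_succ]
    simp only [pdl, HC.pd]
    rw [iteratedFDeriv_succ_apply_left]
    have hf : (pdl (List.ofFn fun i : Fin m => j i.succ) φ)
        = fun y => iteratedFDeriv ℝ m φ y (fun t => Pi.single (j t.succ) 1) := by
      funext y; rw [ih]
    rw [hf]
    have hd : DifferentiableAt ℝ (iteratedFDeriv ℝ m φ) x := by
      apply (h.differentiable_iteratedFDeriv (m := m) _) x
      exact_mod_cast (WithTop.coe_lt_top m)
    rw [fderiv_continuousMultilinear_apply_const_apply hd]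
    rfl

/-- Integrability of products with test functions. -/
lemma ML.integrable_mul {P : ℝ≥0∞} (hP : 1 ≤ P) {U : Set (Rd d)} {f : Rd d → ℝ} (hf : ML P U f)
    {φ : Rd d → ℝ} (hc : Continuous φ) (hs : HasCompactSupport φ) (hU : tsupport φ ⊆ U) :
    Integrable (fun x => f x * φ x) := by
  have h0 : MemLp φ (ENNReal.conjExponent P) (volume : Measure (Rd d)) := hc.memLp_of_hasCompactSupport hs
  have h1 : MemLp φ (ENNReal.conjExponent P) (volume.restrict U) := h0.restrict U
  haveI : ENNReal.HolderConjugate P (ENNReal.conjExponent P) := ENNReal.HolderConjugate.conjExponent hP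
  have h2 : IntegrableOn (fun x => f x * φ x) U := MemLp.integrable_mul (p := P) (q := ENNReal.conjExponent P) hf h1
  rw [← integrableOn_iff_integrable_of_support_subset (s := U)]
  · exact h2
  · intro x hx
    apply hU
    apply subset_tsupport
    intro h; apply hx; simp [h]

lemma ML.integrable_tst {P : ℝ≥0∞} (hP : 1 ≤ P) {U : Set (Rd d)} {f : Rd d → ℝ} (hf : ML P U f)
    {φ : Rd d → ℝ} (hφ : Tst U φ) : Integrable (fun x => f x * φ x) :=
  hf.integrable_mul hP hφ.1.continuous hφ.2.1 hφ.2.2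

lemma ML.mono {P : ℝ≥0∞} {U V : Set (Rd d)} {f : Rd d → ℝ} (hf : ML P V f) (h : U ⊆ V) :
    ML P U f := MemLp.mono_measure (Measure.restrict_mono h le_rfl) hf

lemma nm_mono {P : ℝ≥0∞} {U V : Set (Rd d)} {f : Rd d → ℝ} (h : U ⊆ V) :
    nm P U f ≤ nm P V f := eLpNorm_mono_measure f (Measure.restrict_mono h le_rfl)

lemma ML.nm_ne_top {P : ℝ≥0∞} {U : Set (Rd d)} {f : Rd d → ℝ} (hf : ML P U f) : nm P U f ≠ ⊤ :=
  hf.2.ne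

lemma nm_add_le {P : ℝ≥0∞} (hP : 1 ≤ P) {U : Set (Rd d)} {f g : Rd d → ℝ} (hf : ML P U f) (hg : ML P U g) :
    nm P U (fun x => f x + g x) ≤ nm P U f + nm P U g :=
  eLpNorm_add_le hf.1 hg.1 hP

lemma nm_sub_le {P : ℝ≥0∞} (hP : 1 ≤ P) {U : Set (Rd d)} {f g : Rd d → ℝ} (hf : ML P U f) (hg : ML P U g) :
    nm P U (fun x => f x - g x) ≤ nm P U f + nm P U g :=
  eLpNorm_sub_le hf.1 hg.1 hP

lemma nm_smul (P : ℝ≥0∞) (U : Set (Rd d)) (c : ℝ) (f : Rd d → ℝ) :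
    nm P U (fun x => c * f x) = ENNReal.ofReal |c| * nm P U f := by
  have := eLpNorm_const_smul c f P (volume.restrict U)
  rw [Real.enorm_eq_ofReal_abs] at this
  exact this

lemma nm_congr {P : ℝ≥0∞} {U : Set (Rd d)} (hU : MeasurableSet U) {f g : Rd d → ℝ} (h : ∀ x ∈ U, f x = g x) :
    nm P U f = nm P U g := eLpNorm_congr_ae ((ae_restrict_iff' hU).2 (ae_of_all _ h))

lemma ML.congr {P : ℝ≥0∞} {U : Set (Rd d)} (hU : MeasurableSet U) {f g : Rd d → ℝ} (hf : ML P U f) (h : ∀ x ∈ U, f x = g x) :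
    ML P U g := MemLp.ae_eq ((ae_restrict_iff' hU).2 (ae_of_all _ h)) hf

lemma ML.add {P : ℝ≥0∞} {U : Set (Rd d)} {f g : Rd d → ℝ} (hf : ML P U f) (hg : ML P U g) :
    ML P U (fun x => f x + g x) := MemLp.add hf hg
lemma ML.sub {P : ℝ≥0∞} {U : Set (Rd d)} {f g : Rd d → ℝ} (hf : ML P U f) (hg : ML P U g) :
    ML P U (fun x => f x - g x) := MemLp.sub hf hg
lemma ML.smul {P : ℝ≥0∞} {U : Set (Rd d)} {f : Rd d → ℝ} (hf : ML P U f) (c : ℝ) :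
    ML P U (fun x => c * f x) := MemLp.const_mul hf c
lemma ML.sum {P : ℝ≥0∞} {U : Set (Rd d)} {ι : Type*} (s : Finset ι) {f : ι → Rd d → ℝ}
    (hf : ∀ i ∈ s, ML P U (f i)) : ML P U (fun x => ∑ i ∈ s, f i x) := memLp_finset_sum s hf

lemma nm_sum_le {P : ℝ≥0∞} (hP : 1 ≤ P) {U : Set (Rd d)} {ι : Type*} (s : Finset ι) {f : ι → Rd d → ℝ}
    (hf : ∀ i ∈ s, ML P U (f i)) : nm P U (fun x => ∑ i ∈ s, f i x) ≤ ∑ i ∈ s, nm P U (f i) := by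
  have := eLpNorm_sum_le (μ := volume.restrict U) (p := P) (f := f) (s := s) (fun i hi => (hf i hi).1) hP
  unfold nm
  convert this using 2
  funext x; simp

lemma WD.mono {U V : Set (Rd d)} {i : Fin d} {f g : Rd d → ℝ} (h : WD V i f g) (hUV : U ⊆ V) :
    WD U i f g := fun φ hφ => h φ (hφ.mono hUV)

lemma Jet.mono {P : ℝ≥0∞} {U V : Set (Rd d)} {n : ℕ} {F : List (Fin d) → Rd d → ℝ}
    (h : Jet P V n F) (hUV : U ⊆ V) : Jet P U n F :=
  ⟨fun l hl => (h.mem l hl).mono hUV, fun l i hl => (h.wd l i hl).mono hUV⟩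

lemma WD.add {P : ℝ≥0∞} (hP : 1 ≤ P) {U : Set (Rd d)} {i : Fin d} {f g f' g' : Rd d → ℝ}
    (h : WD U i f g) (h' : WD U i f' g') (hf : ML P U f) (hg : ML P U g) (hf' : ML P U f')
    (hg' : ML P U g') : WD U i (fun x => f x + f' x) (fun x => g x + g' x) := by
  intro φ hφ
  simp only [add_mul]
  rw [integral_add (hf.integrable_tst hP (hφ.pd i)) (hf'.integrable_tst hP (hφ.pd i)),
    integral_add (hg.integrable_tst hP hφ) (hg'.integrable_tst hP hφ), h φ hφ, h' φ hφ]
  ring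

lemma WD.smul {U : Set (Rd d)} {i : Fin d} {f g : Rd d → ℝ}
    (h : WD U i f g) (c : ℝ) : WD U i (fun x => c * f x) (fun x => c * g x) := by
  intro φ hφ
  simp only [mul_assoc]
  rw [integral_const_mul, integral_const_mul, h φ hφ]
  ring

lemma WD.zero {U : Set (Rd d)} {i : Fin d} : WD U i (fun _ => 0) (fun _ => 0) := by
  intro φ _
  simp

lemma WD.sum {P : ℝ≥0∞} (hP : 1 ≤ P) {U : Set (Rd d)} {i : Fin d} {ι : Type*} (s : Finset ι)
    {f g : ι → Rd d → ℝ} (h : ∀ a ∈ s, WD U i (f a) (g a)) (hf : ∀ a ∈ s, ML P U (f a))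
    (hg : ∀ a ∈ s, ML P U (g a)) :
    WD U i (fun x => ∑ a ∈ s, f a x) (fun x => ∑ a ∈ s, g a x) := by
  intro φ hφ
  simp only [Finset.sum_mul]
  rw [integral_finset_sum _ (fun a ha => (hf a ha).integrable_tst hP (hφ.pd i)),
    integral_finset_sum _ (fun a ha => (hg a ha).integrable_tst hP hφ), ← Finset.sum_neg_distrib]
  exact Finset.sum_congr rfl (fun a ha => h a ha φ hφ)

lemma Jet.add {P : ℝ≥0∞} (hP : 1 ≤ P) {U : Set (Rd d)} {n : ℕ} {F G : List (Fin d) → Rd d → ℝ}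
    (hF : Jet P U n F) (hG : Jet P U n G) : Jet P U n (fun l x => F l x + G l x) :=
  ⟨fun l hl => (hF.mem l hl).add (hG.mem l hl), fun l i hl =>
    (hF.wd l i hl).add hP (hG.wd l i hl) (hF.mem _ hl.le) (hF.mem _ hl) (hG.mem _ hl.le) (hG.mem _ hl)⟩

lemma Jet.smul {P : ℝ≥0∞} {U : Set (Rd d)} {n : ℕ} {F : List (Fin d) → Rd d → ℝ}
    (hF : Jet P U n F) (c : ℝ) : Jet P U n (fun l x => c * F l x) :=
  ⟨fun l hl => (hF.mem l hl).smul c, fun l i hl => (hF.wd l i hl).smul c⟩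

lemma Jet.sub {P : ℝ≥0∞} (hP : 1 ≤ P) {U : Set (Rd d)} {n : ℕ} {F G : List (Fin d) → Rd d → ℝ}
    (hF : Jet P U n F) (hG : Jet P U n G) : Jet P U n (fun l x => F l x - G l x) := by
  have := hF.add hP (hG.smul (-1))
  simpa [sub_eq_add_neg] using this

lemma Jet.sum {P : ℝ≥0∞} (hP : 1 ≤ P) {U : Set (Rd d)} {n : ℕ} {ι : Type*} (s : Finset ι)
    {F : ι → List (Fin d) → Rd d → ℝ}
    (hF : ∀ a ∈ s, Jet P U n (F a)) : Jet P U n (fun l x => ∑ a ∈ s, F a l x) :=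
  ⟨fun l hl => ML.sum s (fun a ha => (hF a ha).mem l hl), fun l i hl =>
    WD.sum hP s (fun a ha => (hF a ha).wd l i hl) (fun a ha => (hF a ha).mem _ hl.le)
      (fun a ha => (hF a ha).mem _ hl)⟩

/-- translation of a function -/
def trl (v : Rd d) (f : Rd d → ℝ) : Rd d → ℝ := fun x => f (x + v)

lemma Tst.trl {U : Set (Rd d)} {φ : Rd d → ℝ} (hφ : Tst {y | y + v ∈ U} φ) :
    Tst U (trl (-v) φ) := by
  refine ⟨hφ.1.comp (contDiff_id.add contDiff_const), ?_, ?_⟩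
  · exact hφ.2.1.comp_homeomorph (Homeomorph.addRight (-v))
  · intro x hx
    have h1 : tsupport (HC.trl (-v) φ) = (Homeomorph.addRight (-v)) ⁻¹' tsupport φ := by
      exact tsupport_comp_eq_preimage φ (Homeomorph.addRight (-v))
    rw [h1] at hx
    have := hφ.2.2 hx
    simpa using this

lemma pd_trl (v : Rd d) (i : Fin d) (φ : Rd d → ℝ) : pd i (trl v φ) = trl v (pd i φ) := by
  funext x
  simp only [HC.pd]
  unfold HC.trl
  rw [fderiv_comp_add_right]
  rfl

lemma WD.trl {U : Set (Rd d)} {i : Fin d} {f g : Rd d → ℝ} (h : WD U i f g) (v : Rd d) :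
    WD {y | y + v ∈ U} i (trl v f) (trl v g) := by
  intro φ hφ
  have h2 := h _ hφ.trl
  rw [pd_trl] at h2
  rw [← integral_add_right_eq_self _ v, ← integral_add_right_eq_self (fun x => g x * _) v] at h2
  simpa [HC.trl] using h2

lemma nm_trl (P : ℝ≥0∞) {U W : Set (Rd d)} (hW : MeasurableSet W) (hU : MeasurableSet U) (v : Rd d) {f : Rd d → ℝ} (hf : ML P U f)
    (h : ∀ y ∈ W, y + v ∈ U) : ML P W (trl v f) ∧ nm P W (trl v f) ≤ nm P U f := by
  have mp : MeasurePreserving (fun y : Rd d => y + v) (volume.restrict {y | y + v ∈ U}) (volume.restrict U) :=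
    (measurePreserving_add_right volume v).restrict_preimage hU
  have hs : W ⊆ {y | y + v ∈ U} := h
  have h1 : MemLp (HC.trl v f) P (volume.restrict {y | y + v ∈ U}) := MemLp.comp_measurePreserving hf mp
  have h2 : eLpNorm (HC.trl v f) P (volume.restrict {y | y + v ∈ U}) = eLpNorm f P (volume.restrict U) :=
    eLpNorm_comp_measurePreserving hf.1 mp
  exact ⟨ML.mono h1 hs, (nm_mono hs).trans h2.le⟩

/-- product rule for weak derivatives, with change of domain -/
lemma WD.mul {P : ℝ≥0∞} (hP : 1 ≤ P) {U V : Set (Rd d)} {i : Fin d} {f g ψ : Rd d → ℝ} (h : WD V i f g)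
    (hf : ML P V f) (hg : ML P V g) (hψ : Sm ψ) (hs : U ∩ tsupport ψ ⊆ V) :
    WD U i (fun x => ψ x * f x) (fun x => pd i ψ x * f x + ψ x * g x) := by
  intro φ hφ
  have hts : ∀ a b : Rd d → ℝ, tsupport a ⊆ tsupport ψ → tsupport b ⊆ tsupport φ → tsupport (fun x => a x * b x) ⊆ V := by
    intro a b ha hb x hx
    exact hs ⟨hφ.2.2 (hb (tsupport_mul_subset_right (f := a) (g := b) hx)),
      ha (tsupport_mul_subset_left (f := a) (g := b) hx)⟩
  have ht : Tst V (fun x => ψ x * φ x) := by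
    exact ⟨hψ.mul hφ.1, hφ.2.1.mul_left, hts ψ φ subset_rfl subset_rfl⟩
  have h2 := h _ ht
  have hpd : ∀ x, pd i (fun x => ψ x * φ x) x = pd i ψ x * φ x + ψ x * pd i φ x := by
    intro x
    simp only [HC.pd]
    rw [fderiv_fun_mul (hψ.diff x) (hφ.1.diff x)]
    simp; ring
  simp only [hpd] at h2
  have i1 : Integrable (fun x => f x * (pd i ψ x * φ x)) :=
    hf.integrable_mul hP ((hψ.pd i).continuous.mul hφ.1.continuous) hφ.2.1.mul_left
      (hts _ _ (tsupport_pd i ψ) subset_rfl)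
  have i2 : Integrable (fun x => f x * (ψ x * pd i φ x)) :=
    hf.integrable_mul hP (hψ.continuous.mul (hφ.1.pd i).continuous) (hφ.pd i).2.1.mul_left
      (hts _ _ subset_rfl (tsupport_pd i φ))
  have i3 : Integrable (fun x => g x * (ψ x * φ x)) := hg.integrable_tst hP ht
  simp only [mul_add] at h2
  rw [integral_add i1 i2] at h2
  have e1 : (fun x => ψ x * f x * pd i φ x) = fun x => f x * (ψ x * pd i φ x) := by
    funext x; ring
  have e2 : (fun x => (pd i ψ x * f x + ψ x * g x) * φ x)
      = fun x => f x * (pd i ψ x * φ x) + g x * (ψ x * φ x) := by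
    funext x; ring
  rw [e1, e2, integral_add i1 i3]
  linarith

/-- uniqueness of functions tested against test functions -/
lemma ae_eq_of_test {P : ℝ≥0∞} (hP : 1 ≤ P) {U : Set (Rd d)} (hU : IsOpen U) {f g : Rd d → ℝ}
    (hf : ML P U f) (hg : ML P U g) (h : ∀ φ, Tst U φ → ∫ x, f x * φ x = ∫ x, g x * φ x) :
    f =ᵐ[volume.restrict U] g := by
  have hloc : LocallyIntegrableOn (fun x => f x - g x) U volume := by
    rw [locallyIntegrableOn_iff hU.isLocallyClosed]
    intro K hK hKc
    have hm : ML P U (fun x => f x - g x) := hf.sub hg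
    have hmK := hm.mono hK
    haveI : IsFiniteMeasure (volume.restrict K : Measure (Rd d)) := ⟨by simpa using hKc.measure_lt_top⟩
    exact MemLp.integrable hP hmK
  have := hU.ae_eq_zero_of_integral_contDiff_smul_eq_zero hloc (by
    intro φ h1 h2 h3
    have ht : Tst U φ := ⟨h1, h2, h3⟩
    have := h φ ht
    simp only [smul_eq_mul, mul_sub]
    rw [integral_sub]
    · simp only [mul_comm (φ _)]; rw [this]; simp
    · simpa only [mul_comm (φ _)] using hf.integrable_tst hP ht
    · simpa only [mul_comm (φ _)] using hg.integrable_tst hP ht)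
  rw [Filter.EventuallyEq, ae_restrict_iff' hU.measurableSet]
  filter_upwards [this] with x hx hxU
  linarith [hx hxU]

lemma ML.of_cont {P : ℝ≥0∞} {U : Set (Rd d)} (hU : Bornology.IsBounded U) {q : Rd d → ℝ} (hq : Continuous q) : ML P U q := by
  have hc : IsCompact (closure U) := hU.isCompact_closure
  have : ML P (closure U) q := by
    haveI : IsFiniteMeasure (volume.restrict (closure U) : Measure (Rd d)) := ⟨by simpa using hc.measure_lt_top⟩
    obtain ⟨C, hC⟩ := hc.exists_bound_of_continuousOn hq.continuousOn
    refine MemLp.of_bound hq.aestronglyMeasurable C ?_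
    rw [ae_restrict_iff' isClosed_closure.measurableSet]
    exact ae_of_all _ hC
  exact this.mono subset_closure

/-- smooth functions have weak derivatives -/
lemma WD.smooth (i : Fin d) {q : Rd d → ℝ} (hq : Sm q) (U : Set (Rd d)) : WD U i q (pd i q) := by
  intro φ hφ
  have := integral_mul_fderiv_eq_neg_fderiv_mul_of_integrable (μ := (volume : Measure (Rd d))) (f := q) (g := φ) (v := Pi.single i 1) ?_ ?_ ?_ (fun x _ => hq.diff x) (fun x _ => hφ.1.diff x)
  · exact this
  · exact ((hq.pd i).continuous.mul hφ.1.continuous).integrable_of_hasCompactSupport hφ.2.1.mul_left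
  · exact (hq.continuous.mul (hφ.1.pd i).continuous).integrable_of_hasCompactSupport (hφ.pd i).2.1.mul_left
  · exact (hq.continuous.mul hφ.1.continuous).integrable_of_hasCompactSupport hφ.2.1.mul_left

lemma Jet.smooth (P : ℝ≥0∞) {U : Set (Rd d)} (hU : Bornology.IsBounded U) (n : ℕ) {q : Rd d → ℝ} (hq : Sm q) :
    Jet P U n (fun l => pdl l q) :=
  ⟨fun l _ => ML.of_cont hU (hq.pdl l).continuous, fun l i _ => WD.smooth i (hq.pdl l) U⟩

end basics


/-! ## Analysis lemmas -/
section analysis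
variable {d : ℕ}

lemma mink {Y Z : Type*} [MeasurableSpace Y] [MeasurableSpace Z] (μ : Measure Z) [IsFiniteMeasure μ]
    (ν : Measure Y) [SFinite ν] {h : Y → Z → ℝ≥0∞} (hm : Measurable (Function.uncurry h))
    {p : ℝ} (hp : 1 ≤ p) {M : ℝ≥0∞} (hM : ∀ᵐ z ∂μ, ∫⁻ y, h y z ^ p ∂ν ≤ M ^ p) :
    ∫⁻ y, (∫⁻ z, h y z ∂μ) ^ p ∂ν ≤ (μ univ * M) ^ p := by
  have hp0 : 0 < p := by linarith
  have h1 : ∀ y, (∫⁻ z, h y z ∂μ) ^ p ≤ μ univ ^ (p - 1) * ∫⁻ z, h y z ^ p ∂μ := by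
    intro y
    have hmy : Measurable (h y) := hm.comp measurable_prodMk_left
    have := eLpNorm'_le_eLpNorm'_mul_rpow_measure_univ (μ := μ) (f := h y) (p := 1) (q := p) one_pos hp
      hmy.aestronglyMeasurable
    simp only [eLpNorm', enorm_eq_self, ENNReal.rpow_one, div_one, one_div, inv_one] at this
    calc (∫⁻ z, h y z ∂μ) ^ p ≤ ((∫⁻ z, h y z ^ p ∂μ) ^ p⁻¹ * μ univ ^ (1 - p⁻¹)) ^ p :=
          ENNReal.rpow_le_rpow this hp0.le
      _ = _ := by
          rw [ENNReal.mul_rpow_of_nonneg _ _ hp0.le, ← ENNReal.rpow_mul, ← ENNReal.rpow_mul,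
            inv_mul_cancel₀ hp0.ne', ENNReal.rpow_one, sub_mul, one_mul, inv_mul_cancel₀ hp0.ne', mul_comm]
  calc ∫⁻ y, (∫⁻ z, h y z ∂μ) ^ p ∂ν ≤ ∫⁻ y, μ univ ^ (p - 1) * ∫⁻ z, h y z ^ p ∂μ ∂ν :=
        lintegral_mono h1
    _ = μ univ ^ (p - 1) * ∫⁻ y, ∫⁻ z, h y z ^ p ∂μ ∂ν := by
        rw [lintegral_const_mul']
        exact ENNReal.rpow_ne_top_of_nonneg (by linarith) (measure_ne_top _ _)
    _ = μ univ ^ (p - 1) * ∫⁻ z, ∫⁻ y, h y z ^ p ∂ν ∂μ := by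
        rw [lintegral_lintegral_swap]
        exact (hm.pow_const p).aemeasurable
    _ ≤ μ univ ^ (p - 1) * ∫⁻ z, M ^ p ∂μ := mul_le_mul_right (lintegral_mono_ae hM) _
    _ = (μ univ * M) ^ p := by
        rw [lintegral_const, ENNReal.mul_rpow_of_nonneg _ _ hp0.le]
        by_cases h0 : μ univ = 0
        · simp [h0, hp0]
        · have : μ univ ^ p = μ univ ^ (p - 1) * μ univ := by
            conv_lhs => rw [show p = (p - 1) + 1 by ring]
            rw [ENNReal.rpow_add _ _ h0 (measure_ne_top _ _), ENNReal.rpow_one]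
          rw [this]; ring

lemma nm_int {Y Z : Type*} [MeasurableSpace Y] [MeasurableSpace Z] (μ : Measure Z) [IsFiniteMeasure μ]
    (ν : Measure Y) [SFinite ν] {h : Y → Z → ℝ} (hm : Measurable (Function.uncurry h))
    {P : ℝ≥0∞} (hP : 1 ≤ P) (hP' : P ≠ ⊤) {M : ℝ≥0∞} (hM : ∀ᵐ z ∂μ, eLpNorm (fun y => h y z) P ν ≤ M)
    {f : Y → ℝ} (hf : ∀ᵐ y ∂ν, ‖f y‖ₑ ≤ ∫⁻ z, ‖h y z‖ₑ ∂μ) :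
    eLpNorm f P ν ≤ μ univ * M := by
  have hP0 : P ≠ 0 := (zero_lt_one.trans_le hP).ne'
  have hp : 1 ≤ P.toReal := by
    rw [← ENNReal.toReal_one]; exact (ENNReal.toReal_le_toReal (by simp) hP').2 hP
  have hp0 : 0 < P.toReal := by linarith
  have key := mink μ ν (h := fun y z => ‖h y z‖ₑ) hm.enorm hp (M := M) (by
    filter_upwards [hM] with z this
    rw [eLpNorm_eq_lintegral_rpow_enorm_toReal hP0 hP', one_div] at this
    exact (ENNReal.rpow_inv_le_iff hp0).1 this)
  rw [eLpNorm_eq_lintegral_rpow_enorm_toReal hP0 hP', one_div, ENNReal.rpow_inv_le_iff hp0]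
  refine le_trans (lintegral_mono_ae ?_) key
  filter_upwards [hf] with y hy
  exact ENNReal.rpow_le_rpow hy hp0.le

lemma ML.integrableOn_compact {P : ℝ≥0∞} (hP : 1 ≤ P) {U K : Set (Rd d)} {f : Rd d → ℝ} (hf : ML P U f)
    (hK : IsCompact K) (hKU : K ⊆ U) : IntegrableOn f K := by
  haveI : IsFiniteMeasure (volume.restrict K) := ⟨by
    rw [Measure.restrict_apply_univ]; exact hK.measure_lt_top⟩
  exact MemLp.integrable hP (hf.mono hKU)

set_option maxHeartbeats 1600000 in
/-- estimate of a finite difference by the gradient -/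
lemma diff_le {P : ℝ≥0∞} (hP : 1 ≤ P) (hP' : P ≠ ⊤) {U W : Set (Rd d)} (hU : IsOpen U) (hW : IsOpen W)
    {f : Rd d → ℝ} {g : Fin d → Rd d → ℝ} (hf : ML P U f) (hg : ∀ i, ML P U (g i))
    (hw : ∀ i, WD U i f (g i)) (v : Rd d) (hv : ∀ y ∈ W, ∀ s ∈ Icc (0:ℝ) 1, y + s • v ∈ U) :
    nm P W (fun x => trl v f x - f x) ≤ nm P U (fun x => ∑ i, v i * g i x) := by
  set G : Rd d → ℝ := fun x => ∑ i, v i * g i x with hGdef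
  have hG : ML P U G := ML.sum _ (fun i _ => (hg i).smul (v i))
  obtain ⟨Gm, hGm, hGeq⟩ := hG.1
  set G0 : Rd d → ℝ := U.indicator Gm with hG0
  have hG0m : Measurable G0 := hGm.measurable.indicator hU.measurableSet
  have hG0U : G0 =ᵐ[volume.restrict U] G := by
    have : G0 =ᵐ[volume.restrict U] Gm := indicator_ae_eq_restrict hU.measurableSet
    exact this.trans hGeq.symm
  have hnG : eLpNorm G0 P volume = nm P U G := by
    rw [hG0, eLpNorm_indicator_eq_eLpNorm_restrict hU.measurableSet]
    exact eLpNorm_congr_ae hGeq.symm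
  have hG0L : MemLp G0 P volume := ⟨hG0m.aestronglyMeasurable, by rw [hnG]; exact hG.2⟩
  set I : Measure ℝ := volume.restrict (Icc (0:ℝ) 1) with hI
  have hIf : I univ = 1 := by simp [hI]
  haveI : IsFiniteMeasure I := ⟨by rw [hIf]; simp⟩
  have hsh : Measurable (fun q : Rd d × ℝ => G0 (q.1 + q.2 • v)) := by
    apply hG0m.comp; fun_prop
  set H : Rd d → ℝ := fun y => ∫ s, G0 (y + s • v) ∂I with hH
  have hHm : StronglyMeasurable H := (hsh.stronglyMeasurable).integral_prod_right'
  have htr : ∀ s : ℝ, eLpNorm (fun y => G0 (y + s • v)) P volume = nm P U G := by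
    intro s
    rw [← hnG]
    have h1 := eLpNorm_comp_measurePreserving (p := P) (g := G0) hG0m.aestronglyMeasurable
      (measurePreserving_add_right (volume : Measure (Rd d)) (s • v))
    rw [Function.comp_def] at h1
    exact h1
  have hHn : eLpNorm H P volume ≤ nm P U G := by
    have := nm_int I (volume : Measure (Rd d)) (h := fun y s => G0 (y + s • v)) hsh hP hP'
      (M := nm P U G) (ae_of_all _ fun s => (htr s).le) (f := H) (ae_of_all _ (fun y => enorm_integral_le_lintegral_enorm _))
    rwa [hIf, one_mul] at this
  have hHL : MemLp H P volume := ⟨hHm.aestronglyMeasurable, lt_of_le_of_lt hHn hG.2⟩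
  have hWU : W ⊆ U := fun y hy => by simpa using hv y hy 0 (by simp)
  have hvW : ∀ y ∈ W, y + v ∈ U := fun y hy => by simpa using hv y hy 1 (by simp)
  have htf : ML P W (trl v f) := (nm_trl P hW.measurableSet hU.measurableSet v hf hvW).1
  have hfW : ML P W f := hf.mono hWU
  suffices hae : (fun x => trl v f x - f x) =ᵐ[volume.restrict W] H by
    calc nm P W (fun x => trl v f x - f x) = eLpNorm H P (volume.restrict W) := eLpNorm_congr_ae hae
      _ ≤ eLpNorm H P volume := eLpNorm_mono_measure _ Measure.restrict_le_self
      _ ≤ _ := hHn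
  apply ae_eq_of_test hP hW (htf.sub hfW) (hHL.restrict W)
  intro φ hφ
  -- the compact set
  set K : Set (Rd d) := (fun q : Rd d × ℝ => q.1 + q.2 • v) '' (tsupport φ ×ˢ Icc (0:ℝ) 1) with hK
  have hKc : IsCompact K := (hφ.2.1.isCompact.prod isCompact_Icc).image (by fun_prop)
  have hKU : K ⊆ U := by
    rintro _ ⟨⟨y, s⟩, ⟨hy, hs⟩, rfl⟩
    exact hv y (hφ.2.2 hy) s hs
  have hKz : ∀ z, z ∉ K → ∀ s ∈ Icc (0:ℝ) 1, z - s • v ∉ tsupport φ := by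
    intro z hz s hs hh
    exact hz ⟨(z - s • v, s), ⟨hh, hs⟩, by simp⟩
  have tstU : ∀ s ∈ Icc (0:ℝ) 1, Tst U (trl (-(s • v)) φ) := fun s hs =>
    Tst.trl (hφ.mono fun y hy => hv y hy s hs)
  set q : Rd d → ℝ := fun x => ∑ i, v i * pd i φ x with hq
  have hqc : Continuous q := continuous_finset_sum _ (fun i _ => continuous_const.mul (hφ.1.pd i).continuous)
  have hqs : tsupport q ⊆ tsupport φ := by
    apply closure_minimal _ (isClosed_tsupport _)
    intro x hx
    by_contra hc
    apply hx
    simp only [hq]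
    apply Finset.sum_eq_zero
    intro i _
    have : pd i φ x = 0 := by
      by_contra h0
      exact hc (tsupport_pd i φ (subset_tsupport _ h0))
    simp [this]
  have hqd : ∀ x, fderiv ℝ φ x v = q x := by
    intro x
    have : v = ∑ i, v i • (Pi.single i 1 : Rd d) := by
      simpa using (pi_eq_sum_univ' v)
    conv_lhs => rw [this]
    rw [map_sum]; simp [hq, HC.pd]
  obtain ⟨Cq, hCq⟩ := (hqc.bounded_above_of_compact_support (hφ.2.1.mono' ((subset_tsupport _).trans hqs)))
  obtain ⟨Cφ, hCφ⟩ := hφ.1.continuous.bounded_above_of_compact_support hφ.2.1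
  -- FTC
  have ftc : ∀ z, φ (z - v) - φ z = ∫ s, -q (z - s • v) ∂I := by
    intro z
    have h1 : ∀ s ∈ uIcc (0:ℝ) 1, HasDerivAt (fun s : ℝ => φ (z - s • v)) (-q (z - s • v)) s := by
      intro s _
      have hl : HasDerivAt (fun s : ℝ => z - s • v) (-v) s := by
        have := ((hasDerivAt_id s).smul_const v).const_sub z
        simpa using this
      have := (hφ.1.diff (z - s • v)).hasFDerivAt.comp_hasDerivAt s hl
      rw [map_neg, hqd] at this
      exact this
    have h2 := intervalIntegral.integral_eq_sub_of_hasDerivAt h1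
      ((by fun_prop : Continuous fun s : ℝ => -q (z - s • v)).intervalIntegrable 0 1)
    rw [intervalIntegral.integral_of_le zero_le_one, ← integral_Icc_eq_integral_Ioc] at h2
    simp only [one_smul, zero_smul, sub_zero] at h2
    exact h2.symm
  -- integrability 1
  have fK : Integrable (K.indicator f) := (integrable_indicator_iff hKc.measurableSet).2
    (hf.integrableOn_compact hP hKc hKU)
  have int1 : Integrable (Function.uncurry fun (z : Rd d) (s : ℝ) => f z * -q (z - s • v)) (volume.prod I) := by
    have hb : Integrable (fun w : Rd d × ℝ => -q (w.1 - w.2 • v) * K.indicator f w.1) (volume.prod I) := by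
      apply Integrable.bdd_mul (c := Cq) (fK.comp_fst I)
      · exact (by fun_prop : Continuous fun w : Rd d × ℝ => -q (w.1 - w.2 • v)).aestronglyMeasurable
      · exact ae_of_all _ (fun w => by simpa using hCq _)
    apply hb.congr
    have : ∀ᵐ w ∂((volume : Measure (Rd d)).prod I), w.2 ∈ Icc (0:ℝ) 1 := by
      have h3 : ∀ᵐ s ∂I, s ∈ Icc (0:ℝ) 1 := ae_restrict_mem measurableSet_Icc
      exact (Measure.quasiMeasurePreserving_snd (μ := (volume : Measure (Rd d))) (ν := I)).ae h3
    filter_upwards [this] with w hw2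
    simp only [Function.uncurry]
    by_cases hz : w.1 ∈ K
    · rw [indicator_of_mem hz]; ring
    · have : q (w.1 - w.2 • v) = 0 := by
        by_contra h0
        exact hKz _ hz _ hw2 (hqs (subset_tsupport _ h0))
      rw [this]; simp
  -- integrability 2
  have int2 : Integrable (Function.uncurry fun (y : Rd d) (s : ℝ) => G0 (y + s • v) * φ y) (volume.prod I) := by
    have G0K : IntegrableOn G0 K := by
      haveI : IsFiniteMeasure (volume.restrict K) := ⟨by
        rw [Measure.restrict_apply_univ]; exact hKc.measure_lt_top⟩
      exact MemLp.integrable hP (hG0L.restrict K)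
    have G0Ki : Integrable (K.indicator G0) := (integrable_indicator_iff hKc.measurableSet).2 G0K
    have hmeas : Measurable (Function.uncurry fun (y : Rd d) (s : ℝ) => G0 (y + s • v) * φ y) :=
      hsh.mul (hφ.1.continuous.measurable.comp measurable_fst)
    have hpt : ∀ s ∈ Icc (0:ℝ) 1, ∀ y, G0 (y + s • v) * φ y = φ y * K.indicator G0 (y + s • v) := by
      intro s hs y
      by_cases hz : y + s • v ∈ K
      · rw [indicator_of_mem hz]; ring
      · have : φ y = 0 := by
          by_contra h0
          have := hKz _ hz s hs
          rw [add_sub_cancel_right] at this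
          exact this (subset_tsupport _ h0)
        rw [this]; simp
    have hints : ∀ s : ℝ, Integrable (fun y => φ y * K.indicator G0 (y + s • v)) := fun s =>
      Integrable.bdd_mul (c := Cφ) (G0Ki.comp_add_right (s • v)) hφ.1.continuous.aestronglyMeasurable
        (ae_of_all _ hCφ)
    rw [integrable_prod_iff' hmeas.aestronglyMeasurable]
    constructor
    · filter_upwards [ae_restrict_mem measurableSet_Icc] with s hs
      simp only [Function.uncurry]
      exact (hints s).congr (ae_of_all _ fun y => (hpt s hs y).symm)
    · apply Integrable.of_bound (C := Cφ * ∫ z, ‖K.indicator G0 z‖)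
      · exact (hmeas.norm.stronglyMeasurable.integral_prod_left').aestronglyMeasurable
      · filter_upwards [ae_restrict_mem measurableSet_Icc] with s hs
        rw [Real.norm_of_nonneg (integral_nonneg fun _ => norm_nonneg _)]
        simp only [Function.uncurry, hpt s hs]
        rw [← integral_add_right_eq_self (fun z => ‖K.indicator G0 z‖) (s • v), ← integral_const_mul]
        apply integral_mono (hints s).norm (((G0Ki.comp_add_right (s • v)).norm).const_mul _)
        intro y
        simp only [norm_mul]
        exact mul_le_mul_of_nonneg_right (hCφ y) (norm_nonneg _)
  -- main computation
  have e1 : ∫ x, (trl v f x - f x) * φ x = ∫ z, f z * (φ (z - v) - φ z) := by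
    simp only [sub_mul, mul_sub]
    have t1 : Tst U (trl (-v) φ) := by simpa using tstU 1 (by simp)
    have t0 : Tst U φ := hφ.mono hWU
    rw [integral_sub (htf.integrable_tst hP hφ) (hfW.integrable_tst hP hφ)]
    have hi := hf.integrable_tst hP t1
    simp only [trl, ← sub_eq_add_neg] at hi
    rw [integral_sub hi (hf.integrable_tst hP t0)]
    congr 1
    rw [← integral_add_right_eq_self (fun z => f z * φ (z - v)) v]
    simp [trl]
  rw [e1]
  have e2 : ∫ z, f z * (φ (z - v) - φ z) = ∫ z, ∫ s, f z * -q (z - s • v) ∂I := by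
    congr 1; funext z; rw [ftc z, integral_const_mul]
  rw [e2, integral_integral_swap int1]
  have e3 : ∫ x, H x * φ x = ∫ y, ∫ s, G0 (y + s • v) * φ y ∂I := by
    congr 1; funext y; rw [integral_mul_const]
  rw [e3, integral_integral_swap int2]
  apply integral_congr_ae
  filter_upwards [ae_restrict_mem measurableSet_Icc] with s hs
  have tS := tstU s hs
  have e4 : ∀ z, f z * -q (z - s • v) = -∑ i, v i * (f z * pd i (trl (-(s • v)) φ) z) := by
    intro z
    simp only [hq, mul_neg, neg_inj, Finset.mul_sum]
    apply Finset.sum_congr rfl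
    intro i _
    rw [pd_trl]; simp only [trl, ← sub_eq_add_neg]; ring
  simp only [e4]
  rw [integral_neg, integral_finset_sum _ (fun i _ => (hf.integrable_tst hP (tS.pd i)).const_mul _)]
  simp only [integral_const_mul, hw _ _ tS]
  rw [← integral_add_right_eq_self (fun y => G0 (y + s • v) * φ y) (-(s • v))]
  have e5 : ∫ z, G0 z * trl (-(s • v)) φ z = ∫ z, G z * trl (-(s • v)) φ z := by
    rw [← setIntegral_eq_integral_of_forall_compl_eq_zero (s := U), ← setIntegral_eq_integral_of_forall_compl_eq_zero (s := U) (f := fun z => G z * _)]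
    · apply integral_congr_ae
      filter_upwards [hG0U] with z hz
      rw [hz]
    · intro z hz
      rw [image_eq_zero_of_notMem_tsupport (fun h => hz (tS.2.2 h)), mul_zero]
    · intro z hz
      rw [image_eq_zero_of_notMem_tsupport (fun h => hz (tS.2.2 h)), mul_zero]
  have e6 : ∀ z, G0 (z + -(s • v) + s • v) * φ (z + -(s • v)) = G0 z * trl (-(s • v)) φ z := by
    intro z; simp [trl]
  simp only [e6, e5, hGdef, Finset.sum_mul, mul_assoc]
  rw [integral_finset_sum _ (fun i _ => ((hg i).integrable_tst hP tS).const_mul _)]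
  simp only [integral_const_mul]
  rw [← Finset.sum_neg_distrib]
  apply Finset.sum_congr rfl
  intro i _
  ring

end analysis

section firstorder
variable {d : ℕ}

lemma int_congr_ae {U : Set (Rd d)} {f f' : Rd d → ℝ} (h : f =ᵐ[volume.restrict U] f')
    {ψ : Rd d → ℝ} (hψ : tsupport ψ ⊆ U) : ∫ x, f x * ψ x = ∫ x, f' x * ψ x := by
  rw [← setIntegral_eq_integral_of_forall_compl_eq_zero (s := U),
    ← setIntegral_eq_integral_of_forall_compl_eq_zero (s := U) (f := fun z => f' z * _)]
  · apply integral_congr_ae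
    filter_upwards [h] with z hz
    rw [hz]
  · intro z hz
    rw [image_eq_zero_of_notMem_tsupport (fun h => hz (hψ h)), mul_zero]
  · intro z hz
    rw [image_eq_zero_of_notMem_tsupport (fun h => hz (hψ h)), mul_zero]

lemma WD.congr_ae {U : Set (Rd d)} {i : Fin d} {f f' g g' : Rd d → ℝ} (h : WD U i f g)
    (hf : f =ᵐ[volume.restrict U] f') (hg : g =ᵐ[volume.restrict U] g') : WD U i f' g' := by
  intro φ hφ
  rw [← int_congr_ae hf ((tsupport_pd i φ).trans hφ.2.2), ← int_congr_ae hg hφ.2.2]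
  exact h φ hφ

lemma nm_union_le {P : ℝ≥0∞} (hP : 1 ≤ P) (hP' : P ≠ ⊤) (A B : Set (Rd d)) (f : Rd d → ℝ) :
    nm P (A ∪ B) f ≤ nm P A f + nm P B f := by
  have hP0 : P ≠ 0 := (zero_lt_one.trans_le hP).ne'
  have hp : 1 ≤ P.toReal := by
    rw [← ENNReal.toReal_one]; exact (ENNReal.toReal_le_toReal (by simp) hP').2 hP
  unfold nm
  simp only [eLpNorm_eq_lintegral_rpow_enorm_toReal hP0 hP']
  refine le_trans ?_ (ENNReal.rpow_add_le_add_rpow _ _ (by positivity) ?_)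
  · exact ENNReal.rpow_le_rpow (lintegral_union_le _ _ _) (by positivity)
  · rw [one_div]; exact inv_le_one_of_one_le₀ hp

lemma nm_biUnion_le {P : ℝ≥0∞} (hP : 1 ≤ P) (hP' : P ≠ ⊤) {ι : Type*} (s : Finset ι) (A : ι → Set (Rd d))
    (f : Rd d → ℝ) : nm P (⋃ i ∈ s, A i) f ≤ ∑ i ∈ s, nm P (A i) f := by
  induction s using Finset.induction_on with
  | empty => simp [nm]
  | insert a s ha ih =>
    rw [Finset.set_biUnion_insert, Finset.sum_insert ha]
    exact (nm_union_le hP hP' _ _ _).trans (by gcongr)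

lemma diff_le' {P : ℝ≥0∞} (hP : 1 ≤ P) (hP' : P ≠ ⊤) {U W : Set (Rd d)} (hU : IsOpen U) (hW : IsOpen W)
    {f : Rd d → ℝ} {g : Fin d → Rd d → ℝ} (hf : ML P U f) (hg : ∀ i, ML P U (g i))
    (hw : ∀ i, WD U i f (g i)) (v : Rd d) (hv : ∀ y ∈ W, ∀ s ∈ Icc (0:ℝ) 1, y + s • v ∈ U) :
    nm P W (fun x => trl v f x - f x) ≤ ENNReal.ofReal ‖v‖ * ∑ i, nm P U (g i) := by
  refine (diff_le hP hP' hU hW hf hg hw v hv).trans ?_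
  refine (nm_sum_le hP _ (fun i _ => (hg i).smul (v i))).trans ?_
  rw [Finset.mul_sum]
  apply Finset.sum_le_sum
  intro i _
  rw [nm_smul]
  gcongr
  exact norm_le_pi_norm v i

lemma segment_aux {B : Set (Rd d)} (hB : Convex ℝ B) {y v : Rd d} (h0 : y ∈ B) (h1 : y + v ∈ B) :
    ∀ s ∈ Icc (0:ℝ) 1, y + s • v ∈ B := by
  intro s hs
  have := hB.add_smul_sub_mem h0 h1 hs
  simpa using this

lemma firstOrder {P : ℝ≥0∞} (hP : 1 ≤ P) (hP' : P ≠ ⊤) {y c : Rd d} {s R R' : ℝ} (hs : 0 < s)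
    (hsub : ball y s ⊆ ball c R) (hR : R' < R) :
    ∃ C : ℝ≥0, ∀ (f : Rd d → ℝ) (g : Fin d → Rd d → ℝ), ML P (ball c R) f → (∀ i, ML P (ball c R) (g i)) →
      (∀ i, WD (ball c R) i f (g i)) →
      nm P (ball c R') f ≤ C * (nm P (ball y s) f + ∑ i, nm P (ball c R) (g i)) := by
  set ε := min s (R - R') with hε
  have hε0 : 0 < ε := lt_min hs (by linarith)
  obtain ⟨T, hT, hfin, hcov⟩ := (isCompact_closedBall c R').elim_finite_subcover_image
    (b := closedBall c R') (c := fun z => ball z ε) (fun z _ => isOpen_ball)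
    (fun z hz => mem_biUnion hz (mem_ball_self hε0))
  set T' := hfin.toFinset with hT'
  refine ⟨∑ z ∈ T', (1 + ‖z - y‖₊), ?_⟩
  intro f g hf hg hw
  set S := ∑ i, nm P (ball c R) (g i) with hS
  have hyε : ball y ε ⊆ ball y s := ball_subset_ball (min_le_left _ _)
  have step : ∀ z ∈ T', nm P (ball z ε) f ≤ nm P (ball y s) f + ENNReal.ofReal ‖z - y‖ * S := by
    intro z hz
    have hzT : z ∈ closedBall c R' := hT (hfin.mem_toFinset.1 hz)
    have hzB : ball z ε ⊆ ball c R := by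
      apply ball_subset_ball'
      have := mem_closedBall.1 hzT
      have := min_le_right s (R - R')
      linarith
    have h1 : nm P (ball z ε) f ≤ nm P (ball y ε) (trl (z - y) f) := by
      have htf : ML P (ball y ε) (trl (z - y) f) := (nm_trl P measurableSet_ball measurableSet_ball (z - y) (hf.mono hzB)
        (fun w hw => by
          rw [mem_ball, dist_eq_norm] at hw ⊢
          rwa [show w + (z - y) - z = w - y by abel])).1
      have := (nm_trl P (W := ball z ε) measurableSet_ball measurableSet_ball (-(z - y)) htf
        (fun w hw => by
          rw [mem_ball, dist_eq_norm] at hw ⊢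
          rwa [show w + -(z - y) - y = w - z by abel])).2
      convert this using 2
      funext w; simp only [trl]; congr 1; abel
    have h2 : nm P (ball y ε) (fun x => trl (z - y) f x - f x) ≤ ENNReal.ofReal ‖z - y‖ * S := by
      apply diff_le' hP hP' isOpen_ball isOpen_ball hf hg hw
      intro w hw
      apply segment_aux (convex_ball c R) (hsub (hyε hw))
      apply hzB
      rw [mem_ball, dist_eq_norm] at hw ⊢
      rwa [show w + (z - y) - z = w - y by abel]
    have htf : ML P (ball y ε) (trl (z - y) f) := (nm_trl P measurableSet_ball measurableSet_ball (z - y) (hf.mono hzB)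
        (fun w hw => by
          rw [mem_ball, dist_eq_norm] at hw ⊢
          rwa [show w + (z - y) - z = w - y by abel])).1
    have hfy : ML P (ball y ε) f := hf.mono (hyε.trans hsub)
    have h3 := nm_add_le hP hfy (htf.sub hfy)
    simp only [add_sub_cancel] at h3
    calc nm P (ball z ε) f ≤ nm P (ball y ε) (trl (z - y) f) := h1
      _ ≤ _ := h3
      _ ≤ _ := add_le_add (nm_mono hyε) h2
  calc nm P (ball c R') f ≤ nm P (⋃ z ∈ T', ball z ε) f := by
        apply nm_mono
        refine ball_subset_closedBall.trans (hcov.trans ?_)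
        simp [hT']
    _ ≤ ∑ z ∈ T', nm P (ball z ε) f := nm_biUnion_le hP hP' _ _ _
    _ ≤ ∑ z ∈ T', ((1 + ‖z - y‖₊ : ℝ≥0) : ℝ≥0∞) * (nm P (ball y s) f + S) := by
        apply Finset.sum_le_sum
        intro z hz
        refine (step z hz).trans ?_
        have : ENNReal.ofReal ‖z - y‖ = (‖z - y‖₊ : ℝ≥0∞) := by
          rw [ofReal_norm_eq_enorm, enorm_eq_nnnorm]
        rw [this, ENNReal.coe_add, add_mul, mul_add, mul_add, ENNReal.coe_one, one_mul, one_mul]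
        set a := nm P (ball y s) f
        calc a + _ ≤ (a + S) + (_ * a + _ * S) := add_le_add le_self_add le_add_self
          _ = _ := rfl
    _ = _ := by rw [← Finset.sum_mul]; push_cast; rfl

lemma poincare {P : ℝ≥0∞} (hP : 1 ≤ P) (hP' : P ≠ ⊤) {x0 : Rd d} {ρ : ℝ} (hρ : 0 < ρ) {θ : Rd d → ℝ}
    (hθc : Continuous θ) (hθs : HasCompactSupport θ) (hθt : tsupport θ ⊆ ball x0 ρ) (hθi : ∫ x, θ x = 1) :
    ∃ C : ℝ≥0, ∀ (f : Rd d → ℝ) (g : Fin d → Rd d → ℝ), ML P (ball x0 (3 * ρ)) f →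
      (∀ i, ML P (ball x0 (3 * ρ)) (g i)) → (∀ i, WD (ball x0 (3 * ρ)) i f (g i)) → (∫ x, f x * θ x = 0) →
      nm P (ball x0 ρ) f ≤ C * ∑ i, nm P (ball x0 (3 * ρ)) (g i) := by
  obtain ⟨Cθ, hCθ⟩ := hθc.bounded_above_of_compact_support hθs
  set μ : Measure (Rd d) := volume.restrict (ball 0 (2 * ρ)) with hμ
  have hμu : μ univ < ⊤ := by rw [hμ, Measure.restrict_apply_univ]; exact measure_ball_lt_top
  haveI : IsFiniteMeasure μ := ⟨hμu⟩
  have hsub : ball x0 ρ ⊆ ball x0 (3 * ρ) := ball_subset_ball (by linarith)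
  refine ⟨(μ univ).toNNReal * (Cθ.toNNReal * (2 * ρ).toNNReal), ?_⟩
  intro f0 g hf0 hg hw0 hint0
  obtain ⟨f, hfm, hfeq⟩ := hf0.1
  have hf : ML P (ball x0 (3 * ρ)) f := MemLp.ae_eq hfeq hf0
  have hw : ∀ i, WD (ball x0 (3 * ρ)) i f (g i) := fun i => (hw0 i).congr_ae hfeq (ae_eq_refl _)
  have hInt : ∫ x, f x * θ x = 0 := by rw [← int_congr_ae hfeq (hθt.trans hsub)]; exact hint0
  have hnm : nm P (ball x0 ρ) f0 = nm P (ball x0 ρ) f :=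
    eLpNorm_congr_ae (ae_mono (Measure.restrict_mono hsub le_rfl) hfeq)
  rw [hnm]
  set S := ∑ i, nm P (ball x0 (3 * ρ)) (g i)
  have hfm' := hfm.measurable
  have key := nm_int μ (volume.restrict (ball x0 ρ)) (h := fun y w => Cθ * (f (y + w) - f y)) (P := P)
    (M := ENNReal.ofReal Cθ * (ENNReal.ofReal (2 * ρ) * S)) (f := f)
    (by
      apply Measurable.const_mul
      exact (hfm'.comp (measurable_fst.add measurable_snd)).sub (hfm'.comp measurable_fst)) hP hP'
    (by
      filter_upwards [ae_restrict_mem measurableSet_ball] with w hw2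
      have h1 := nm_smul P (ball x0 ρ) Cθ (fun y => trl w f y - f y)
      have hC0 : 0 ≤ Cθ := (norm_nonneg _).trans (hCθ x0)
      rw [abs_of_nonneg hC0] at h1
      change nm P (ball x0 ρ) (fun y => Cθ * (trl w f y - f y)) ≤ _
      rw [h1]
      gcongr
      have hw3 : ‖w‖ < 2 * ρ := by simpa using hw2
      refine (diff_le' hP hP' isOpen_ball isOpen_ball hf hg hw w ?_).trans ?_
      · intro y hy
        apply segment_aux (convex_ball _ _) (hsub hy)
        rw [mem_ball, dist_eq_norm] at hy ⊢
        calc ‖y + w - x0‖ = ‖(y - x0) + w‖ := by congr 1; abel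
          _ ≤ _ := norm_add_le _ _
          _ < _ := by linarith
      · gcongr)
    (by
      filter_upwards [ae_restrict_mem measurableSet_ball] with y hy
      have hθint : Integrable θ := hθc.integrable_of_hasCompactSupport hθs
      have hfθ : Integrable (fun x => f x * θ x) := hf.integrable_mul hP hθc hθs (hθt.trans hsub)
      have e1 : f y = ∫ w, θ (y + w) * (f y - f (y + w)) := by
        rw [integral_add_left_eq_self (fun z => θ z * (f y - f z)) y]
        have : ∀ z, θ z * (f y - f z) = θ z * f y - f z * θ z := fun z => by ring
        simp only [this]
        rw [integral_sub (hθint.mul_const _) hfθ, hInt, integral_mul_const, hθi]; ring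
      conv_lhs => rw [e1]
      refine (enorm_integral_le_lintegral_enorm _).trans ?_
      rw [hμ, ← lintegral_indicator measurableSet_ball]
      apply lintegral_mono
      intro w
      dsimp only
      by_cases hw4 : θ (y + w) = 0
      · simp [hw4]
      · have hmem := hθt (subset_tsupport _ hw4)
        have : w ∈ ball (0 : Rd d) (2 * ρ) := by
          rw [mem_ball, dist_eq_norm] at hmem hy ⊢
          calc ‖w - 0‖ = ‖(y + w - x0) - (y - x0)‖ := by congr 1; abel
            _ ≤ _ := norm_sub_le _ _
            _ < _ := by linarith
        rw [indicator_of_mem this, enorm_mul, enorm_mul, enorm_sub_rev]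
        gcongr
        rw [Real.enorm_eq_ofReal_abs, Real.enorm_eq_ofReal_abs]
        apply ENNReal.ofReal_le_ofReal
        exact (hCθ _).trans (le_abs_self _))
  refine key.trans (le_of_eq ?_)
  rw [ENNReal.coe_mul, ENNReal.coe_toNNReal hμu.ne, ENNReal.coe_mul]
  rw [mul_assoc, mul_assoc]; rfl

end firstorder

section polyop
variable {d : ℕ}
open Polynomial

/-- pointwise size of the `m`-th gradient of a jet -/
def gm {d : ℕ} (m : ℕ) (F : List (Fin d) → Rd d → ℝ) (x : Rd d) : ℝ :=
  ∑ j : Fin m → Fin d, |F (List.ofFn j) x|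

lemma abs_le_gm (F : List (Fin d) → Rd d → ℝ) (l : List (Fin d)) (x : Rd d) : |F l x| ≤ gm l.length F x := by
  have := Finset.single_le_sum (f := fun j : Fin l.length → Fin d => |F (List.ofFn j) x|) (fun j _ => abs_nonneg _)
    (Finset.mem_univ l.get)
  simpa [gm] using this

lemma sum_cons_le_gm (F : List (Fin d) → Rd d → ℝ) (l : List (Fin d)) (x : Rd d) :
    ∑ i, |F (i :: l) x| ≤ gm (l.length + 1) F x := by
  have hinj : Function.Injective (fun i : Fin d => (Fin.cons i l.get : Fin (l.length + 1) → Fin d)) := by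
    intro a b hab
    have := congrFun hab 0
    simpa using this
  have h1 : ∑ i, |F (i :: l) x| = ∑ j ∈ Finset.univ.image (fun i : Fin d => (Fin.cons i l.get : Fin (l.length + 1) → Fin d)),
      |F (List.ofFn j) x| := by
    rw [Finset.sum_image (fun a _ b _ h => hinj h)]
    apply Finset.sum_congr rfl
    intro i _
    congr 2
    simp [List.ofFn_succ]
  rw [h1]
  exact Finset.sum_le_sum_of_subset_of_nonneg (Finset.subset_univ _) (fun _ _ _ => abs_nonneg _)

lemma gm_nonneg (m : ℕ) (F : List (Fin d) → Rd d → ℝ) (x : Rd d) : 0 ≤ gm m F x :=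
  Finset.sum_nonneg (fun _ _ => abs_nonneg _)

lemma nm_mono_fun {P : ℝ≥0∞} {U : Set (Rd d)} (hU : MeasurableSet U) {f g : Rd d → ℝ} (h : ∀ x ∈ U, |f x| ≤ g x) :
    nm P U f ≤ nm P U g := by
  apply eLpNorm_mono_ae
  filter_upwards [ae_restrict_mem hU] with x hx
  exact (h x hx).trans (le_abs_self _)

lemma nm_le_gm {P : ℝ≥0∞} {U : Set (Rd d)} (F : List (Fin d) → Rd d → ℝ) (l : List (Fin d)) :
    nm P U (F l) ≤ nm P U (gm l.length F) := by
  apply eLpNorm_mono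
  intro x
  exact (abs_le_gm F l x).trans (le_abs_self _)

lemma ML.abs {P : ℝ≥0∞} {U : Set (Rd d)} {f : Rd d → ℝ} (hf : ML P U f) : ML P U (fun x => |f x|) := MemLp.norm hf

lemma nm_abs {P : ℝ≥0∞} {U : Set (Rd d)} (f : Rd d → ℝ) : nm P U (fun x => |f x|) = nm P U f := eLpNorm_norm f

lemma ML.gm {P : ℝ≥0∞} {U : Set (Rd d)} {m : ℕ} {F : List (Fin d) → Rd d → ℝ}
    (hF : ∀ l, l.length = m → ML P U (F l)) : ML P U (gm m F) :=
  ML.sum _ (fun j _ => (hF _ (by simp)).abs)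

lemma nm_gm_le {P : ℝ≥0∞} (hP : 1 ≤ P) {U : Set (Rd d)} {m : ℕ} {F : List (Fin d) → Rd d → ℝ}
    (hF : ∀ l, l.length = m → ML P U (F l)) {M : ℝ≥0∞} (hM : ∀ l, l.length = m → nm P U (F l) ≤ M) :
    nm P U (gm m F) ≤ (d : ℝ≥0∞) ^ m * M := by
  refine (nm_sum_le hP _ (fun j _ => (hF _ (by simp)).abs)).trans ?_
  calc _ ≤ ∑ j : Fin m → Fin d, M := Finset.sum_le_sum (fun j _ => by rw [nm_abs]; exact hM _ (by simp))
    _ = _ := by simp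

lemma jet_diff {P : ℝ≥0∞} (hP : 1 ≤ P) (hP' : P ≠ ⊤) {U W : Set (Rd d)} (hU : IsOpen U) (hW : IsOpen W)
    {n : ℕ} {F : List (Fin d) → Rd d → ℝ} (hF : Jet P U n F) {l : List (Fin d)} (hl : l.length < n)
    (v : Rd d) (hv : ∀ y ∈ W, ∀ s ∈ Icc (0:ℝ) 1, y + s • v ∈ U) :
    nm P W (fun x => trl v (F l) x - F l x) ≤ ENNReal.ofReal ‖v‖ * nm P U (gm (l.length + 1) F) := by
  refine (diff_le hP hP' hU hW (hF.mem _ hl.le) (g := fun i => F (i :: l)) (fun i => hF.mem _ hl) (fun i => hF.wd _ _ hl) v hv).trans ?_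
  rw [← abs_of_nonneg (norm_nonneg v), ← nm_smul]
  apply nm_mono_fun hU.measurableSet
  intro x _
  calc |∑ i, v i * F (i :: l) x| ≤ ∑ i, |v i * F (i :: l) x| := Finset.abs_sum_le_sum_abs _ _
    _ ≤ ∑ i, ‖v‖ * |F (i :: l) x| := by
        apply Finset.sum_le_sum; intro i _
        rw [abs_mul]; gcongr; exact norm_le_pi_norm v i
    _ = ‖v‖ * ∑ i, |F (i :: l) x| := by rw [Finset.mul_sum]
    _ ≤ _ := by gcongr; exact sum_cons_le_gm F l x

/-- translation operator -/
def Tm (v : Rd d) : Module.End ℝ (Rd d → ℝ) where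
  toFun f := trl v f
  map_add' _ _ := rfl
  map_smul' _ _ := rfl

lemma Tm_apply (v : Rd d) (f : Rd d → ℝ) : Tm v f = trl v f := rfl

lemma Tm_pow (v : Rd d) (k : ℕ) (f : Rd d → ℝ) : (Tm v ^ k) f = trl ((k : ℝ) • v) f := by
  induction k with
  | zero => funext x; simp [trl]
  | succ k ih =>
    rw [pow_succ', Module.End.mul_apply, ih, Tm_apply]
    funext x
    simp only [trl]
    congr 1
    push_cast
    rw [add_smul, one_smul]; abel

/-- polynomial in the translation operator -/
def pq (q : ℝ[X]) (v : Rd d) : Module.End ℝ (Rd d → ℝ) := aeval (Tm v) q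

lemma pq_apply (q : ℝ[X]) (v : Rd d) (f : Rd d → ℝ) :
    pq q v f = fun x => ∑ k ∈ q.support, q.coeff k * trl ((k : ℝ) • v) f x := by
  funext x
  rw [pq, aeval_def, eval₂_eq_sum, Polynomial.sum_def]
  simp only [LinearMap.sum_apply, Finset.sum_apply, Module.End.mul_apply]
  apply Finset.sum_congr rfl
  intro k _
  rw [Tm_pow]
  simp [Algebra.algebraMap_eq_smul_one]

lemma pq_mul (q r : ℝ[X]) (v : Rd d) (f : Rd d → ℝ) : pq (q * r) v f = pq q v (pq r v f) := by
  simp [pq]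

lemma pq_add (q r : ℝ[X]) (v : Rd d) (f : Rd d → ℝ) (x : Rd d) : pq (q + r) v f x = pq q v f x + pq r v f x := by
  simp [pq]

lemma pq_sub (q r : ℝ[X]) (v : Rd d) (f : Rd d → ℝ) (x : Rd d) : pq (q - r) v f x = pq q v f x - pq r v f x := by
  simp [pq]

/-- sum of absolute values of the coefficients -/
def cs (q : ℝ[X]) : ℝ≥0 := ∑ k ∈ q.support, ‖q.coeff k‖₊

lemma pq_bound {P : ℝ≥0∞} (hP : 1 ≤ P) {U W : Set (Rd d)} (hU : MeasurableSet U) (hW : MeasurableSet W)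
    (q : ℝ[X]) (v : Rd d) (h : ∀ y ∈ W, ∀ k ∈ q.support, y + (k : ℝ) • v ∈ U) {f : Rd d → ℝ} (hf : ML P U f) :
    ML P W (pq q v f) ∧ nm P W (pq q v f) ≤ cs q * nm P U f := by
  rw [pq_apply]
  have h1 : ∀ k ∈ q.support, ML P W (trl ((k : ℝ) • v) f) ∧ nm P W (trl ((k : ℝ) • v) f) ≤ nm P U f :=
    fun k hk => nm_trl P hW hU _ hf (fun y hy => h y hy k hk)
  refine ⟨ML.sum _ (fun k hk => (h1 k hk).1.smul _), ?_⟩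
  refine (nm_sum_le hP _ (fun k hk => (h1 k hk).1.smul _)).trans ?_
  rw [cs, ENNReal.coe_finset_sum, Finset.sum_mul]
  apply Finset.sum_le_sum
  intro k hk
  rw [nm_smul]
  have : ENNReal.ofReal |q.coeff k| = (‖q.coeff k‖₊ : ℝ≥0∞) := by
    rw [← Real.enorm_eq_ofReal_abs]; rfl
  rw [this]
  gcongr
  exact (h1 k hk).2

lemma Jet.pq {P : ℝ≥0∞} (hP : 1 ≤ P) {U W : Set (Rd d)} (hU : MeasurableSet U) (hW : MeasurableSet W)
    (q : ℝ[X]) (v : Rd d) (h : ∀ y ∈ W, ∀ k ∈ q.support, y + (k : ℝ) • v ∈ U)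
    {n : ℕ} {F : List (Fin d) → Rd d → ℝ} (hF : Jet P U n F) : Jet P W n (fun l => pq q v (F l)) := by
  refine ⟨fun l hl => (pq_bound hP hU hW q v h (hF.mem l hl)).1, ?_⟩
  intro l i hl
  simp only [pq_apply]
  have h1 : ∀ k ∈ q.support, ∀ f, ML P U f → ML P W (trl ((k : ℝ) • v) f) :=
    fun k hk f hf => (nm_trl P hW hU _ hf (fun y hy => h y hy k hk)).1
  apply WD.sum hP
  · intro k hk
    exact (((hF.wd l i hl).trl ((k : ℝ) • v)).mono (fun y hy => h y hy k hk)).smul _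
  · intro k hk; exact (h1 k hk _ (hF.mem _ hl.le)).smul _
  · intro k hk; exact (h1 k hk _ (hF.mem (i :: l) (by simpa using hl))).smul _

/-- the core set -/
lemma isOpen_core {V : Set (Rd d)} (hV : IsOpen V) (v : Rd d) (a b : ℝ) :
    IsOpen {y : Rd d | ∀ s ∈ Icc a b, y + s • v ∈ V} := by
  rw [isOpen_iff_mem_nhds]
  intro y hy
  have := isCompact_Icc.eventually_forall_of_forall_eventually (x₀ := y) (K := Icc a b)
    (P := fun y s => y + s • v ∈ V) (by
      intro s hs
      have hc : Continuous (fun q : Rd d × ℝ => q.1 + q.2 • v) := by fun_prop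
      exact hc.continuousAt.eventually (hV.mem_nhds (hy s hs)))
  exact this

lemma diffpow_bound {P : ℝ≥0∞} (hP : 1 ≤ P) (hP' : P ≠ ⊤) (v : Rd d) (n m : ℕ) : 
    ∀ {U W : Set (Rd d)} (hU : IsOpen U) (hW : IsOpen W)
    {F : List (Fin d) → Rd d → ℝ} (hF : Jet P U n F) {l : List (Fin d)} (hl : l.length + m ≤ n)
    (hv : ∀ y ∈ W, ∀ s ∈ Icc (0:ℝ) m, y + s • v ∈ U),
    nm P W (pq ((X - 1) ^ m) v (F l)) ≤ (((d + 1 : ℕ) : ℝ≥0∞) ^ n * ENNReal.ofReal ‖v‖) ^ m * nm P U (gm (l.length + m) F) := by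
  induction m with
  | zero =>
    intro U W hU hW F hF l hl hv
    have hWU : W ⊆ U := fun y hy => by simpa using hv y hy 0 (by simp)
    have : pq ((X - 1) ^ 0) v (F l) = F l := by simp [pq]
    rw [this, pow_zero, one_mul]
    exact (nm_mono hWU).trans (nm_le_gm F l)
  | succ m ih =>
    intro U W hU hW F hF l hl hv
    set W' : Set (Rd d) := {y | ∀ s ∈ Icc (0:ℝ) 1, y + s • v ∈ U} with hW'
    have hW'o : IsOpen W' := isOpen_core hU v 0 1
    have hpq : ∀ f : Rd d → ℝ, pq (X - 1) v f = fun x => trl v f x - f x := by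
      intro f; funext x; simp [pq, Tm_apply]
    have hsup : ∀ y ∈ W', ∀ k ∈ (X - 1 : ℝ[X]).support, y + (k : ℝ) • v ∈ U := by
      intro y hy k hk
      apply hy
      have : k ≤ (X - 1 : ℝ[X]).natDegree := le_natDegree_of_mem_supp _ hk
      have hd : (X - 1 : ℝ[X]).natDegree ≤ 1 := by
        have := natDegree_X_sub_C_le (1 : ℝ); simpa using this
      refine ⟨by positivity, ?_⟩
      exact_mod_cast this.trans hd
    have hG : Jet P W' n (fun l => pq (X - 1) v (F l)) := Jet.pq hP hU.measurableSet hW'o.measurableSet _ _ hsup hF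
    have h1 := ih hW'o hW hG (l := l) (by omega) (by
      intro y hy s hs r hr
      have := hv y hy (s + r) ⟨by linarith [hs.1, hr.1], by push_cast; linarith [hs.2, hr.2]⟩
      rwa [add_smul, ← add_assoc] at this)
    rw [pow_succ (X - 1 : ℝ[X]), pq_mul]
    refine h1.trans ?_
    have h2 : nm P W' (gm (l.length + m) fun l => pq (X - 1) v (F l)) ≤
        (((d + 1 : ℕ) : ℝ≥0∞) ^ n * ENNReal.ofReal ‖v‖) * nm P U (gm (l.length + (m + 1)) F) := by
      refine (nm_gm_le hP (M := ENNReal.ofReal ‖v‖ * nm P U (gm (l.length + (m + 1)) F)) (fun l' hl' => hG.mem _ (by omega)) ?_).trans ?_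
      · intro l' hl'
        rw [hpq]
        have := jet_diff hP hP' hU hW'o hF (l := l') (by omega) v (fun y hy => hy)
        rwa [hl'] at this
      · rw [mul_assoc]
        refine mul_le_mul' ?_ le_rfl
        calc (d : ℝ≥0∞) ^ (l.length + m) ≤ ((d + 1 : ℕ) : ℝ≥0∞) ^ (l.length + m) := by
              gcongr; omega
          _ ≤ _ := pow_le_pow_right₀ (by exact_mod_cast Nat.le_add_left 1 d) (by omega)
    calc _ ≤ _ := mul_le_mul_right h2 _
      _ = _ := by rw [pow_succ]; ring

lemma poly_bound {P : ℝ≥0∞} (hP : 1 ≤ P) (hP' : P ≠ ⊤) (v : Rd d) {n m : ℕ} {V W : Set (Rd d)}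
    (hV : IsOpen V) (hW : MeasurableSet W) {F : List (Fin d) → Rd d → ℝ} (hF : Jet P V n F)
    {l : List (Fin d)} (hl : l.length + m ≤ n) (r : ℝ[X]) {B : ℕ} (hr : r.natDegree + 1 + m ≤ B)
    (hv : ∀ y ∈ W, ∀ s ∈ Icc (1:ℝ) B, y + s • v ∈ V) :
    nm P W (pq (X * r * (X - 1) ^ m) v (F l)) ≤
      cs (X * r) * ((((d + 1 : ℕ) : ℝ≥0∞) ^ n * ENNReal.ofReal ‖v‖) ^ m * nm P V (gm (l.length + m) F)) := by
  set W' : Set (Rd d) := {y | ∀ s ∈ Icc (0:ℝ) m, y + s • v ∈ V} with hW'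
  have hW'o : IsOpen W' := isOpen_core hV v 0 m
  have h1 := diffpow_bound hP hP' v n m hV hW'o hF hl (fun y hy => hy)
  have hml : ML P W' (pq ((X - 1) ^ m) v (F l)) := by
    apply (pq_bound hP hV.measurableSet hW'o.measurableSet _ v _ (hF.mem l (by omega))).1
    intro y hy k hk
    apply hy
    have : k ≤ ((X - 1 : ℝ[X]) ^ m).natDegree := le_natDegree_of_mem_supp _ hk
    have hd : ((X - 1 : ℝ[X]) ^ m).natDegree ≤ m := by
      have h1 := natDegree_pow_le_of_le m (natDegree_X_sub_C_le (1 : ℝ)); simpa using h1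
    exact ⟨by positivity, by exact_mod_cast this.trans hd⟩
  rw [pq_mul]
  refine (pq_bound hP hW'o.measurableSet hW (X * r) v ?_ hml).2.trans (by gcongr)
  intro y hy k hk s hs
  have hk1 : 1 ≤ k := by
    by_contra h0
    have : k = 0 := by omega
    subst this
    simp at hk
  have hk2 : k ≤ r.natDegree + 1 := by
    refine (le_natDegree_of_mem_supp _ hk).trans ?_
    refine natDegree_mul_le.trans ?_
    have := natDegree_X_le (R := ℝ)
    omega
  have := hv y hy (k + s) ⟨by have : (1:ℝ) ≤ k := by exact_mod_cast hk1
                              linarith [hs.1], by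
      have h3 : ((k + m : ℕ) : ℝ) ≤ B := by exact_mod_cast (by omega : k + m ≤ B)
      push_cast at h3
      linarith [hs.2]⟩
  rwa [add_smul, ← add_assoc] at this

end polyop

section leibniz
variable {d : ℕ}

/-- Leibniz expansion of the `l`-derivative of a product -/
def Leib : List (Fin d) → (List (Fin d) → Rd d → ℝ) → (List (Fin d) → Rd d → ℝ) → Rd d → ℝ
  | [], Ψ, F => fun x => Ψ [] x * F [] x
  | i :: l, Ψ, F => fun x => Leib l (fun a => Ψ (i :: a)) F x + Leib l Ψ (fun b => F (i :: b)) x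

lemma Leib_congr (l : List (Fin d)) {Ψ F Ψ' F' : List (Fin d) → Rd d → ℝ} {x : Rd d}
    (h : ∀ a b, a.length + b.length = l.length → Ψ a x * F b x = Ψ' a x * F' b x) :
    Leib l Ψ F x = Leib l Ψ' F' x := by
  induction l generalizing Ψ F Ψ' F' with
  | nil => exact h [] [] rfl
  | cons i l ih =>
    simp only [Leib]
    rw [ih (Ψ := fun a => Ψ (i :: a)) (F := F) (Ψ' := fun a => Ψ' (i :: a)) (F' := F'),
      ih (Ψ := Ψ) (F := fun b => F (i :: b)) (Ψ' := Ψ') (F' := fun b => F' (i :: b))]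
    · intro a b hab
      exact h a (i :: b) (by simp; omega)
    · intro a b hab
      exact h (i :: a) b (by simp; omega)

lemma Leib_zero (l : List (Fin d)) {Ψ F : List (Fin d) → Rd d → ℝ} {x : Rd d}
    (h : ∀ a b, a.length + b.length = l.length → Ψ a x * F b x = 0) : Leib l Ψ F x = 0 := by
  induction l generalizing Ψ F with
  | nil => exact h [] [] rfl
  | cons i l ih =>
    simp only [Leib]
    rw [ih (Ψ := fun a => Ψ (i :: a)) (F := F), ih (Ψ := Ψ) (F := fun b => F (i :: b)), add_zero]
    · intro a b hab
      exact h a (i :: b) (by simp; omega)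
    · intro a b hab
      exact h (i :: a) b (by simp; omega)

lemma Leib_one (l : List (Fin d)) {Ψ F : List (Fin d) → Rd d → ℝ} {x : Rd d}
    (h1 : Ψ [] x = 1) (h : ∀ a, a ≠ [] → Ψ a x = 0) : Leib l Ψ F x = F l x := by
  induction l generalizing F with
  | nil => simp [Leib, h1]
  | cons i l ih =>
    simp only [Leib]
    rw [ih (F := fun b => F (i :: b)), Leib_zero l, zero_add]
    intro a b hab
    rw [h (i :: a) (by simp), zero_mul]

lemma Leib_sum_left {ι : Type*} (s : Finset ι) (l : List (Fin d)) (Ψ : ι → List (Fin d) → Rd d → ℝ)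
    (F : List (Fin d) → Rd d → ℝ) (x : Rd d) :
    Leib l (fun a y => ∑ k ∈ s, Ψ k a y) F x = ∑ k ∈ s, Leib l (Ψ k) F x := by
  induction l generalizing Ψ F with
  | nil => simp [Leib, Finset.sum_mul]
  | cons i l ih =>
    simp only [Leib]
    rw [ih (fun k a => Ψ k (i :: a)) F, ih Ψ, Finset.sum_add_distrib]

lemma Leib_sub_right (l : List (Fin d)) (Ψ F G : List (Fin d) → Rd d → ℝ) (x : Rd d) :
    Leib l Ψ (fun b y => F b y - G b y) x = Leib l Ψ F x - Leib l Ψ G x := by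
  induction l generalizing Ψ F G with
  | nil => simp [Leib, mul_sub]
  | cons i l ih =>
    simp only [Leib]
    rw [ih, ih]; ring

lemma Leib_ML {P : ℝ≥0∞} (hP : 1 ≤ P) {U : Set (Rd d)} (l : List (Fin d)) {Ψ F : List (Fin d) → Rd d → ℝ} {M : ℝ≥0∞}
    (h : ∀ a b, a.length + b.length = l.length → ML P U (fun x => Ψ a x * F b x) ∧ nm P U (fun x => Ψ a x * F b x) ≤ M) :
    ML P U (Leib l Ψ F) ∧ nm P U (Leib l Ψ F) ≤ 2 ^ l.length * M := by
  induction l generalizing Ψ F with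
  | nil => simpa [Leib] using h [] [] rfl
  | cons i l ih =>
    simp only [Leib]
    have h1 := ih (Ψ := fun a => Ψ (i :: a)) (F := F) (fun a b hab => h (i :: a) b (by simp; omega))
    have h2 := ih (Ψ := Ψ) (F := fun b => F (i :: b)) (fun a b hab => h a (i :: b) (by simp; omega))
    refine ⟨h1.1.add h2.1, (nm_add_le hP h1.1 h2.1).trans ((add_le_add h1.2 h2.2).trans (le_of_eq ?_))⟩
    rw [List.length_cons, pow_succ]; ring

lemma Leib_WD {P : ℝ≥0∞} (hP : 1 ≤ P) {U : Set (Rd d)} (i : Fin d) (l : List (Fin d))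
    {Ψ F Ψ' F' : List (Fin d) → Rd d → ℝ}
    (h0 : ∀ a b, a.length + b.length = l.length → ML P U (fun x => Ψ a x * F b x) ∧
      ML P U (fun x => Ψ' a x * F b x + Ψ a x * F' b x) ∧
      WD U i (fun x => Ψ a x * F b x) (fun x => Ψ' a x * F b x + Ψ a x * F' b x)) :
    ML P U (Leib l Ψ F) ∧ ML P U (fun x => Leib l Ψ' F x + Leib l Ψ F' x) ∧
    WD U i (Leib l Ψ F) (fun x => Leib l Ψ' F x + Leib l Ψ F' x) := by
  induction l generalizing Ψ F Ψ' F' with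
  | nil => exact h0 [] [] rfl
  | cons j l ih =>
    simp only [Leib]
    have h1 := ih (Ψ := fun a => Ψ (j :: a)) (F := F) (Ψ' := fun a => Ψ' (j :: a)) (F' := F')
      (fun a b hab => h0 (j :: a) b (by simp; omega))
    have h2 := ih (Ψ := Ψ) (F := fun b => F (j :: b)) (Ψ' := Ψ') (F' := fun b => F' (j :: b))
      (fun a b hab => h0 a (j :: b) (by simp; omega))
    have e : (fun x => Leib l (fun a => Ψ' (j :: a)) F x + Leib l Ψ' (fun b => F (j :: b)) x +
        (Leib l (fun a => Ψ (j :: a)) F' x + Leib l Ψ (fun b => F' (j :: b)) x)) =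
        fun x => (Leib l (fun a => Ψ' (j :: a)) F x + Leib l (fun a => Ψ (j :: a)) F' x) +
          (Leib l Ψ' (fun b => F (j :: b)) x + Leib l Ψ (fun b => F' (j :: b)) x) := by
      funext x; ring
    rw [e]
    exact ⟨h1.1.add h2.1, h1.2.1.add h2.2.1, h1.2.2.add hP h2.2.2 h1.1 h1.2.1 h2.1 h2.2.1⟩

lemma ML.mul_bdd {P : ℝ≥0∞} {U V : Set (Rd d)} (hU : MeasurableSet U) (hV : MeasurableSet V)
    {ψ f : Rd d → ℝ} (hψ : Continuous ψ) {C : ℝ} (hC : ∀ x ∈ U, |ψ x| ≤ C) (hz : ∀ x ∈ U, x ∉ V → ψ x = 0)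
    (hf : ML P V f) : ML P U (fun x => ψ x * f x) ∧ nm P U (fun x => ψ x * f x) ≤ ENNReal.ofReal C * nm P V f := by
  have e : ∀ x ∈ U, V.indicator (fun x => ψ x * f x) x = ψ x * f x := by
    intro x hx
    by_cases hv : x ∈ V
    · rw [indicator_of_mem hv]
    · rw [indicator_of_notMem hv, hz x hx hv, zero_mul]
  have hb : nm P (U ∩ V) (fun x => ψ x * f x) ≤ ENNReal.ofReal C * nm P V f := by
    refine (eLpNorm_le_mul_eLpNorm_of_ae_le_mul (c := C) (g := f) ?_ P).trans (mul_le_mul' le_rfl (nm_mono inter_subset_right))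
    filter_upwards [ae_restrict_mem (hU.inter hV)] with x hx
    rw [norm_mul]
    exact mul_le_mul_of_nonneg_right (hC x hx.1) (norm_nonneg _)
  have hn : nm P U (fun x => ψ x * f x) = nm P (U ∩ V) (fun x => ψ x * f x) := by
    rw [← nm_congr hU e]
    unfold nm
    rw [eLpNorm_indicator_eq_eLpNorm_restrict hV, Measure.restrict_restrict hV, inter_comm]
  rw [hn]
  refine ⟨?_, hb⟩
  apply ML.congr hU _ e
  refine ⟨?_, ?_⟩
  · rw [aestronglyMeasurable_indicator_iff hV, Measure.restrict_restrict hV]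
    exact hψ.aestronglyMeasurable.mul (hf.1.mono_measure (Measure.restrict_mono inter_subset_left le_rfl))
  · have := nm_congr (P := P) hU e
    unfold nm at this
    rw [this]
    change nm P U _ < ⊤
    rw [hn]
    exact lt_of_le_of_lt hb (ENNReal.mul_lt_top ENNReal.ofReal_lt_top hf.2)

lemma pdl_zero_off (a : List (Fin d)) (ψ : Rd d → ℝ) : tsupport (pdl a ψ) ⊆ tsupport ψ := by
  induction a with
  | nil => exact subset_rfl
  | cons i a ih => exact (tsupport_pd i _).trans ih

lemma Jet.leib {P : ℝ≥0∞} (hP : 1 ≤ P) {U V : Set (Rd d)} (hU : MeasurableSet U) (hV : MeasurableSet V)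
    {n : ℕ} {F : List (Fin d) → Rd d → ℝ} (hF : Jet P V n F) {ψ : Rd d → ℝ} (hψ : Sm ψ)
    (hs : U ∩ tsupport ψ ⊆ V) {C : ℝ} (hC : ∀ a, a.length ≤ n → ∀ x ∈ U, |pdl a ψ x| ≤ C) :
    Jet P U n (fun l => Leib l (fun a => pdl a ψ) F) := by
  have hz : ∀ a, ∀ x ∈ U, x ∉ V → pdl a ψ x = 0 := by
    intro a x hx hxV
    by_contra h0
    exact hxV (hs ⟨hx, pdl_zero_off a ψ (subset_tsupport _ h0)⟩)
  have hml : ∀ a b : List (Fin d), a.length ≤ n → b.length ≤ n → ML P U (fun x => pdl a ψ x * F b x) :=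
    fun a b ha hb => (ML.mul_bdd hU hV (hψ.pdl a).continuous (hC a ha) (hz a) (hF.mem b hb)).1
  refine ⟨?_, ?_⟩
  · intro l hl
    refine (Leib_ML hP l (M := ⊤) ?_).1
    intro a b hab
    exact ⟨hml a b (by omega) (by omega), le_top⟩
  · intro l i hl
    refine (Leib_WD hP i l (Ψ' := fun a => pdl (i :: a) ψ) (F' := fun b => F (i :: b)) ?_).2.2
    intro a b hab
    refine ⟨hml a b (by omega) (by omega), (hml (i :: a) b (by simp; omega) (by omega)).add (hml a (i :: b) (by omega) (by simp; omega)), ?_⟩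
    exact WD.mul hP (hF.wd b i (by omega)) (hF.mem b (by omega)) (hF.mem (i :: b) (by simp; omega)) (hψ.pdl a)
      (fun x hx => hs ⟨hx.1, pdl_zero_off a ψ hx.2⟩)

end leibniz

section cutoff
variable {d : ℕ}
open ContinuousLinearMap

lemma pd_conv {χ f : Rd d → ℝ} (hχ : LocallyIntegrable χ) (hf : Sm f) (hc : HasCompactSupport f) (i : Fin d) :
    pd i (convolution χ f (lsmul ℝ ℝ) volume) = convolution χ (pd i f) (lsmul ℝ ℝ) volume := by
  funext x
  have h := hc.hasFDerivAt_convolution_right (lsmul ℝ ℝ) hχ (hf.of_le (by simp)) x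
  rw [HC.pd, h.fderiv]
  have hfc : Continuous (fderiv ℝ f) := hf.continuous_fderiv (by simp)
  rw [convolution_precompR_apply (lsmul ℝ ℝ) hχ (hc.fderiv ℝ) hfc x (Pi.single i 1)]
  rfl

lemma pdl_conv {χ f : Rd d → ℝ} (hχ : LocallyIntegrable χ) (hf : Sm f) (hc : HasCompactSupport f) (l : List (Fin d)) :
    pdl l (convolution χ f (lsmul ℝ ℝ) volume) = convolution χ (pdl l f) (lsmul ℝ ℝ) volume := by
  induction l with
  | nil => rfl
  | cons i l ih =>
    have ht : Tst univ (pdl l f) := Tst.pdl ⟨hf, hc, subset_univ _⟩ l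
    simp only [pdl, ih]
    exact pd_conv hχ ht.1 ht.2.1 i

lemma pdl_scale {f : Rd d → ℝ} (hf : Sm f) (c : ℝ) (l : List (Fin d)) :
    pdl l (fun y => f (c • y)) = fun y => c ^ l.length * pdl l f (c • y) := by
  induction l with
  | nil => funext y; simp [pdl]
  | cons i l ih =>
    simp only [pdl, ih]
    funext y
    have hd : DifferentiableAt ℝ (pdl l f) (c • y) := (hf.pdl l).diff _
    have h1 : HasFDerivAt (fun y : Rd d => c • y) (c • ContinuousLinearMap.id ℝ (Rd d)) y :=
      (hasFDerivAt_id y).const_smul c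
    have h2 := (hd.hasFDerivAt.comp y h1).const_mul (c ^ l.length)
    simp only [HC.pd]
    have h3 : (fun y => c ^ l.length * pdl l f (c • y)) = fun y => c ^ l.length * (pdl l f ∘ fun y => c • y) y := rfl
    rw [h3, h2.fderiv]
    simp [pow_succ]; ring

lemma cutoff (d : ℕ) (K : ℝ≥0) (n : ℕ) : ∃ C : ℝ, 0 ≤ C ∧ ∀ s : ℝ, 0 < s → ∀ t : Rd d → ℝ, LipschitzWith K t →
    ∃ θ : Rd d → ℝ, Sm θ ∧ (∀ y, t y < 5 / 4 * s → θ y = 1) ∧ (∀ y, 7 / 4 * s < t y → θ y = 0) ∧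
      ∀ l : List (Fin d), l.length ≤ n → ∀ y, |pdl l θ y| ≤ C * s⁻¹ ^ l.length := by
  have hK0 : (0:ℝ) ≤ K := K.2
  set ε : ℝ := 1 / (8 * (K + 1)) with hε
  have hε0 : 0 < ε := by positivity
  have hKε : K * ε < 1 / 4 := by
    rw [hε, mul_one_div, div_lt_div_iff₀ (by positivity) (by norm_num)]
    linarith
  let b : ContDiffBump (0 : Rd d) := ⟨ε / 2, ε, by positivity, by linarith⟩
  set ψ : Rd d → ℝ := b.normed volume with hψ
  have hψs : Sm ψ := b.contDiff_normed
  have hψc : HasCompactSupport ψ := b.hasCompactSupport_normed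
  have hψ1 : ∫ x, ψ x = 1 := b.integral_normed
  have hψsup : ∀ x, ε ≤ ‖x‖ → ψ x = 0 := by
    intro x hx
    by_contra h0
    have : x ∈ Function.support ψ := h0
    rw [hψ, b.support_normed_eq] at this
    simp [b] at this
    linarith
  set C : ℝ := ∑ m ∈ Finset.range (n + 1), ∑ j : Fin m → Fin d, ∫ x, |pdl (List.ofFn j) ψ x| with hC
  have hCl : ∀ l : List (Fin d), l.length ≤ n → ∫ x, |pdl l ψ x| ≤ C := by
    intro l hl
    have h1 : ∫ x, |pdl l ψ x| ≤ ∑ j : Fin l.length → Fin d, ∫ x, |pdl (List.ofFn j) ψ x| := by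
      have := Finset.single_le_sum (f := fun j : Fin l.length → Fin d => ∫ x, |pdl (List.ofFn j) ψ x|)
        (fun j _ => integral_nonneg fun _ => abs_nonneg _) (Finset.mem_univ l.get)
      simpa using this
    refine h1.trans ?_
    exact Finset.single_le_sum (f := fun m => ∑ j : Fin m → Fin d, ∫ x, |pdl (List.ofFn j) ψ x|)
        (fun m _ => Finset.sum_nonneg fun j _ => integral_nonneg fun _ => abs_nonneg _) (Finset.mem_range.2 (by omega))
  refine ⟨C, Finset.sum_nonneg fun m _ => Finset.sum_nonneg fun j _ => integral_nonneg fun _ => abs_nonneg _, ?_⟩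
  intro s hs t ht
  set A : Set (Rd d) := {z | t (s • z) < 3 / 2 * s} with hA
  have htc : Continuous t := ht.continuous
  have hAm : MeasurableSet A := (isOpen_lt (by fun_prop) (by fun_prop)).measurableSet
  set χ : Rd d → ℝ := A.indicator 1 with hχ
  have hχm : Measurable χ := measurable_one.indicator hAm
  have hχb : ∀ x, |χ x| ≤ 1 := by
    intro x
    by_cases hx : x ∈ A
    · simp [hχ, hx]
    · simp [hχ, hx]
  have hχl : LocallyIntegrable χ := by
    apply (locallyIntegrable_const (1:ℝ)).mono hχm.aestronglyMeasurable
    exact ae_of_all _ (fun x => by simpa using hχb x)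
  set θ1 : Rd d → ℝ := convolution χ ψ (lsmul ℝ ℝ) volume with hθ1
  have hθsmooth : Sm θ1 := hψc.contDiff_convolution_right _ hχl hψs
  have hval : ∀ (c : ℝ) (x : Rd d), (∀ w, ‖x - w‖ < ε → χ w = c) → θ1 x = c := by
    intro c x hx
    have : θ1 x = ∫ w, c * ψ (x - w) := by
      rw [hθ1, convolution_def]
      congr 1; funext w
      simp only [lsmul_apply, smul_eq_mul]
      by_cases hw : ‖x - w‖ < ε
      · rw [hx w hw]
      · rw [hψsup _ (not_lt.1 hw)]; simp
    rw [this, integral_const_mul, integral_sub_left_eq_self ψ volume x, hψ1, mul_one]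
  have hdist : ∀ x w : Rd d, ‖x - w‖ < ε → |t (s • x) - t (s • w)| < s / 4 := by
    intro x w hw
    have h1 := ht.dist_le_mul (s • x) (s • w)
    rw [Real.dist_eq, dist_eq_norm, ← smul_sub, norm_smul, Real.norm_of_nonneg hs.le] at h1
    calc _ ≤ K * (s * ‖x - w‖) := h1
      _ ≤ K * (s * ε) := by gcongr
      _ = s * (K * ε) := by ring
      _ < s * (1 / 4) := by gcongr
      _ = _ := by ring
  refine ⟨fun y => θ1 (s⁻¹ • y), hθsmooth.comp (contDiff_const_smul _), ?_, ?_, ?_⟩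
  · intro y hy
    apply hval
    intro w hw
    have := hdist _ _ hw
    rw [smul_inv_smul₀ hs.ne', abs_lt] at this
    have hwA : w ∈ A := by
      simp only [hA, mem_setOf_eq]; linarith
    simp [hχ, hwA]
  · intro y hy
    apply hval
    intro w hw
    have := hdist _ _ hw
    rw [smul_inv_smul₀ hs.ne', abs_lt] at this
    have hwA : w ∉ A := by
      simp only [hA, mem_setOf_eq, not_lt]; linarith
    simp [hχ, hwA]
  · intro l hl y
    rw [pdl_scale hθsmooth, abs_mul, abs_of_nonneg (by positivity), mul_comm]
    gcongr
    rw [hθ1, pdl_conv hχl hψs hψc, convolution_def]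
    refine le_trans ?_ (hCl l hl)
    have ht : Tst univ (pdl l ψ) := Tst.pdl ⟨hψs, hψc, subset_univ _⟩ l
    have hin : Integrable (pdl l ψ) := ht.1.continuous.integrable_of_hasCompactSupport ht.2.1
    rw [← integral_sub_left_eq_self (fun x => |pdl l ψ x|) volume (s⁻¹ • y), ← Real.norm_eq_abs]
    apply norm_integral_le_of_norm_le (hin.abs.comp_sub_left _)
    refine ae_of_all _ (fun w => ?_)
    simp only [lsmul_apply, smul_eq_mul, norm_mul]
    calc _ ≤ 1 * |pdl l ψ (s⁻¹ • y - w)| := mul_le_mul_of_nonneg_right (hχb w) (abs_nonneg _)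
      _ = _ := one_mul _

end cutoff

/-! ## Local extension across a Lipschitz graph -/

section localext
variable {d : ℕ}
open Polynomial

lemma pdl_const_loc {ψ : Rd d → ℝ} {c : ℝ} {y : Rd d} (h : ∀ᶠ z in 𝓝 y, ψ z = c) (a : List (Fin d)) :
    ∀ᶠ z in 𝓝 y, pdl a ψ z = if a = [] then c else 0 := by
  induction a with
  | nil => simpa [pdl] using h
  | cons i a ih =>
    filter_upwards [ih.eventually_nhds] with z hz
    have h1 : pdl a ψ =ᶠ[𝓝 z] fun _ => if a = [] then c else 0 := hz
    simp only [pdl, HC.pd, reduceCtorEq, if_false]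
    rw [h1.fderiv_eq]
    simp

/-- The reflection polynomial. -/
def qp (ℓ : ℕ) : ℝ[X] := 1 - (1 - X) ^ ℓ

lemma qp_natDegree (ℓ : ℕ) : (qp ℓ).natDegree ≤ ℓ := by
  unfold qp
  compute_degree

lemma factor_deg {q r : ℝ[X]} {m B : ℕ} (hq : q.natDegree ≤ B) (hm : 1 + m ≤ B) (h : q = X * r * (X - 1) ^ m) :
    r.natDegree + 1 + m ≤ B := by
  by_cases hr : r = 0
  · simp [hr]; omega
  · have hX : (X - 1 : ℝ[X]).natDegree = 1 := by simpa using natDegree_X_sub_C (1:ℝ)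
    have hX0 : (X - 1 : ℝ[X]) ≠ 0 := by simpa using X_sub_C_ne_zero (1:ℝ)
    have := hq
    rw [h, natDegree_mul (mul_ne_zero X_ne_zero hr) (pow_ne_zero _ hX0), natDegree_mul X_ne_zero hr, natDegree_pow, hX, natDegree_X] at this
    omega

lemma qp_X (ℓ : ℕ) : ∃ r : ℝ[X], qp ℓ = X * r := by
  have h : (1 - (1 - X) : ℝ[X]) ∣ 1 ^ ℓ - (1 - X) ^ ℓ := sub_dvd_pow_sub_pow _ _ _
  rw [one_pow, sub_sub_cancel] at h
  exact h

lemma qp_comp_X (ℓ : ℕ) (hl : 1 ≤ ℓ) : ∃ r : ℝ[X], r.natDegree + 1 + 0 ≤ 2 * ℓ ∧ (qp ℓ).comp (X ^ 2) = X * r * (X - 1) ^ 0 := by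
  obtain ⟨r, hr⟩ := qp_X ℓ
  refine ⟨X * r.comp (X ^ 2), ?_, ?_⟩
  · refine factor_deg (q := (qp ℓ).comp (X ^ 2)) ?_ (by omega) ?_
    · rw [natDegree_comp]; simp; have := qp_natDegree ℓ; omega
    · rw [hr]; simp; ring
  · rw [hr]; simp; ring

lemma qp_X' (ℓ : ℕ) (hl : 1 ≤ ℓ) : ∃ r : ℝ[X], r.natDegree + 1 + 0 ≤ ℓ ∧ (qp ℓ) = X * r * (X - 1) ^ 0 := by
  obtain ⟨r, hr⟩ := qp_X ℓ
  refine ⟨r, factor_deg (qp_natDegree ℓ) (by omega) ?_, ?_⟩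
  · rw [hr]; ring
  · rw [hr]; ring

lemma qp_diff (ℓ : ℕ) (hl : 1 ≤ ℓ) {m : ℕ} (hm : m ≤ ℓ) : ∃ r : ℝ[X], r.natDegree + 1 + m ≤ 2 * ℓ ∧
    qp ℓ - (qp ℓ).comp (X ^ 2) = X * r * (X - 1) ^ m := by
  have h : (1 + X - 1 : ℝ[X]) ∣ (1 + X) ^ ℓ - 1 ^ ℓ := sub_dvd_pow_sub_pow _ _ _
  rw [one_pow, add_sub_cancel_left] at h
  obtain ⟨r, hr⟩ := h
  have e1 : qp ℓ - (qp ℓ).comp (X ^ 2) = (1 - X) ^ ℓ * ((1 + X) ^ ℓ - 1) := by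
    have : (1 - X ^ 2 : ℝ[X]) ^ ℓ = (1 - X) ^ ℓ * (1 + X) ^ ℓ := by rw [← mul_pow]; ring
    simp [qp, this]; ring
  have e2 : qp ℓ - (qp ℓ).comp (X ^ 2) = X * ((-1) ^ ℓ * (X - 1) ^ (ℓ - m) * r) * (X - 1) ^ m := by
    have : (1 - X : ℝ[X]) ^ ℓ = (-1) ^ ℓ * ((X - 1) ^ (ℓ - m) * (X - 1) ^ m) := by
      rw [← pow_add, Nat.sub_add_cancel hm, ← mul_pow]; ring
    rw [e1, hr, this]; ring
  refine ⟨_, factor_deg ?_ (by omega) e2, e2⟩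
  refine (natDegree_sub_le _ _).trans (max_le ((qp_natDegree ℓ).trans (by omega)) ?_)
  rw [natDegree_comp]; simp; have := qp_natDegree ℓ; omega

lemma pq_two (q : ℝ[X]) (v : Rd d) (f : Rd d → ℝ) : pq q ((2:ℝ) • v) f = pq (q.comp (X ^ 2)) v f := by
  have : Tm ((2:ℝ) • v) = (Tm v) ^ 2 := by
    apply LinearMap.ext; intro f; rw [Tm_pow, Tm_apply]; norm_num
  unfold pq
  rw [this, aeval_comp]; simp

lemma support_qp {ℓ k : ℕ} (hk : k ∈ (qp ℓ).support) : 1 ≤ k ∧ k ≤ ℓ := by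
  refine ⟨?_, (le_natDegree_of_mem_supp _ hk).trans (qp_natDegree ℓ)⟩
  by_contra h
  have : k = 0 := by omega
  subst this
  obtain ⟨r, hr⟩ := qp_X ℓ
  simp [hr] at hk

lemma sum_qp (ℓ : ℕ) (hl : 1 ≤ ℓ) : ∑ k ∈ (qp ℓ).support, (qp ℓ).coeff k = 1 := by
  have : (qp ℓ).eval 1 = 1 := by simp [qp]; omega
  rw [eval_eq_sum, Polynomial.sum] at this
  simpa using this

lemma layer_sum {P : ℝ≥0∞} (hP : 1 ≤ P) (hP' : P ≠ ⊤) {L V : ℕ → Set (Rd d)} {D : Set (Rd d)} 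
    (hV : ∀ k, MeasurableSet (V k)) (hVD : ∀ k, V k ⊆ D) {G a : Rd d → ℝ} (ha : ML P D a) {C N : ℝ≥0} (hN : 1 ≤ N)
    (hb : ∀ k, nm P (L k) G ≤ C * nm P (V k) a) (ho : ∀ x, ∑' k, (V k).indicator (fun _ => (1:ℝ≥0∞)) x ≤ N) :
    nm P (⋃ k, L k) G ≤ C * N * nm P D a := by
  have h0 : P ≠ 0 := by rintro rfl; simp at hP
  have hp1 : 1 ≤ P.toReal := by
    have := (ENNReal.toReal_le_toReal (by simp) hP').2 hP
    simpa using this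
  have hp : 0 < P.toReal := by linarith
  have key : ∀ (U : Set (Rd d)) (f : Rd d → ℝ), nm P U f ^ P.toReal = ∫⁻ x in U, ‖f x‖ₑ ^ P.toReal := by
    intro U f
    unfold nm
    rw [eLpNorm_eq_lintegral_rpow_enorm_toReal h0 hP', one_div, ENNReal.rpow_inv_rpow hp.ne']
  rw [← ENNReal.rpow_le_rpow_iff hp, ENNReal.mul_rpow_of_nonneg _ _ hp.le, ENNReal.mul_rpow_of_nonneg _ _ hp.le, key, key]
  have hm : AEMeasurable (fun x => ‖a x‖ₑ ^ P.toReal) (volume.restrict D) :=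
    (ha.1.enorm).pow_const _
  calc ∫⁻ x in ⋃ k, L k, ‖G x‖ₑ ^ P.toReal ≤ ∑' k, ∫⁻ x in L k, ‖G x‖ₑ ^ P.toReal := lintegral_iUnion_le _ _
    _ ≤ ∑' k, (C:ℝ≥0∞) ^ P.toReal * ∫⁻ x in V k, ‖a x‖ₑ ^ P.toReal := by
        apply ENNReal.tsum_le_tsum
        intro k
        rw [← key, ← key, ← ENNReal.mul_rpow_of_nonneg _ _ hp.le]
        exact ENNReal.rpow_le_rpow (hb k) hp.le
    _ = (C:ℝ≥0∞) ^ P.toReal * ∑' k, ∫⁻ x in D, (V k).indicator (fun x => ‖a x‖ₑ ^ P.toReal) x := by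
        rw [ENNReal.tsum_mul_left]
        congr 2
        ext k
        rw [lintegral_indicator (hV k), Measure.restrict_restrict (hV k), inter_eq_left.2 (hVD k)]
    _ = (C:ℝ≥0∞) ^ P.toReal * ∫⁻ x in D, ∑' k, (V k).indicator (fun x => ‖a x‖ₑ ^ P.toReal) x := by
        rw [lintegral_tsum (fun k => hm.indicator (hV k))]
    _ ≤ (C:ℝ≥0∞) ^ P.toReal * ∫⁻ x in D, (N:ℝ≥0∞) ^ P.toReal * ‖a x‖ₑ ^ P.toReal := by
        gcongr with x
        have : ∀ k, (V k).indicator (fun x => ‖a x‖ₑ ^ P.toReal) x = (V k).indicator (fun _ => (1:ℝ≥0∞)) x * ‖a x‖ₑ ^ P.toReal := by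
          intro k; by_cases hx : x ∈ V k <;> simp [hx]
        simp_rw [this]
        rw [ENNReal.tsum_mul_right]
        gcongr
        refine (ho x).trans ?_
        have hN' : (1:ℝ≥0∞) ≤ N := by exact_mod_cast hN
        calc (N:ℝ≥0∞) = (N:ℝ≥0∞) ^ (1:ℝ) := by simp
          _ ≤ _ := ENNReal.rpow_le_rpow_of_exponent_le hN' hp1
    _ = _ := by
        rw [lintegral_const_mul' _ _ (by simp [ENNReal.rpow_eq_top_iff, hp.le]), mul_assoc]

lemma overlap {τ σ : ℝ} (hσ : 0 < σ) (M : ℕ) {V : ℕ → Prop} (hV : ∀ k, V k → σ / 2 ^ k < τ ∧ τ < M * (σ / 2 ^ k)) :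
    ∑' k, (if V k then (1:ℝ≥0∞) else 0) ≤ M := by
  by_cases h : ∃ k, V k
  · classical
    have hk0 := Nat.find_spec h
    set k0 := Nat.find h with hk0d
    have hz : ∀ k ∉ Finset.Ico k0 (k0 + M), (if V k then (1:ℝ≥0∞) else 0) = 0 := by
      intro k hk
      rw [if_neg]
      intro hVk
      have h1 : k0 ≤ k := Nat.find_min' h hVk
      have h2 : k0 + M ≤ k := by
        by_contra h3; exact hk (by simp; omega)
      have a1 := (hV _ hk0).1
      have a2 := (hV _ hVk).2
      have a3 : (M:ℝ) * (σ / 2 ^ k) ≤ σ / 2 ^ k0 := by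
        rw [← mul_div_assoc, div_le_div_iff₀ (by positivity) (by positivity)]
        have : (M:ℝ) * 2 ^ k0 ≤ 2 ^ k := by
          calc (M:ℝ) * 2 ^ k0 ≤ 2 ^ M * 2 ^ k0 := by
                gcongr; exact_mod_cast (Nat.lt_two_pow_self (n := M)).le
            _ = 2 ^ (k0 + M) := by rw [pow_add]; ring
            _ ≤ 2 ^ k := pow_le_pow_right₀ (by norm_num) h2
        nlinarith
      linarith
    rw [tsum_eq_sum hz]
    calc _ ≤ ∑ k ∈ Finset.Ico k0 (k0 + M), (1:ℝ≥0∞) := Finset.sum_le_sum (fun k _ => by split_ifs <;> simp)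
      _ = M := by simp
  · have : ∀ k, ¬ V k := by simpa using h
    simp [this]

end localext

section localext2
variable {d : ℕ}
open Polynomial

/-- Smoothed reflection at scale `σ / 2 ^ k`. -/
def TT (ℓ : ℕ) (e : Rd d) (σ : ℝ) (k : ℕ) : Module.End ℝ (Rd d → ℝ) := pq (qp ℓ) ((4 * (σ / 2 ^ k)) • e)

/-- Difference of two consecutive scales. -/
def SS (ℓ : ℕ) (e : Rd d) (σ : ℝ) (k : ℕ) (F : List (Fin d) → Rd d → ℝ) (b : List (Fin d)) (y : Rd d) : ℝ :=
  TT ℓ e σ (k + 1) (F b) y - TT ℓ e σ k (F b) y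

/-- Partial sums of the extension. -/
def AA (ℓ : ℕ) (e : Rd d) (σ : ℝ) (θ : ℕ → Rd d → ℝ) (n : ℕ) (F : List (Fin d) → Rd d → ℝ) (l : List (Fin d))
    (y : Rd d) : ℝ :=
  TT ℓ e σ 0 (F l) y + ∑ k ∈ Finset.range n, Leib l (fun a => pdl a (θ k)) (SS ℓ e σ k F) y

/-- First scale below `t y`. -/
def nn (t : Rd d → ℝ) (σ : ℝ) (y : Rd d) : ℕ := if h : ∃ n : ℕ, σ / 2 ^ n < t y then Nat.find h else 0

/-- The local extension. -/
def GG (ℓ : ℕ) (e : Rd d) (σ : ℝ) (θ : ℕ → Rd d → ℝ) (t : Rd d → ℝ) (F : List (Fin d) → Rd d → ℝ)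
    (l : List (Fin d)) (y : Rd d) : ℝ :=
  if t y < 0 then F l y else if t y = 0 then 0 else AA ℓ e σ θ (nn t σ y) F l y

/-- The local graph data. -/
structure LG (D : Set (Rd d)) (x : Rd d) (r : ℝ) (K : ℝ≥0) (t : Rd d → ℝ) (e : Rd d) : Prop where
  rpos : 0 < r
  lip : LipschitzWith K t
  tr : ∀ y s, t (y + s • e) = t y - s
  t0 : t x ≤ 0
  mem : ∀ y ∈ ball x r, (y ∈ D ↔ t y < 0)

/-- The cutoff functions. -/
structure CO (σ : ℝ) (t : Rd d → ℝ) (ℓ : ℕ) (C : ℝ) (θ : ℕ → Rd d → ℝ) : Prop where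
  sm : ∀ k, Sm (θ k)
  one : ∀ k y, t y < 5 / 4 * (σ / 2 ^ (k + 1)) → θ k y = 1
  zero : ∀ k y, 7 / 4 * (σ / 2 ^ (k + 1)) < t y → θ k y = 0
  bd : ∀ k (l : List (Fin d)), l.length ≤ ℓ → ∀ y, |pdl l (θ k) y| ≤ C * (σ / 2 ^ (k + 1))⁻¹ ^ l.length

lemma sc_anti {σ : ℝ} (hσ : 0 < σ) {m n : ℕ} (h : m ≤ n) : σ / 2 ^ n ≤ σ / 2 ^ m := by
  gcongr; norm_num

lemma AA_low {ℓ : ℕ} {e : Rd d} {σ C : ℝ} (hσ : 0 < σ) {t : Rd d → ℝ} (ht : Continuous t) {θ : ℕ → Rd d → ℝ}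
    (hθ : CO σ t ℓ C θ) {n : ℕ} {y : Rd d} (hy : t y ≤ σ / 2 ^ n) (F : List (Fin d) → Rd d → ℝ) (l : List (Fin d)) :
    AA ℓ e σ θ n F l y = TT ℓ e σ n (F l) y := by
  unfold AA
  have : ∀ k ∈ Finset.range n, Leib l (fun a => pdl a (θ k)) (SS ℓ e σ k F) y =
      TT ℓ e σ (k + 1) (F l) y - TT ℓ e σ k (F l) y := by
    intro k hk
    have hk' : k + 1 ≤ n := Finset.mem_range.1 hk
    have h1 : t y < 5 / 4 * (σ / 2 ^ (k + 1)) := by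
      have := sc_anti hσ hk'
      have h3 : 0 < σ / 2 ^ (k + 1) := by positivity
      linarith
    have hloc : ∀ᶠ z in 𝓝 y, θ k z = 1 := by
      filter_upwards [(isOpen_lt ht continuous_const).mem_nhds h1] with z hz
      exact hθ.one k z hz
    rw [Leib_one]
    · rfl
    · simpa using (pdl_const_loc hloc []).self_of_nhds
    · intro a ha
      simpa [ha] using (pdl_const_loc hloc a).self_of_nhds
  rw [Finset.sum_congr rfl this, Finset.sum_range_sub (fun k => TT ℓ e σ k (F l) y)]
  ring

lemma AA_high {ℓ : ℕ} {e : Rd d} {σ C : ℝ} (hσ : 0 < σ) {t : Rd d → ℝ} (ht : Continuous t) {θ : ℕ → Rd d → ℝ}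
    (hθ : CO σ t ℓ C θ) {n m : ℕ} (hnm : n ≤ m) {y : Rd d} (hy : σ / 2 ^ n < t y) (F : List (Fin d) → Rd d → ℝ)
    (l : List (Fin d)) : AA ℓ e σ θ m F l y = AA ℓ e σ θ n F l y := by
  unfold AA
  congr 1
  symm
  apply Finset.sum_subset
  · exact Finset.range_mono hnm
  · intro k _ hk
    have hk' : n ≤ k := by simpa using hk
    have h1 : 7 / 4 * (σ / 2 ^ (k + 1)) < t y := by
      have := sc_anti hσ hk'
      have h3 : σ / 2 ^ (k + 1) = (σ / 2 ^ k) / 2 := by rw [pow_succ]; field_simp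
      have h4 : 0 < σ / 2 ^ k := by positivity
      rw [h3]; linarith
    have hloc : ∀ᶠ z in 𝓝 y, θ k z = 0 := by
      filter_upwards [(isOpen_lt continuous_const ht).mem_nhds h1] with z hz
      exact hθ.zero k z hz
    apply Leib_zero
    intro a b _
    have := (pdl_const_loc hloc a).self_of_nhds
    simp only [ite_self] at this
    rw [this, zero_mul]

lemma GG_pos {ℓ : ℕ} {e : Rd d} {σ C : ℝ} (hσ : 0 < σ) {t : Rd d → ℝ} (ht : Continuous t) {θ : ℕ → Rd d → ℝ}
    (hθ : CO σ t ℓ C θ) {n : ℕ} {y : Rd d} (hy : σ / 2 ^ n < t y) (F : List (Fin d) → Rd d → ℝ)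
    (l : List (Fin d)) : GG ℓ e σ θ t F l y = AA ℓ e σ θ n F l y := by
  have h0 : 0 < t y := lt_trans (by positivity) hy
  have hex : ∃ n : ℕ, σ / 2 ^ n < t y := ⟨n, hy⟩
  have hnn : nn t σ y = Nat.find hex := by simp [nn, hex]
  have h1 : σ / 2 ^ (nn t σ y) < t y := by rw [hnn]; exact Nat.find_spec hex
  have h2 : nn t σ y ≤ n := by rw [hnn]; exact Nat.find_min' hex hy
  unfold GG
  rw [if_neg (not_lt.2 h0.le), if_neg h0.ne', AA_high hσ ht hθ h2 h1]

lemma LG.shift {D : Set (Rd d)} {x : Rd d} {r : ℝ} {K : ℝ≥0} {t : Rd d → ℝ} {e : Rd d} (h : LG D x r K t e)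
    {ρ M : ℝ} (hr : ρ + M * ‖e‖ ≤ r) {y : Rd d} (hy : y ∈ ball x ρ) {w : ℝ} (hw0 : 0 ≤ w) (hw : w ≤ M) (ht : t y < w) :
    y + w • e ∈ D := by
  have : y + w • e ∈ ball x r := by
    rw [mem_ball] at hy ⊢
    calc dist (y + w • e) x ≤ dist (y + w • e) y + dist y x := dist_triangle _ _ _
      _ = w * ‖e‖ + dist y x := by rw [dist_self_add_left, norm_smul, Real.norm_of_nonneg hw0]
      _ ≤ M * ‖e‖ + dist y x := by gcongr
      _ < _ := by linarith
  rw [h.mem _ this, h.tr]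
  linarith

lemma TT_jet {P : ℝ≥0∞} (hP : 1 ≤ P) {D W : Set (Rd d)} (hD : MeasurableSet D) (hW : MeasurableSet W)
    {ℓ n : ℕ} {e : Rd d} {σ : ℝ} {k : ℕ} {F : List (Fin d) → Rd d → ℝ} (hF : Jet P D n F)
    (h : ∀ y ∈ W, ∀ j : ℕ, 1 ≤ j → j ≤ ℓ → y + (4 * (σ / 2 ^ k) * j) • e ∈ D) :
    Jet P W n (fun l => TT ℓ e σ k (F l)) := by
  refine Jet.pq hP hD hW _ _ ?_ hF
  intro y hy j hj
  have := h y hy j (support_qp hj).1 (support_qp hj).2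
  rwa [smul_smul, mul_comm]

lemma SS_jet {P : ℝ≥0∞} (hP : 1 ≤ P) {D W : Set (Rd d)} (hD : MeasurableSet D) (hW : MeasurableSet W)
    {ℓ n : ℕ} {e : Rd d} {σ : ℝ} {k : ℕ} {F : List (Fin d) → Rd d → ℝ} (hF : Jet P D n F)
    (h : ∀ y ∈ W, ∀ s ∈ Icc (1:ℝ) (2 * ℓ : ℕ), y + (4 * (σ / 2 ^ (k + 1)) * s) • e ∈ D) :
    Jet P W n (SS ℓ e σ k F) := by
  unfold SS
  refine Jet.sub hP (TT_jet hP hD hW hF ?_) (TT_jet hP hD hW hF ?_)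
  · intro y hy j h1 h2
    have a1 : (1:ℝ) ≤ j := by exact_mod_cast h1
    have a2 : (j:ℝ) ≤ ℓ := by exact_mod_cast h2
    exact h y hy j ⟨a1, by push_cast; linarith⟩
  · intro y hy j h1 h2
    have a1 : (1:ℝ) ≤ j := by exact_mod_cast h1
    have a2 : (j:ℝ) ≤ ℓ := by exact_mod_cast h2
    have := h y hy (2 * j) ⟨by linarith, by push_cast; linarith⟩
    convert this using 3
    rw [pow_succ]; field_simp

lemma AA_jet {P : ℝ≥0∞} (hP : 1 ≤ P) {D : Set (Rd d)} (hD : IsOpen D) {x : Rd d} {r : ℝ} {K : ℝ≥0}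
    {t : Rd d → ℝ} {e : Rd d} (h : LG D x r K t e) {ℓ : ℕ} (hl : 1 ≤ ℓ) {σ ρ : ℝ} (hσ : 0 < σ)
    (hr : ρ + 4 * ℓ * σ * ‖e‖ ≤ r) (hρ : ∀ y ∈ ball x ρ, t y < σ) {C : ℝ} {θ : ℕ → Rd d → ℝ} (hC : 0 ≤ C)
    (hθ : CO σ t ℓ C θ) {F : List (Fin d) → Rd d → ℝ} (hF : Jet P D ℓ F) (n : ℕ) :
    Jet P (ball x ρ) ℓ (AA ℓ e σ θ n F) := by
  have hl' : (1:ℝ) ≤ ℓ := by exact_mod_cast hl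
  have hcont := h.lip.continuous
  unfold AA
  refine Jet.add hP (TT_jet hP hD.measurableSet measurableSet_ball hF ?_) (Jet.sum hP _ ?_)
  · intro y hy j h1 h2
    have a1 : (1:ℝ) ≤ j := by exact_mod_cast h1
    have a2 : (j:ℝ) ≤ ℓ := by exact_mod_cast h2
    refine h.shift hr hy (by positivity) ?_ ?_
    · simp only [pow_zero, div_one]; nlinarith
    · have := hρ y hy
      simp only [pow_zero, div_one]; nlinarith
  · intro k _
    set s := σ / 2 ^ (k + 1) with hs
    have hs0 : 0 < s := by positivity
    have hs1 : s ≤ σ / 2 := by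
      have := sc_anti hσ (show 1 ≤ k + 1 by omega)
      simpa using this
    set V : Set (Rd d) := {y | ∀ u ∈ Icc (1:ℝ) (2 * ℓ : ℕ), y + u • ((4 * s) • e) ∈ D} with hV
    have hVo : IsOpen V := isOpen_core hD _ _ _
    have hts : tsupport (θ k) ⊆ {y | t y ≤ 7 / 4 * s} := by
      apply closure_minimal _ (isClosed_le hcont continuous_const)
      intro y hy
      by_contra hne
      exact hy (hθ.zero k y (not_le.1 hne))
    refine Jet.leib hP measurableSet_ball hVo.measurableSet (SS_jet hP hD.measurableSet hVo.measurableSet hF ?_)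
      (hθ.sm k) ?_ (C := C * (1 + s⁻¹) ^ ℓ) ?_
    · intro y hy u hu
      have := hy u hu
      rwa [smul_smul, mul_comm u] at this
    · rintro y ⟨hy, hyt⟩ u ⟨hu1, hu2⟩
      have h1 := hts hyt
      simp only [mem_setOf_eq] at h1
      push_cast at hu2
      rw [smul_smul]
      refine h.shift hr hy (by positivity) ?_ ?_ <;> nlinarith
    · intro a ha y _
      refine (hθ.bd k a ha y).trans ?_
      have : 0 < s⁻¹ := by positivity
      gcongr
      calc s⁻¹ ^ a.length ≤ (1 + s⁻¹) ^ a.length := by gcongr; linarith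
        _ ≤ (1 + s⁻¹) ^ ℓ := pow_le_pow_right₀ (by linarith) ha

lemma TT_eq (ℓ : ℕ) (e : Rd d) (σ : ℝ) (k : ℕ) (f : Rd d → ℝ) :
    TT ℓ e σ k f = pq ((qp ℓ).comp (X ^ 2)) ((4 * (σ / 2 ^ (k + 1))) • e) f := by
  rw [← pq_two, smul_smul]
  unfold TT
  congr 2
  rw [pow_succ]; field_simp

lemma SS_eq (ℓ : ℕ) (e : Rd d) (σ : ℝ) (k : ℕ) (F : List (Fin d) → Rd d → ℝ) (b : List (Fin d)) :
    SS ℓ e σ k F b = pq (qp ℓ - (qp ℓ).comp (X ^ 2)) ((4 * (σ / 2 ^ (k + 1))) • e) (F b) := by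
  ext y
  rw [pq_sub, ← TT_eq]; rfl

lemma layer_bound {P : ℝ≥0∞} (hP : 1 ≤ P) (hP' : P ≠ ⊤) {ℓ : ℕ} (hl : 1 ≤ ℓ) (e : Rd d) {C : ℝ} (hC : 0 ≤ C) :
    ∃ A : ℝ≥0, ∀ (V W : Set (Rd d)) (hV : IsOpen V) (hW : MeasurableSet W) (σ : ℝ) (hσ : 0 < σ) (t : Rd d → ℝ)
      (θ : ℕ → Rd d → ℝ) (hθ : CO σ t ℓ C θ) (k : ℕ)
      (hv : ∀ y ∈ W, ∀ s ∈ Icc (1:ℝ) (2 * ℓ : ℕ), y + s • ((4 * (σ / 2 ^ (k + 1))) • e) ∈ V)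
      (F : List (Fin d) → Rd d → ℝ) (hF : Jet P V ℓ F) (l : List (Fin d)) (hll : l.length ≤ ℓ),
      nm P W (fun y => TT ℓ e σ k (F l) y + Leib l (fun a => pdl a (θ k)) (SS ℓ e σ k F) y) ≤
        A * nm P V (gm l.length F) := by
  obtain ⟨r0, hr0, hr0'⟩ := qp_comp_X ℓ hl
  have hr : ∀ m : ℕ, ∃ r : ℝ[X], m ≤ ℓ → r.natDegree + 1 + m ≤ 2 * ℓ ∧ qp ℓ - (qp ℓ).comp (X ^ 2) = X * r * (X - 1) ^ m := by
    intro m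
    by_cases hm : m ≤ ℓ
    · obtain ⟨r, h⟩ := qp_diff ℓ hl hm; exact ⟨r, fun _ => h⟩
    · exact ⟨0, fun h => absurd h hm⟩
  choose r hr using hr
  set Am : ℕ → ℝ≥0 := fun m => C.toNNReal * (cs (X * r m) * ((((d + 1 : ℕ) : ℝ≥0) ^ ℓ) * (4 * ‖e‖₊)) ^ m) with hAm
  refine ⟨cs (X * r0) + 2 ^ ℓ * ∑ m ∈ Finset.range (ℓ + 1), Am m, ?_⟩
  intro V W hV hW σ hσ t θ hθ k hv F hF l hll
  set s := σ / 2 ^ (k + 1) with hs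
  have hs0 : 0 < s := by positivity
  have hSJ : Jet P W ℓ (SS ℓ e σ k F) := by
    refine SS_jet hP hV.measurableSet hW hF ?_
    intro y hy u hu
    have := hv y hy u hu
    rwa [smul_smul, mul_comm u] at this
  have hT : ML P W (TT ℓ e σ k (F l)) := by
    refine (TT_jet hP hV.measurableSet hW hF ?_ ).mem l hll
    intro y hy j h1 h2
    have a1 : (1:ℝ) ≤ j := by exact_mod_cast h1
    have a2 : (j:ℝ) ≤ ℓ := by exact_mod_cast h2
    have := hv y hy (2 * j) ⟨by linarith, by push_cast; linarith⟩
    rw [smul_smul] at this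
    convert this using 3
    rw [hs, pow_succ]; field_simp
  have hTb : nm P W (TT ℓ e σ k (F l)) ≤ cs (X * r0) * nm P V (gm l.length F) := by
    rw [TT_eq, hr0']
    have := poly_bound hP hP' ((4 * s) • e) (n := ℓ) (m := 0) hV hW hF (l := l) (by omega) r0 hr0 hv
    simpa using this
  have hLe := Leib_ML hP (U := W) l (Ψ := fun a => pdl a (θ k)) (F := SS ℓ e σ k F)
    (M := (∑ m ∈ Finset.range (ℓ + 1), Am m : ℝ≥0) * nm P V (gm l.length F)) (by
      intro a b hab
      have ha : a.length ≤ ℓ := by omega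
      have h1 := ML.mul_bdd (P := P) (U := W) (V := W) hW hW ((hθ.sm k).pdl a).continuous
        (fun y _ => hθ.bd k a ha y) (fun y h h' => absurd h h') (hSJ.mem b (by omega))
      refine ⟨h1.1, h1.2.trans ?_⟩
      have h2 : nm P W (SS ℓ e σ k F b) ≤ cs (X * r a.length) * ((((d + 1 : ℕ) : ℝ≥0∞) ^ ℓ * ENNReal.ofReal ‖(4 * s) • e‖) ^ a.length
          * nm P V (gm l.length F)) := by
        rw [SS_eq, (hr a.length ha).2]
        have := poly_bound hP hP' ((4 * s) • e) (n := ℓ) (m := a.length) hV hW hF (l := b) (by omega) (r a.length) (hr a.length ha).1 hv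
        rwa [show b.length + a.length = l.length by omega] at this
      have h3 : Am a.length ≤ ∑ m ∈ Finset.range (ℓ + 1), Am m :=
        Finset.single_le_sum (f := Am) (fun _ _ => bot_le) (by simp; omega)
      refine le_trans ?_ (mul_le_mul' (ENNReal.coe_le_coe.2 h3) le_rfl)
      refine (mul_le_mul' le_rfl h2).trans (le_of_eq ?_)
      have e1 : ENNReal.ofReal ‖(4 * s) • e‖ = ENNReal.ofReal s * (4 * (‖e‖₊ : ℝ≥0∞)) := by
        rw [norm_smul, Real.norm_of_nonneg (by positivity), show 4 * s * ‖e‖ = s * (4 * ‖e‖) by ring,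
          ENNReal.ofReal_mul hs0.le, ENNReal.ofReal_mul (by norm_num), ofReal_norm_eq_enorm, enorm_eq_nnnorm]
        norm_num
      have e2 : ENNReal.ofReal (C * s⁻¹ ^ a.length) = C.toNNReal * (ENNReal.ofReal s)⁻¹ ^ a.length := by
        rw [ENNReal.ofReal_mul hC, ENNReal.ofReal_pow (by positivity), ENNReal.ofReal_inv_of_pos hs0]; rfl
      have e3 : (ENNReal.ofReal s)⁻¹ ^ a.length * ENNReal.ofReal s ^ a.length = 1 := by
        rw [← mul_pow, ENNReal.inv_mul_cancel (by simpa using hs0) (by simp), one_pow]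
      rw [e1, e2, hAm]
      push_cast
      calc _ = C.toNNReal * (cs (X * r a.length) * (((d + 1 : ℕ) : ℝ≥0∞) ^ ℓ * (4 * ‖e‖₊)) ^ a.length) *
            ((ENNReal.ofReal s)⁻¹ ^ a.length * ENNReal.ofReal s ^ a.length) * nm P V (gm l.length F) := by
              push_cast; ring
        _ = _ := by rw [e3, mul_one]; push_cast; rfl)
  refine (nm_add_le hP hT hLe.1).trans ?_
  push_cast
  rw [add_mul]
  refine add_le_add hTb (hLe.2.trans ?_)
  rw [mul_assoc]
  push_cast
  gcongr
  norm_num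

end localext2

section localext3
variable {d : ℕ}
open Polynomial

lemma exists_scale {σ τ : ℝ} (hτ : 0 < τ) : ∃ n : ℕ, σ / 2 ^ n < τ := by
  obtain ⟨n, hn⟩ := exists_nat_gt (σ / τ)
  refine ⟨n, ?_⟩
  have h2 : (n:ℝ) ≤ 2 ^ n := by exact_mod_cast (Nat.lt_two_pow_self (n := n)).le
  rw [div_lt_iff₀ (by positivity)]
  rw [div_lt_iff₀ hτ] at hn
  nlinarith

lemma exists_layer {σ τ : ℝ} (hτ : 0 < τ) (hτσ : τ < σ) : ∃ k : ℕ, σ / 2 ^ (k + 1) < τ ∧ τ ≤ σ / 2 ^ k := by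
  have hex := exists_scale (σ := σ) hτ
  have h1 := Nat.find_spec hex
  have h0 : Nat.find hex ≠ 0 := by
    intro h0; rw [h0] at h1; simp at h1; linarith
  obtain ⟨k, hk⟩ := Nat.exists_eq_succ_of_ne_zero h0
  refine ⟨k, ?_, ?_⟩
  · rw [hk] at h1; exact h1
  · by_contra h
    exact Nat.find_min hex (m := k) (by omega) (not_le.1 h)

/-- The layers. -/
def Lay (x : Rd d) (ρ σ : ℝ) (t : Rd d → ℝ) (k : ℕ) : Set (Rd d) :=
  {y | y ∈ ball x ρ ∧ σ / 2 ^ (k + 1) < t y ∧ t y ≤ σ / 2 ^ k}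

lemma GG_bound {P : ℝ≥0∞} (hP : 1 ≤ P) (hP' : P ≠ ⊤) {ℓ : ℕ} (hl : 1 ≤ ℓ) (e : Rd d) {C : ℝ} (hC : 0 ≤ C) :
    ∃ A : ℝ≥0, ∀ {D : Set (Rd d)} (hD : IsOpen D) {x : Rd d} {r : ℝ} {K : ℝ≥0}
    {t : Rd d → ℝ} (h : LG D x r K t e) {σ ρ : ℝ} (hσ : 0 < σ)
    (hr : ρ + 4 * ℓ * σ * ‖e‖ ≤ r) (hρr : ρ ≤ r) (hρ : ∀ y ∈ ball x ρ, t y < σ) {θ : ℕ → Rd d → ℝ} 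
    (hθ : CO σ t ℓ C θ) {F : List (Fin d) → Rd d → ℝ} (hF : Jet P D ℓ F) (l : List (Fin d)) (hll : l.length ≤ ℓ),
    ML P (ball x ρ) (GG ℓ e σ θ t F l) ∧ nm P (ball x ρ) (GG ℓ e σ θ t F l) ≤ A * nm P D (gm l.length F) := by
  obtain ⟨A, hA⟩ := layer_bound hP hP' hl e hC
  refine ⟨1 + A * (9 * ℓ : ℕ), ?_⟩
  intro D hD x r K t h σ ρ hσ hr hρr hρ θ hθ F hF l hll
  have hl' : (1:ℝ) ≤ ℓ := by exact_mod_cast hl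
  have hcont := h.lip.continuous
  set G := GG ℓ e σ θ t F l with hG
  set L := Lay x ρ σ t with hL
  have hLm : ∀ k, MeasurableSet (L k) := fun k => measurableSet_ball.inter
    ((isOpen_lt continuous_const hcont).measurableSet.inter (isClosed_le hcont continuous_const).measurableSet)
  set V : ℕ → Set (Rd d) := fun k => D ∩ {y | σ / 2 ^ (k + 1) < - t y ∧ - t y < (9 * ℓ : ℕ) * (σ / 2 ^ (k + 1))} with hV
  have hVo : ∀ k, IsOpen (V k) := fun k => hD.inter
    ((isOpen_lt continuous_const hcont.neg).inter (isOpen_lt hcont.neg continuous_const))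
  have hGL : ∀ k, ∀ y ∈ L k, G y = TT ℓ e σ k (F l) y + Leib l (fun a => pdl a (θ k)) (SS ℓ e σ k F) y := by
    rintro k y ⟨hy, h1, h2⟩
    rw [hG, GG_pos hσ hcont hθ h1]
    have := AA_low (e := e) hσ hcont hθ h2 F l
    rw [← this]
    unfold AA
    rw [Finset.sum_range_succ, add_assoc]
  have hgm : ML P D (gm l.length F) := ML.gm (fun l' hl' => hF.mem l' (by omega))
  have hLb : ∀ k, nm P (L k) G ≤ A * nm P (V k) (gm l.length F) := by
    intro k
    rw [nm_congr (hLm k) (hGL k)]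
    refine hA (V k) (L k) (hVo k) (hLm k) σ hσ t θ hθ k ?_ F (hF.mono inter_subset_left) l hll
    rintro y ⟨hy, h1, h2⟩ u ⟨hu1, hu2⟩
    push_cast at hu2
    have hs : σ / 2 ^ k = 2 * (σ / 2 ^ (k + 1)) := by rw [pow_succ]; field_simp
    rw [hs] at h2
    set s := σ / 2 ^ (k + 1) with hsd
    have hs0 : 0 < s := by positivity
    have hs1 : s ≤ σ / 2 := by
      have := sc_anti hσ (show 1 ≤ k + 1 by omega)
      simpa using this
    rw [smul_smul]
    refine ⟨h.shift hr hy (by positivity) ?_ ?_, ?_, ?_⟩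
    · nlinarith
    · nlinarith
    · rw [h.tr]; nlinarith
    · rw [h.tr]; push_cast; nlinarith
  have hLs : nm P (⋃ k, L k) G ≤ A * (9 * ℓ : ℕ) * nm P D (gm l.length F) := by
    have := layer_sum hP hP' (L := L) (V := V) (D := D) (fun k => (hVo k).measurableSet) (fun k => inter_subset_left) hgm
      (N := ((9 * ℓ : ℕ) : ℝ≥0)) (by exact_mod_cast (by omega : 1 ≤ 9 * ℓ)) hLb ?_
    · exact_mod_cast this
    · intro y
      have := overlap (τ := -t y) (σ := σ / 2) (by positivity) (9 * ℓ) (V := fun k => y ∈ V k) (by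
        rintro k ⟨_, h1, h2⟩
        have : σ / 2 / 2 ^ k = σ / 2 ^ (k + 1) := by rw [pow_succ]; field_simp
        rw [this]; exact ⟨h1, h2⟩)
      refine le_trans (le_of_eq ?_) (this.trans (le_of_eq (by push_cast; rfl)))
      congr 1
  set N : Set (Rd d) := {y | y ∈ ball x ρ ∧ t y < 0} with hN
  set Z : Set (Rd d) := {y | y ∈ ball x ρ ∧ t y = 0} with hZ
  have hNm : MeasurableSet N := measurableSet_ball.inter (isOpen_lt hcont continuous_const).measurableSet
  have hZm : MeasurableSet Z := measurableSet_ball.inter (isClosed_eq hcont continuous_const).measurableSet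
  have hND : N ⊆ D := fun y hy => (h.mem y (ball_subset_ball hρr hy.1)).2 hy.2
  have hGN : ∀ y ∈ N, G y = F l y := fun y hy => by rw [hG, GG, if_pos hy.2]
  have hGZ : ∀ y ∈ Z, G y = 0 := fun y hy => by rw [hG, GG, if_neg (not_lt.2 hy.2.ge), if_pos hy.2]
  have hsub : ball x ρ ⊆ (N ∪ Z) ∪ ⋃ k, L k := by
    intro y hy
    rcases lt_trichotomy (t y) 0 with h0 | h0 | h0
    · exact Or.inl (Or.inl ⟨hy, h0⟩)
    · exact Or.inl (Or.inr ⟨hy, h0⟩)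
    · obtain ⟨k, h1, h2⟩ := exists_layer h0 (hρ y hy)
      exact Or.inr (mem_iUnion.2 ⟨k, hy, h1, h2⟩)
  have hNZ : nm P N G ≤ nm P D (gm l.length F) := by
    rw [nm_congr hNm hGN]
    exact (nm_mono hND).trans (nm_le_gm F l)
  have hZ0 : nm P Z G = 0 := by
    rw [nm_congr hZm hGZ]; simp [nm]
  have hb : nm P (ball x ρ) G ≤ (1 + A * (9 * ℓ : ℕ) : ℝ≥0) * nm P D (gm l.length F) := by
    refine (nm_mono hsub).trans ((nm_union_le hP hP' _ _ _).trans ?_)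
    refine (add_le_add ((nm_union_le hP hP' _ _ _).trans (add_le_add hNZ hZ0.le)) hLs).trans (le_of_eq ?_)
    push_cast; ring
  have hmeas : AEStronglyMeasurable G (volume.restrict (ball x ρ)) := by
    apply AEStronglyMeasurable.mono_measure _ (Measure.restrict_mono hsub le_rfl)
    have hN' : AEStronglyMeasurable G (volume.restrict N) :=
      (ML.congr hNm ((hF.mem l hll).mono hND) (fun y hy => (hGN y hy).symm)).1
    have hZ' : AEStronglyMeasurable G (volume.restrict Z) :=
      (ML.congr (P := P) (f := fun _ => 0) hZm (by simp [ML]) (fun y hy => (hGZ y hy).symm)).1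
    have hL' : ∀ k, AEStronglyMeasurable G (volume.restrict (L k)) := by
      intro k
      have := (AA_jet hP hD h hl hσ hr hρ hC hθ hF (k + 1)).mem l hll
      refine (ML.congr (hLm k) (this.mono (fun y hy => hy.1)) (fun y hy => ?_)).1
      rw [hG, GG_pos hσ hcont hθ hy.2.1]
    rw [aestronglyMeasurable_union_iff, aestronglyMeasurable_union_iff]
    exact ⟨⟨hN', hZ'⟩, aestronglyMeasurable_iUnion_iff.2 hL'⟩
  refine ⟨⟨hmeas, lt_of_le_of_lt hb ?_⟩, hb⟩
  exact ENNReal.mul_lt_top ENNReal.coe_lt_top (lt_top_iff_ne_top.2 hgm.nm_ne_top)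

lemma tail_lim {P : ℝ≥0∞} (hP : 1 ≤ P) {D : Set (Rd d)} (hD : IsOpen D) {x : Rd d} {r : ℝ} {K : ℝ≥0}
    {t : Rd d → ℝ} {e : Rd d} (h : LG D x r K t e) {σ ρ : ℝ} (hσ : 0 < σ) {j ℓ : ℕ} (hj1 : 1 ≤ j) (hj : j ≤ ℓ)
    (hr : ρ + 4 * ℓ * σ * ‖e‖ ≤ r) {f : Rd d → ℝ} (hf : ML P D f) {ψ : Rd d → ℝ} (hψ : Tst (ball x ρ) ψ) :
    Tendsto (fun n : ℕ => ∫ y, {y | t y ≤ σ / 2 ^ n}.indicator (fun y => f (y + (4 * (σ / 2 ^ n) * j) • e) * ψ y) y) atTop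
      (𝓝 (∫ y, {y | t y < 0}.indicator (fun y => f y * ψ y) y)) ∧
    ∀ n : ℕ, Integrable ({y | t y ≤ σ / 2 ^ n}.indicator (fun y => f (y + (4 * (σ / 2 ^ n) * j) • e) * ψ y)) := by
  have hcont := h.lip.continuous
  have hj1' : (1:ℝ) ≤ j := by exact_mod_cast hj1
  have hj' : (j:ℝ) ≤ ℓ := by exact_mod_cast hj
  set V := D ∩ ball x r with hV
  have hVm : MeasurableSet V := hD.measurableSet.inter measurableSet_ball
  set g := V.indicator f with hg
  have hgi : Integrable g := by
    rw [hg, integrable_indicator_iff hVm]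
    have : IsFiniteMeasure (volume.restrict V) := ⟨by
      rw [Measure.restrict_apply_univ]
      exact lt_of_le_of_lt (measure_mono inter_subset_right) measure_ball_lt_top⟩
    exact MemLp.integrable hP (hf.mono inter_subset_left)
  obtain ⟨M, hM⟩ := hψ.1.continuous.bounded_above_of_compact_support hψ.2.1
  have hM0 : 0 ≤ M := (norm_nonneg _).trans (hM 0)
  have hψ0 : ∀ z, z ∉ ball x ρ → ψ z = 0 := by
    intro z hz
    by_contra hne
    exact hz (hψ.2.2 (subset_tsupport _ hne))
  set w : ℕ → ℝ := fun n => 4 * (σ / 2 ^ n) * j with hw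
  have hw0 : ∀ n, 0 < w n := fun n => by positivity
  set H : ℕ → Rd d → ℝ := fun n z => {z | t z ≤ σ / 2 ^ n - w n}.indicator (fun z => ψ (z - w n • e)) z with hH
  have hHm : ∀ n, Measurable (H n) := fun n => 
    Measurable.indicator (hψ.1.continuous.comp (continuous_id.sub continuous_const)).measurable
      (isClosed_le hcont continuous_const).measurableSet
  have hHb : ∀ n z, ‖H n z‖ ≤ M := fun n z => by
    refine (norm_indicator_le_norm_self _ _).trans (hM _)
  have hnt : ∀ n, σ / 2 ^ n - w n < 0 := by
    intro n
    have : 0 < σ / 2 ^ n := by positivity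
    simp only [hw]; nlinarith
  -- rewriting of the integrand
  have hre : ∀ n y, {y | t y ≤ σ / 2 ^ n}.indicator (fun y => f (y + (4 * (σ / 2 ^ n) * j) • e) * ψ y) y =
      (fun z => g z * H n z) (y + w n • e) := by
    intro n y
    simp only [hH, indicator, mem_setOf_eq, h.tr, add_sub_cancel_right]
    by_cases h1 : t y ≤ σ / 2 ^ n
    · rw [if_pos h1, if_pos (by linarith)]
      by_cases h2 : y ∈ ball x ρ
      · have h3 : y + w n • e ∈ V := by
          refine ⟨h.shift hr h2 (hw0 n).le ?_ ?_, ?_⟩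
          · have := sc_anti hσ (Nat.zero_le n)
            simp only [pow_zero, div_one] at this
            have h5 : 0 < σ / 2 ^ n := by positivity
            simp only [hw]; nlinarith
          · have := hnt n; linarith
          · rw [mem_ball] at h2 ⊢
            have : w n ≤ 4 * ℓ * σ := by
              have := sc_anti hσ (Nat.zero_le n)
              simp only [pow_zero, div_one] at this
              have h5 : 0 < σ / 2 ^ n := by positivity
              simp only [hw]; nlinarith
            calc dist (y + w n • e) x ≤ dist (y + w n • e) y + dist y x := dist_triangle _ _ _
              _ = w n * ‖e‖ + dist y x := by rw [dist_self_add_left, norm_smul, Real.norm_of_nonneg (hw0 n).le]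
              _ ≤ 4 * ℓ * σ * ‖e‖ + dist y x := by gcongr
              _ < _ := by linarith
        rw [hg, indicator_of_mem h3]
      · rw [hψ0 y h2]; simp
    · rw [if_neg h1, if_neg (by linarith), mul_zero]
  have hInt : ∀ n, Integrable (fun z => g z * H n z) := fun n => 
    hgi.mul_bdd (hHm n).aestronglyMeasurable (Eventually.of_forall (hHb n))
  refine ⟨?_, ?_⟩
  · have e1 : ∀ n, ∫ y, {y | t y ≤ σ / 2 ^ n}.indicator (fun y => f (y + (4 * (σ / 2 ^ n) * j) • e) * ψ y) y =
      ∫ z, g z * H n z := by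
      intro n
      simp_rw [hre n]
      exact integral_add_right_eq_self (fun z => g z * H n z) (w n • e)
    simp_rw [e1]
    have e2 : ∀ y, {y | t y < 0}.indicator (fun y => f y * ψ y) y = g y * {y | t y < 0}.indicator ψ y := by
      intro y
      simp only [indicator, mem_setOf_eq]
      by_cases h1 : t y < 0
      · rw [if_pos h1, if_pos h1]
        by_cases h2 : y ∈ ball x ρ
        · have h4 : y ∈ ball x r := by
            refine ball_subset_ball ?_ h2
            have : 0 ≤ 4 * ℓ * σ * ‖e‖ := by positivity
            linarith
          have h3 : y ∈ V := ⟨(h.mem y h4).2 h1, h4⟩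
          rw [hg, indicator_of_mem h3]
        · rw [hψ0 y h2]; simp
      · rw [if_neg h1, if_neg h1, mul_zero]
    simp_rw [e2]
    apply tendsto_integral_of_dominated_convergence (fun z => ‖g z‖ * M)
    · exact fun n => (hInt n).aestronglyMeasurable
    · exact hgi.norm.mul_const M
    · intro n
      refine Eventually.of_forall fun z => ?_
      rw [norm_mul]
      gcongr
      exact hHb n z
    · refine Eventually.of_forall fun z => ?_
      apply Tendsto.const_mul
      by_cases h1 : t z < 0
      · rw [indicator_of_mem (by exact h1)]
        have hs : Tendsto (fun n : ℕ => σ / 2 ^ n) atTop (𝓝 0) := by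
          have := (tendsto_pow_atTop_nhds_zero_of_lt_one (r := (1/2:ℝ)) (by norm_num) (by norm_num)).const_mul σ
          simpa [div_eq_mul_inv] using this
        have hwt : Tendsto w atTop (𝓝 0) := by
          have := (hs.const_mul 4).mul_const (j:ℝ)
          simpa [hw] using this
        have h2 : Tendsto (fun n => ψ (z - w n • e)) atTop (𝓝 (ψ z)) := by
          have : Tendsto (fun n => z - w n • e) atTop (𝓝 (z - (0:ℝ) • e)) :=
            tendsto_const_nhds.sub (hwt.smul_const e)
          rw [zero_smul, sub_zero] at this
          exact (hψ.1.continuous.tendsto z).comp this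
        refine h2.congr' ?_
        have h3 : ∀ᶠ n in atTop, t z < σ / 2 ^ n - w n := by
          have := hs.sub hwt
          rw [sub_zero] at this
          exact this.eventually (lt_mem_nhds h1)
        filter_upwards [h3] with n hn
        simp only [hH]
        rw [indicator_of_mem]
        exact hn.le
      · rw [indicator_of_notMem (by exact h1)]
        refine tendsto_const_nhds.congr fun n => ?_
        simp only [hH]
        rw [indicator_of_notMem]
        simp only [mem_setOf_eq, not_le]
        have := hnt n
        linarith
  · intro n
    have : ({y | t y ≤ σ / 2 ^ n}.indicator (fun y => f (y + (4 * (σ / 2 ^ n) * j) • e) * ψ y)) =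
      fun y => (fun z => g z * H n z) (y + w n • e) := funext (hre n)
    rw [this]
    exact (hInt n).comp_add_right (w n • e)

lemma AA_lim {P : ℝ≥0∞} (hP : 1 ≤ P) {D : Set (Rd d)} (hD : IsOpen D) {x : Rd d} {r : ℝ} {K : ℝ≥0}
    {t : Rd d → ℝ} {e : Rd d} (h : LG D x r K t e) {σ ρ : ℝ} (hσ : 0 < σ) {ℓ : ℕ} (hl : 1 ≤ ℓ)
    (hr : ρ + 4 * ℓ * σ * ‖e‖ ≤ r) {C : ℝ} {θ : ℕ → Rd d → ℝ} 
    (hθ : CO σ t ℓ C θ) {F : List (Fin d) → Rd d → ℝ} {l : List (Fin d)} (hf : ML P D (F l)) {ψ : Rd d → ℝ} (hψ : Tst (ball x ρ) ψ)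
    (hG : ML P (ball x ρ) (GG ℓ e σ θ t F l)) :
    Tendsto (fun n : ℕ => ∫ y, AA ℓ e σ θ n F l y * ψ y) atTop (𝓝 (∫ y, GG ℓ e σ θ t F l y * ψ y)) := by
  have hcont := h.lip.continuous
  set G := GG ℓ e σ θ t F l with hGd
  have hGi : Integrable (fun y => G y * ψ y) := ML.integrable_tst hP hG hψ
  have hs : Tendsto (fun n : ℕ => σ / 2 ^ n) atTop (𝓝 0) := by
    have := (tendsto_pow_atTop_nhds_zero_of_lt_one (r := (1/2:ℝ)) (by norm_num) (by norm_num)).const_mul σ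
    simpa [div_eq_mul_inv] using this
  have hm : ∀ n : ℕ, MeasurableSet {y | σ / 2 ^ n < t y} := fun n => (isOpen_lt continuous_const hcont).measurableSet
  have h1 : Tendsto (fun n : ℕ => ∫ y, {y | σ / 2 ^ n < t y}.indicator (fun y => G y * ψ y) y) atTop
      (𝓝 (∫ y, {y | 0 < t y}.indicator (fun y => G y * ψ y) y)) := by
    apply tendsto_integral_of_dominated_convergence (fun y => ‖G y * ψ y‖)
    · exact fun n => (hGi.indicator (hm n)).aestronglyMeasurable
    · exact hGi.norm
    · exact fun n => Eventually.of_forall fun y => norm_indicator_le_norm_self _ _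
    · refine Eventually.of_forall fun y => ?_
      by_cases hy : 0 < t y
      · rw [indicator_of_mem (by exact hy)]
        refine tendsto_const_nhds.congr' ?_
        filter_upwards [hs.eventually (gt_mem_nhds hy)] with n hn
        rw [indicator_of_mem]; exact hn
      · rw [indicator_of_notMem (by exact hy)]
        refine tendsto_const_nhds.congr fun n => ?_
        rw [indicator_of_notMem]
        have : 0 < σ / 2 ^ n := by positivity
        simp only [mem_setOf_eq, not_lt] at hy ⊢
        linarith
  have h2 : ∀ j ∈ (qp ℓ).support, _ := fun j hj => tail_lim hP hD h hσ (support_qp hj).1 (support_qp hj).2 hr hf hψ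
  have h3 := h1.add (tendsto_finset_sum (qp ℓ).support (fun j hj => ((h2 j hj).1.const_mul ((qp ℓ).coeff j))))
  have e1 : ∀ n : ℕ, ∫ y, AA ℓ e σ θ n F l y * ψ y = (∫ y, {y | σ / 2 ^ n < t y}.indicator (fun y => G y * ψ y) y) +
      ∑ j ∈ (qp ℓ).support, (qp ℓ).coeff j * ∫ y, {y | t y ≤ σ / 2 ^ n}.indicator (fun y => F l (y + (4 * (σ / 2 ^ n) * j) • e) * ψ y) y := by
    intro n
    simp_rw [← integral_const_mul]
    rw [← integral_finset_sum _ (fun j hj => ((h2 j hj).2 n).const_mul _), ← integral_add (hGi.indicator (hm n))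
      (integrable_finset_sum _ (fun j hj => ((h2 j hj).2 n).const_mul _))]
    congr 1
    ext y
    by_cases hy : t y ≤ σ / 2 ^ n
    · simp only [indicator, mem_setOf_eq, if_pos hy, if_neg (not_lt.2 hy), zero_add]
      rw [AA_low hσ hcont hθ hy]
      unfold TT
      rw [pq_apply]
      simp only [trl, smul_smul, Finset.sum_mul]
      refine Finset.sum_congr rfl fun j _ => ?_
      rw [mul_assoc, mul_comm (j:ℝ)]
    · simp only [indicator, mem_setOf_eq, if_neg hy, if_pos (not_le.1 hy), mul_zero, Finset.sum_const_zero, add_zero]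
      rw [hGd, GG_pos hσ hcont hθ (not_le.1 hy)]
  simp_rw [e1]
  convert h3 using 2
  rw [← Finset.sum_mul, sum_qp ℓ hl, one_mul]
  have e2 : ∀ y, {y | t y < 0}.indicator (fun y => F l y * ψ y) y = {y | t y < 0}.indicator (fun y => G y * ψ y) y := by
    intro y
    simp only [indicator, mem_setOf_eq]
    split_ifs with hy
    · rw [hGd, GG, if_pos hy]
    · rfl
  simp_rw [e2]
  rw [← integral_add (hGi.indicator (isOpen_lt continuous_const hcont).measurableSet)
    (hGi.indicator (isOpen_lt hcont continuous_const).measurableSet)]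
  congr 1
  ext y
  simp only [indicator, mem_setOf_eq]
  rcases lt_trichotomy (t y) 0 with h0 | h0 | h0
  · rw [if_neg (not_lt.2 h0.le), if_pos h0, zero_add]
  · rw [if_neg (not_lt.2 h0.le), if_neg (not_lt.2 h0.ge), hGd, GG, if_neg (not_lt.2 h0.ge), if_pos h0]; simp
  · rw [if_pos h0, if_neg (not_lt.2 h0.le), add_zero]

end localext3

section localext4
variable {d : ℕ}

lemma LG_of {D : Set (Rd d)} (hD : IsOpen D) {x : Rd d} (hx : x ∈ frontier D) (h : LipschitzGraphAt D x) :
    ∃ (r : ℝ) (K : ℝ≥0) (t : Rd d → ℝ) (e : Rd d), LG D x r K t e := by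
  obtain ⟨L, i, φ, K, r, hr, -, hφ, hup, hmem⟩ := h
  set Lc : Rd d →L[ℝ] Rd d := LinearMap.toContinuousLinearMap L.toLinearMap with hLc
  have hLc' : ∀ y, Lc y = L y := fun y => rfl
  set t : Rd d → ℝ := fun y => φ (L y) - L y i with ht
  have hlip : LipschitzWith (K * ‖Lc‖₊ + 1 * ‖Lc‖₊) t := by
    have h1 : LipschitzWith (K * ‖Lc‖₊) (fun y => φ (L y)) := hφ.comp Lc.lipschitz
    have h2 : LipschitzWith (1 * ‖Lc‖₊) (fun y => L y i) := (LipschitzWith.eval i).comp Lc.lipschitz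
    exact h1.sub h2
  refine ⟨r, _, t, L.symm (Pi.single i 1), hr, hlip, ?_, ?_, ?_⟩
  · intro y s
    have e1 : L (y + s • L.symm (Pi.single i 1)) = Function.update (L y) i (L y i + s) := by
      rw [map_add, map_smul, LinearEquiv.apply_symm_apply]
      ext k
      by_cases hk : k = i
      · subst hk; simp
      · simp [hk]
    simp only [ht, e1, hup, Function.update_self]
    ring
  · by_contra hpos
    have hpos : 0 < t x := not_le.1 hpos
    have hx' : x ∈ closure D := hx.1
    have hn : {y | 0 < t y} ∩ ball x r ∈ 𝓝 x :=
      inter_mem ((isOpen_lt continuous_const hlip.continuous).mem_nhds hpos) (ball_mem_nhds _ hr)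
    obtain ⟨y, ⟨hy1, hy2⟩, hy3⟩ := mem_closure_iff_nhds.1 hx' _ hn
    have := (hmem y hy2).1 hy3
    simp only [ht, mem_setOf_eq] at hy1
    linarith
  · intro y hy
    rw [hmem y hy]
    simp only [ht]
    constructor <;> intro h <;> linarith

lemma local_ext {P : ℝ≥0∞} (hP : 1 ≤ P) (hP' : P ≠ ⊤) {ℓ : ℕ} (hl : 1 ≤ ℓ) {D : Set (Rd d)} (hD : IsOpen D)
    {x : Rd d} (hx : x ∈ frontier D) (hlip : LipschitzGraphAt D x) :
    ∃ ρ : ℝ, 0 < ρ ∧ ∃ (E : (Rd d → ℝ) →ₗ[ℝ] (Rd d → ℝ)) (A : ℝ≥0), ∀ F : List (Fin d) → Rd d → ℝ, Jet P D ℓ F →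
      ∃ G : List (Fin d) → Rd d → ℝ, Jet P (ball x ρ) ℓ G ∧ G [] = E (F []) ∧
        (∀ l, ∀ y ∈ ball x ρ ∩ D, G l y = F l y) ∧
        ∀ l, l.length ≤ ℓ → nm P (ball x ρ) (G l) ≤ A * nm P D (gm l.length F) := by
  obtain ⟨r, K, t, e, h⟩ := LG_of hD hx hlip
  obtain ⟨C, hC, hcut⟩ := cutoff d K ℓ
  have hcont := h.lip.continuous
  have hr := h.rpos
  have hl' : (1:ℝ) ≤ ℓ := by exact_mod_cast hl
  set σ : ℝ := r / (2 * (4 * ℓ * ‖e‖ + 1)) with hσd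
  have hσ : 0 < σ := by positivity
  set ρ : ℝ := min (r / 2) (σ / (K + 1)) with hρd
  have hρ0 : 0 < ρ := by
    apply lt_min <;> positivity
  have h1 : ρ + 4 * ℓ * σ * ‖e‖ ≤ r := by
    have a1 : ρ ≤ r / 2 := min_le_left _ _
    have a2 : 4 * ℓ * σ * ‖e‖ ≤ r / 2 := by
      have : σ * (2 * (4 * ℓ * ‖e‖ + 1)) = r := by rw [hσd]; field_simp
      nlinarith
    linarith
  have h2 : ρ ≤ r := by
    have a1 : ρ ≤ r / 2 := min_le_left _ _
    linarith
  have h3 : ∀ y ∈ ball x ρ, t y < σ := by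
    intro y hy
    have a1 := h.lip.dist_le_mul y x
    rw [mem_ball] at hy
    have a2 : ρ ≤ σ / (K + 1) := min_le_right _ _
    rw [le_div_iff₀ (by positivity)] at a2
    have a3 : |t y - t x| ≤ K * dist y x := by rwa [Real.dist_eq] at a1
    have a4 := le_abs_self (t y - t x)
    have a5 := h.t0
    have a6 : (K:ℝ) * dist y x ≤ K * ρ := by gcongr
    have a7 : (0:ℝ) ≤ K := K.2
    nlinarith
  choose θ hθ using fun k : ℕ => hcut (σ / 2 ^ (k + 1)) (by positivity) t h.lip
  have hCO : CO σ t ℓ C θ := ⟨fun k => (hθ k).1, fun k => (hθ k).2.1, fun k => (hθ k).2.2.1, fun k => (hθ k).2.2.2⟩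
  obtain ⟨A, hA⟩ := GG_bound hP hP' hl e hC
  refine ⟨ρ, hρ0, ⟨⟨fun f => GG ℓ e σ θ t (fun _ => f) [], ?_⟩, ?_⟩, A, ?_⟩
  · intro f g
    ext y
    simp only [GG, Pi.add_apply]
    split_ifs
    · rfl
    · simp
    · simp only [AA, Leib, SS, map_add, Pi.add_apply]
      rw [add_add_add_comm, ← Finset.sum_add_distrib]
      congr 1
      refine Finset.sum_congr rfl fun k _ => ?_
      ring
  · intro c f
    ext y
    simp only [GG, Pi.smul_apply, RingHom.id_apply]
    split_ifs
    · rfl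
    · simp
    · simp only [AA, Leib, SS, map_smul, Pi.smul_apply, smul_eq_mul]
      rw [mul_add, Finset.mul_sum]
      congr 1
      refine Finset.sum_congr rfl fun k _ => ?_
      ring
  · intro F hF
    refine ⟨GG ℓ e σ θ t F, ⟨?_, ?_⟩, ?_, ?_, ?_⟩
    · intro l hll
      exact (hA hD h hσ h1 h2 h3 hCO hF l hll).1
    · intro l i hll φ hφ
      have a1 := AA_lim hP hD h hσ hl h1 hCO (hF.mem l hll.le) (hφ.pd i) (hA hD h hσ h1 h2 h3 hCO hF l hll.le).1
      have a2 := AA_lim hP hD h hσ hl h1 hCO (hF.mem (i :: l) (by simpa using hll)) hφ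
        (hA hD h hσ h1 h2 h3 hCO hF (i :: l) (by simpa using hll)).1
      refine tendsto_nhds_unique a1 ?_
      refine a2.neg.congr fun n => ?_
      exact ((AA_jet hP hD h hl hσ h1 h3 hC hCO hF n).wd l i hll φ hφ).symm
    · rfl
    · rintro l y ⟨hy1, hy2⟩
      rw [GG, if_pos ((h.mem y (ball_subset_ball h2 hy1)).1 hy2)]
    · intro l hll
      exact (hA hD h hσ h1 h2 h3 hCO hF l hll).2

end localext4

/-! ## Polynomial projection -/

section proj
variable {d : ℕ}

lemma jet_int {P : ℝ≥0∞} {U : Set (Rd d)} {n : ℕ} {F : List (Fin d) → Rd d → ℝ} (hF : Jet P U n F)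
    (l : List (Fin d)) (hl : l.length ≤ n) {θ : Rd d → ℝ} (hθ : Tst U θ) :
    ∫ x, F l x * θ x = (-1) ^ l.length * ∫ x, F [] x * pdl l θ x := by
  induction l generalizing θ with
  | nil => simp [pdl]
  | cons i l ih =>
    simp only [List.length_cons] at hl
    have h1 := hF.wd l i (by omega) θ hθ
    have h2 := ih (by omega) (hθ.pd i)
    rw [h1] at h2
    have h3 : pdl l (pd i θ) = pdl (i :: l) θ := by
      rw [pdl_pd hθ.1]
    rw [h3] at h2
    rw [List.length_cons, pow_succ]
    linarith

/-- Homogeneous polynomial with prescribed derivatives. -/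
def Hom : ℕ → (List (Fin d) → ℝ) → Rd d → ℝ
  | 0, a => fun _ => a []
  | m + 1, a => fun x => (1 / ((m : ℝ) + 1)) * ∑ i, x i * Hom m (fun l => a (i :: l)) x

/-- Symmetric coefficients. -/
def PI (a : List (Fin d) → ℝ) : Prop := ∀ l l', l.Perm l' → a l = a l'

lemma PI.cons {a : List (Fin d) → ℝ} (h : PI a) (i : Fin d) : PI (fun l => a (i :: l)) :=
  fun _ _ hl => h _ _ (hl.cons i)

lemma Hom_sm (m : ℕ) (a : List (Fin d) → ℝ) : Sm (Hom m a) := by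
  induction m generalizing a with
  | zero => exact contDiff_const
  | succ m ih =>
    unfold Hom
    refine contDiff_const.mul (ContDiff.sum fun i _ => ?_)
    exact (contDiff_apply ℝ ℝ i).mul (ih _)

lemma Hom_add (m : ℕ) (a b : List (Fin d) → ℝ) (x : Rd d) : Hom m (fun l => a l + b l) x = Hom m a x + Hom m b x := by
  induction m generalizing a b with
  | zero => rfl
  | succ m ih =>
    simp only [Hom, ih, mul_add, Finset.sum_add_distrib]

lemma Hom_smul (m : ℕ) (c : ℝ) (a : List (Fin d) → ℝ) (x : Rd d) : Hom m (fun l => c * a l) x = c * Hom m a x := by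
  induction m generalizing a with
  | zero => rfl
  | succ m ih =>
    simp only [Hom, ih]
    rw [mul_left_comm, Finset.mul_sum _ _ c]
    congr 1
    exact Finset.sum_congr rfl fun i _ => by ring

lemma Hom_bound (m : ℕ) (a : List (Fin d) → ℝ) {x : Rd d} {R M : ℝ} (hR : ‖x‖ ≤ R) (hM : ∀ l, l.length = m → |a l| ≤ M) :
    |Hom m a x| ≤ (d * R) ^ m * M := by
  have hR0 : 0 ≤ R := (norm_nonneg x).trans hR
  induction m generalizing a with
  | zero => simpa [Hom] using hM [] rfl
  | succ m ih =>
    have h1 : ∀ i, |x i * Hom m (fun l => a (i :: l)) x| ≤ R * ((d * R) ^ m * M) := by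
      intro i
      rw [abs_mul]
      have := ih (fun l => a (i :: l)) (fun l hl => hM _ (by simp [hl]))
      have h2 : |x i| ≤ R := (norm_le_pi_norm x i).trans hR
      gcongr
    simp only [Hom]
    rw [abs_mul]
    have h3 : |(1 / ((m:ℝ) + 1))| ≤ 1 := by
      rw [abs_of_nonneg (by positivity), div_le_one (by positivity)]
      have : (0:ℝ) ≤ m := by positivity
      linarith
    calc _ ≤ 1 * ∑ i : Fin d, R * ((d * R) ^ m * M) := by
          gcongr
          exact (Finset.abs_sum_le_sum_abs _ _).trans (Finset.sum_le_sum fun i _ => h1 i)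
      _ = _ := by simp; ring

lemma pd_const (i : Fin d) (c : ℝ) : pd i (fun _ => c) = fun _ => 0 := by
  ext x; simp [HC.pd]

lemma pd_Hom (m : ℕ) {a : List (Fin d) → ℝ} (ha : PI a) (i : Fin d) : pd i (Hom (m + 1) a) = Hom m (fun l => a (i :: l)) := by
  have key : ∀ m (a : List (Fin d) → ℝ) x, pd i (Hom (m + 1) a) x = 1 / ((m:ℝ) + 1) *
      (Hom m (fun l => a (i :: l)) x + ∑ k, x k * pd i (Hom m (fun l => a (k :: l))) x) := by
    intro m a x
    have h1 : ∀ k : Fin d, HasFDerivAt (fun x : Rd d => x k * Hom m (fun l => a (k :: l)) x)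
        (x k • fderiv ℝ (Hom m (fun l => a (k :: l))) x + Hom m (fun l => a (k :: l)) x • (ContinuousLinearMap.proj k : Rd d →L[ℝ] ℝ)) x := by
      intro k
      exact (ContinuousLinearMap.proj (R := ℝ) (φ := fun _ : Fin d => ℝ) k).hasFDerivAt.mul
        ((Hom_sm m (fun l => a (k :: l))).diff x).hasFDerivAt
    have h2 := (HasFDerivAt.fun_sum (u := Finset.univ) (fun k _ => h1 k)).const_mul (1 / ((m:ℝ) + 1))
    simp only [HC.pd, Hom]
    rw [h2.fderiv]
    have h4 : ∀ (c : ℝ) (Λ : Fin d → Rd d →L[ℝ] ℝ) (v : Rd d), (c • ∑ k, Λ k) v = c * ∑ k, Λ k v := by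
      intro c Λ v
      rw [ContinuousLinearMap.smul_apply, ContinuousLinearMap.sum_apply]; rfl
    rw [h4]
    have h5 : ∀ k : Fin d, (x k • fderiv ℝ (Hom m (fun l => a (k :: l))) x + Hom m (fun l => a (k :: l)) x • (ContinuousLinearMap.proj k : Rd d →L[ℝ] ℝ)) (Pi.single i 1)
      = x k * fderiv ℝ (Hom m (fun l => a (k :: l))) x (Pi.single i 1) + Hom m (fun l => a (k :: l)) x * (Pi.single i 1 : Rd d) k := fun k => rfl
    rw [Finset.sum_congr rfl (fun k _ => h5 k)]
    have h6 : ∑ k, Hom m (fun l => a (k :: l)) x * (Pi.single i 1 : Rd d) k = Hom m (fun l => a (i :: l)) x := by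
      simp [Pi.single_apply]
    rw [Finset.sum_add_distrib, h6, add_comm (∑ k, x k * _)]
  induction m generalizing a with
  | zero =>
    ext x
    rw [key]
    simp [Hom, pd_const]
  | succ m ih =>
    ext x
    rw [key]
    have h1 : ∀ k, pd i (Hom (m + 1) (fun l => a (k :: l))) = Hom m (fun l => a (i :: k :: l)) := by
      intro k
      rw [ih (ha.cons k)]
      congr 1
      ext l
      exact ha _ _ (List.Perm.swap _ _ _)
    simp_rw [h1]
    have h2 : Hom (m + 1) (fun l => a (i :: l)) x = 1 / ((m:ℝ) + 1) * ∑ k, x k * Hom m (fun l => a (i :: k :: l)) x := rfl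
    have h3 : ∑ k, x k * Hom m (fun l => a (i :: k :: l)) x = ((m:ℝ) + 1) * Hom (m + 1) (fun l => a (i :: l)) x := by
      rw [h2]; field_simp
    rw [h3]
    push_cast
    field_simp
    ring

lemma pdl_Hom (l : List (Fin d)) (k : ℕ) {a : List (Fin d) → ℝ} (ha : PI a) :
    pdl l (Hom (k + l.length) a) = Hom k (fun l' => a (l ++ l')) := by
  induction l generalizing k with
  | nil => rfl
  | cons i l ih =>
    have : k + (i :: l).length = (k + 1) + l.length := by simp; omega
    rw [this, pdl, ih, pd_Hom k (a := fun l' => a (l ++ l')) (fun l1 l2 h => ha _ _ (h.append_left l))]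
    congr 1
    ext l'
    apply ha
    exact List.perm_middle

lemma pdl_Hom_eq {l : List (Fin d)} {m : ℕ} (hl : l.length = m) {a : List (Fin d) → ℝ} (ha : PI a) :
    pdl l (Hom m a) = fun _ => a l := by
  have := pdl_Hom l 0 ha
  rw [zero_add, hl] at this
  rw [this]; simp [Hom]

lemma pdl_zero_fun (l : List (Fin d)) : pdl l (fun _ => (0:ℝ)) = fun _ => 0 := by
  induction l with
  | nil => rfl
  | cons i l ih => rw [pdl, ih, pd_const]

lemma pdl_const (l : List (Fin d)) (hl : l ≠ []) (c : ℝ) : pdl l (fun _ => c) = fun _ => 0 := by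
  induction l with
  | nil => exact absurd rfl hl
  | cons i l ih =>
    by_cases h : l = []
    · subst h; simp [pdl, pd_const]
    · rw [pdl, ih h, pd_const]

lemma pdl_Hom_gt {l : List (Fin d)} {m : ℕ} (hl : m < l.length) {a : List (Fin d) → ℝ} (ha : PI a) :
    pdl l (Hom m a) = fun _ => 0 := by
  have h1 : l = l.take (l.length - m) ++ l.drop (l.length - m) := (List.take_append_drop _ _).symm
  rw [h1, pdl_append, pdl_Hom_eq (by simp; omega) ha]
  apply pdl_const
  intro h
  have := congrArg List.length h
  simp at this
  omega

lemma pd_add {f g : Rd d → ℝ} (hf : Sm f) (hg : Sm g) (i : Fin d) : pd i (fun x => f x + g x) = fun x => pd i f x + pd i g x := by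
  ext x
  simp only [HC.pd]
  rw [fderiv_fun_add (hf.diff x) (hg.diff x)]; rfl

lemma pdl_add {f g : Rd d → ℝ} (hf : Sm f) (hg : Sm g) (l : List (Fin d)) :
    pdl l (fun x => f x + g x) = fun x => pdl l f x + pdl l g x := by
  induction l with
  | nil => rfl
  | cons i l ih => rw [pdl, ih, pd_add (hf.pdl l) (hg.pdl l)]; rfl

lemma ML.pair_bound {P : ℝ≥0∞} (hP : 1 ≤ P) {U : Set (Rd d)} (hU : Bornology.IsBounded U) (hUm : MeasurableSet U) {κ : Rd d → ℝ} (hκ : Tst U κ) :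
    ∃ C : ℝ≥0, ∀ f, ML P U f → ENNReal.ofReal |∫ x, f x * κ x| ≤ C * nm P U f := by
  obtain ⟨M, hM⟩ := hκ.1.continuous.bounded_above_of_compact_support hκ.2.1
  have hM0 : 0 ≤ M := (norm_nonneg _).trans (hM 0)
  have hfin : volume U < ⊤ := hU.measure_lt_top
  have hne : volume U ^ (1 / (1:ℝ≥0∞).toReal - 1 / P.toReal) ≠ ⊤ := by
    apply ENNReal.rpow_ne_top_of_nonneg _ hfin.ne
    by_cases hPt : P = ⊤
    · simp [hPt]
    · have : 1 ≤ P.toReal := by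
        have := (ENNReal.toReal_le_toReal (by simp) hPt).2 hP
        simpa using this
      simp only [ENNReal.toReal_one, div_one, one_div, sub_nonneg]
      exact inv_le_one_of_one_le₀ this
  refine ⟨M.toNNReal * (volume U ^ (1 / (1:ℝ≥0∞).toReal - 1 / P.toReal)).toNNReal, fun f hf => ?_⟩
  have h0 : ∀ x, x ∉ U → κ x = 0 := by
    intro x hx
    by_contra hne
    exact hx (hκ.2.2 (subset_tsupport _ hne))
  have h1 : ∫ x, f x * κ x = ∫ x in U, f x * κ x := by
    symm
    apply setIntegral_eq_integral_of_forall_compl_eq_zero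
    intro x hx
    rw [h0 x hx, mul_zero]
  rw [h1]
  calc ENNReal.ofReal |∫ x in U, f x * κ x| = ‖∫ x in U, f x * κ x‖ₑ := by
        rw [← Real.norm_eq_abs, ofReal_norm_eq_enorm]
    _ ≤ ∫⁻ x in U, ‖f x * κ x‖ₑ := enorm_integral_le_lintegral_enorm _
    _ ≤ ∫⁻ x in U, (M.toNNReal : ℝ≥0∞) * ‖f x‖ₑ := by
        gcongr with x
        rw [enorm_mul, mul_comm]
        gcongr
        rw [← ofReal_norm_eq_enorm]
        exact ENNReal.ofReal_le_ofReal (hM x)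
    _ = M.toNNReal * eLpNorm f 1 (volume.restrict U) := by
        rw [lintegral_const_mul' _ _ ENNReal.coe_ne_top, eLpNorm_one_eq_lintegral_enorm]
    _ ≤ M.toNNReal * (nm P U f * volume U ^ (1 / (1:ℝ≥0∞).toReal - 1 / P.toReal)) := by
        gcongr
        have := eLpNorm_le_eLpNorm_mul_rpow_measure_univ hP hf.1
        rwa [Measure.restrict_apply_univ] at this
    _ = _ := by
        push_cast
        rw [ENNReal.coe_toNNReal hne]
        ring

lemma pdl_smul {f : Rd d → ℝ} (hf : Sm f) (c : ℝ) (l : List (Fin d)) :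
    pdl l (fun x => c * f x) = fun x => c * pdl l f x := by
  induction l with
  | nil => rfl
  | cons i l ih =>
    rw [pdl, ih]
    ext x
    simp only [HC.pd, pdl]
    rw [fderiv_const_mul ((hf.pdl l).diff x)]; rfl

end proj

section proj2
variable {d : ℕ}

/-- Bounded linear projections onto polynomials. -/
structure Pr (P : ℝ≥0∞) (B : Set (Rd d)) (ℓ : ℕ) (Q : (Rd d → ℝ) → Rd d → ℝ) : Prop where
  sm : ∀ f, Sm (Q f)
  top : ∀ f l, ℓ ≤ l.length → pdl l (Q f) = fun _ => 0
  add : ∀ f g, ML P B f → ML P B g → Q (fun x => f x + g x) = fun x => Q f x + Q g x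
  smul : ∀ (c : ℝ) f, Q (fun x => c * f x) = fun x => c * Q f x
  bd : ∀ U, Bornology.IsBounded U → ∃ C : ℝ≥0, ∀ f, ML P B f → nm P U (Q f) ≤ C * nm P B f

/-- Averages. -/
def av (Q : (Rd d → ℝ) → Rd d → ℝ) (θ : Rd d → ℝ) (f : Rd d → ℝ) (l : List (Fin d)) : ℝ :=
  (-1) ^ l.length * ∫ x, (f x - Q f x) * pdl l θ x

lemma av_PI (Q : (Rd d → ℝ) → Rd d → ℝ) {θ : Rd d → ℝ} (hθ : Sm θ) (f : Rd d → ℝ) : PI (av Q θ f) := by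
  intro l l' h
  unfold av
  rw [h.length_eq, pdl_perm hθ h]

lemma nm_const_le {P : ℝ≥0∞} (hP : 1 ≤ P) {U : Set (Rd d)} (hU : Bornology.IsBounded U) (hUm : MeasurableSet U) {f : Rd d → ℝ} {M : ℝ}
    (hM : ∀ x ∈ U, |f x| ≤ M) : nm P U f ≤ ((max 1 (volume U)).toNNReal : ℝ≥0∞) * ENNReal.ofReal M := by
  have hfin : volume U < ⊤ := hU.measure_lt_top
  have h0 : nm P U f ≤ volume U ^ P.toReal⁻¹ * ENNReal.ofReal M := by
    have := eLpNorm_le_of_ae_bound (p := P) (μ := volume.restrict U) (f := f) (C := M) ?_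
    · rwa [Measure.restrict_apply_univ] at this
    · exact ae_restrict_of_forall_mem hUm hM
  refine h0.trans ?_
  gcongr
  rw [ENNReal.coe_toNNReal (by simp [hfin.ne])]
  by_cases hPt : P = ⊤
  · simp [hPt]
  have hp1 : 1 ≤ P.toReal := by
    have := (ENNReal.toReal_le_toReal (by simp) hPt).2 hP
    simpa using this
  calc volume U ^ P.toReal⁻¹ ≤ (max 1 (volume U)) ^ P.toReal⁻¹ := by
        gcongr; exact le_max_right _ _
    _ ≤ (max 1 (volume U)) ^ (1:ℝ) := by
        apply ENNReal.rpow_le_rpow_of_exponent_le (le_max_left _ _)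
        exact inv_le_one_of_one_le₀ hp1
    _ = _ := by simp

lemma Jet.resid {P : ℝ≥0∞} (hP : 1 ≤ P) {B : Set (Rd d)} (hB : Bornology.IsBounded B) {ℓ : ℕ} {F : List (Fin d) → Rd d → ℝ}
    (hF : Jet P B ℓ F) {q : Rd d → ℝ} (hq : Sm q) : Jet P B ℓ (fun l x => F l x - pdl l q x) :=
  Jet.sub hP hF (Jet.smooth P hB ℓ hq)

lemma proj_exists {P : ℝ≥0∞} (hP : 1 ≤ P) {x0 : Rd d} {ρ : ℝ} {θ : Rd d → ℝ} (hθ : Tst (ball x0 ρ) θ) (hθi : ∫ x, θ x = 1)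
    (ℓ : ℕ) (k : ℕ) (hk : k ≤ ℓ) : ∃ Q : (Rd d → ℝ) → Rd d → ℝ, Pr P (ball x0 ρ) ℓ Q ∧
      ∀ F, Jet P (ball x0 ρ) ℓ F → ∀ l : List (Fin d), ℓ ≤ l.length + k → l.length < ℓ →
        ∫ x, (F l x - pdl l (Q (F [])) x) * θ x = 0 := by
  induction k with
  | zero =>
    refine ⟨fun _ _ => 0, ⟨fun _ => contDiff_const, fun _ l _ => pdl_zero_fun l, fun _ _ _ _ => by simp, fun _ _ => by simp, 
      fun U _ => ⟨0, fun f _ => by simp [nm]⟩⟩, fun F hF l h1 h2 => by omega⟩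
  | succ k ih =>
    obtain ⟨Q, hQ, hQ0⟩ := ih (by omega)
    have hB : Bornology.IsBounded (ball x0 ρ) := isBounded_ball
    set m := ℓ - 1 - k with hm
    have hInt : ∀ f, ML P (ball x0 ρ) f → ∀ l, Integrable (fun x => (f x - Q f x) * pdl l θ x) := by
      intro f hf l
      exact ML.integrable_tst hP (hf.sub (ML.of_cont hB (hQ.sm f).continuous)) (hθ.pdl l)
    refine ⟨fun f x => Q f x + Hom m (av Q θ f) x, ⟨?_, ?_, ?_, ?_, ?_⟩, ?_⟩
    · exact fun f => (hQ.sm f).add (Hom_sm _ _)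
    · intro f l hl
      rw [pdl_add (hQ.sm f) (Hom_sm _ _), hQ.top f l hl, pdl_Hom_gt (by omega) (av_PI Q hθ.1 f)]
      simp
    · intro f g hf hg
      ext x
      have : av Q θ (fun x => f x + g x) = fun l => av Q θ f l + av Q θ g l := by
        ext l
        unfold av
        rw [← mul_add, ← integral_add (hInt f hf l) (hInt g hg l), hQ.add f g hf hg]
        congr 2
        ext x
        ring
      rw [this, Hom_add, hQ.add f g hf hg]
      ring
    · intro c f
      ext x
      have : av Q θ (fun x => c * f x) = fun l => c * av Q θ f l := by
        ext l
        unfold av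
        have h1 : ∫ x, (c * f x - Q (fun x => c * f x) x) * pdl l θ x = c * ∫ x, (f x - Q f x) * pdl l θ x := by
          rw [← integral_const_mul, hQ.smul]
          refine integral_congr_ae (Eventually.of_forall fun x => ?_)
          simp only
          ring
        rw [h1]
        ring
      rw [this, Hom_smul, hQ.smul]
      ring
    · intro U0 hU0
      obtain ⟨R, hR0, hUR⟩ : ∃ R : ℝ, 0 ≤ R ∧ U0 ⊆ closedBall 0 R := by
        obtain ⟨R, hR⟩ := hU0.subset_closedBall 0
        exact ⟨max R 0, le_max_right _ _, hR.trans (closedBall_subset_closedBall (le_max_left _ _))⟩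
      suffices hsuf : ∃ C : ℝ≥0, ∀ f, ML P (ball x0 ρ) f → nm P (closedBall (0 : Rd d) R)
          (fun x => Q f x + Hom m (av Q θ f) x) ≤ C * nm P (ball x0 ρ) f by
        obtain ⟨C, hC⟩ := hsuf
        exact ⟨C, fun f hf => (nm_mono hUR).trans (hC f hf)⟩
      have hU : Bornology.IsBounded (closedBall (0 : Rd d) R) := isBounded_closedBall
      set U := closedBall (0 : Rd d) R with hUdef
      have hR : ∀ x ∈ U, ‖x‖ ≤ R := fun x hx => by simpa [hUdef] using hx
      obtain ⟨C1, hC1⟩ := hQ.bd U hU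
      obtain ⟨C2, hC2⟩ := hQ.bd (ball x0 ρ) hB
      choose C3 hC3 using fun l : List (Fin d) => ML.pair_bound hP hB measurableSet_ball (hθ.pdl l)
      set C4 : ℝ≥0 := ∑ j : Fin m → Fin d, C3 (List.ofFn j) with hC4
      have h4 : ∀ l : List (Fin d), l.length = m → C3 l ≤ C4 := by
        intro l hl
        rw [hC4]
        clear hC4 C4
        clear_value m
        subst hl
        have : C3 l = C3 (List.ofFn l.get) := by rw [List.ofFn_get]
        rw [this]
        exact Finset.single_le_sum (f := fun j => C3 (List.ofFn j)) (fun _ _ => bot_le) (Finset.mem_univ _)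
      refine ⟨C1 + (max 1 (volume U)).toNNReal * ((d * R) ^ m).toNNReal * C4 * (1 + C2), fun f hf => ?_⟩
      have hQf : ML P (ball x0 ρ) (Q f) := ML.of_cont hB (hQ.sm f).continuous
      set N := nm P (ball x0 ρ) f with hN
      have hNt : N ≠ ⊤ := hf.nm_ne_top
      have h5 : ∀ l : List (Fin d), l.length = m → |av Q θ f l| ≤ (C4 * (1 + C2) * N).toReal := by
        intro l hl
        rw [← ENNReal.ofReal_le_iff_le_toReal (by finiteness)]
        unfold av
        rw [abs_mul, abs_pow, abs_neg, abs_one, one_pow, one_mul]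
        refine (hC3 l _ (hf.sub hQf)).trans ?_
        rw [mul_assoc]
        refine mul_le_mul' (ENNReal.coe_le_coe.2 (h4 l hl)) ?_
        refine (nm_sub_le hP hf hQf).trans ?_
        rw [add_mul, one_mul]
        exact add_le_add le_rfl (hC2 f hf)
      have h6 : nm P U (Hom m (av Q θ f)) ≤ ((max 1 (volume U)).toNNReal * ((d * R) ^ m).toNNReal * C4 * (1 + C2) : ℝ≥0) * N := by
        refine (nm_const_le hP hU measurableSet_closedBall (fun x hx => Hom_bound m _ (hR x hx) h5)).trans ?_
        rw [ENNReal.ofReal_mul (by positivity), ENNReal.ofReal_toReal (by finiteness)]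
        push_cast
        rw [← ENNReal.ofNNReal_toNNReal]
        simp only [mul_assoc]
        exact le_rfl
      refine (nm_add_le hP (ML.of_cont hU (hQ.sm f).continuous) (ML.of_cont hU (Hom_sm _ _).continuous)).trans ?_
      push_cast at h6 ⊢
      rw [add_mul]
      exact add_le_add (hC1 f hf) h6
    · intro F hF l h1 h2
      have hH := hF.resid hP hB (hQ.sm (F []))
      by_cases hl : l.length = m
      · rw [pdl_add (hQ.sm _) (Hom_sm _ _), pdl_Hom_eq hl (av_PI Q hθ.1 _)]
        have h3 := jet_int hH l h2.le hθ
        have h4 : ∫ x, (F l x - pdl l (Q (F [])) x) * θ x = av Q θ (F []) l := h3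
        have h5 : Integrable (fun x => (F l x - pdl l (Q (F [])) x) * θ x) := ML.integrable_tst hP (hH.mem l h2.le) hθ
        have h6 : Integrable θ := hθ.1.continuous.integrable_of_hasCompactSupport hθ.2.1
        calc _ = ∫ x, ((F l x - pdl l (Q (F [])) x) * θ x - av Q θ (F []) l * θ x) := by
              congr 1; ext x; ring
          _ = 0 := by
              rw [integral_sub h5 (h6.const_mul _), h4, integral_const_mul, hθi]; ring
      · rw [pdl_add (hQ.sm _) (Hom_sm _ _), pdl_Hom_gt (by omega) (av_PI Q hθ.1 _)]
        simp only [add_zero]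
        exact hQ0 F hF l (by omega) h2

end proj2

section chain
variable {d : ℕ}

lemma exists_theta (x0 : Rd d) {r : ℝ} (hr : 0 < r) : ∃ θ : Rd d → ℝ, Tst (ball x0 r) θ ∧ ∫ x, θ x = 1 := by
  let b : ContDiffBump x0 := ⟨r / 4, r / 2, by positivity, by linarith⟩
  refine ⟨b.normed volume, ⟨b.contDiff_normed, b.hasCompactSupport_normed, ?_⟩, b.integral_normed⟩
  rw [b.tsupport_normed_eq]
  exact closedBall_subset_ball (show r / 2 < r by linarith)

lemma good0 {P : ℝ≥0∞} (hP : 1 ≤ P) (hP' : P ≠ ⊤) (x0 : Rd d) {R : ℝ} (hR : 0 < R) (ℓ : ℕ) :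
    ∃ Q : (Rd d → ℝ) → Rd d → ℝ, ∃ r : ℝ, 0 < r ∧ r ≤ R ∧ Pr P (ball x0 r) ℓ Q ∧
      ∃ C : ℝ≥0, ∀ F, Jet P (ball x0 R) ℓ F → ∀ l : List (Fin d), l.length ≤ ℓ →
        nm P (ball x0 r) (fun x => F l x - pdl l (Q (F [])) x) ≤ C * nm P (ball x0 R) (gm ℓ F) := by
  have h3 : ∀ k, R / 3 ^ k ≤ R := fun k => div_le_self hR.le (one_le_pow₀ (by norm_num))
  have h30 : ∀ k, 0 < R / 3 ^ k := fun k => by positivity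
  obtain ⟨θ, hθ, hθi⟩ := exists_theta x0 (h30 ℓ)
  obtain ⟨Q, hQ, hQ0⟩ := proj_exists hP hθ hθi ℓ ℓ le_rfl
  refine ⟨Q, R / 3 ^ ℓ, h30 ℓ, h3 ℓ, hQ, ?_⟩
  have key : ∀ k ≤ ℓ, ∃ C : ℝ≥0, ∀ F, Jet P (ball x0 R) ℓ F → ∀ l : List (Fin d), ℓ ≤ l.length + k → l.length ≤ ℓ →
        nm P (ball x0 (R / 3 ^ k)) (fun x => F l x - pdl l (Q (F [])) x) ≤ C * nm P (ball x0 R) (gm ℓ F) := by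
    intro k
    induction k with
    | zero =>
      intro _
      refine ⟨1, fun F hF l h1 h2 => ?_⟩
      have : l.length = ℓ := by omega
      rw [hQ.top _ l this.ge]
      simp only [sub_zero, pow_zero, div_one, ENNReal.coe_one, one_mul]
      subst this
      exact nm_le_gm F l
    | succ k ih =>
      intro hk
      obtain ⟨C, hC⟩ := ih (by omega)
      have hsub : ball x0 (R / 3 ^ ℓ) ⊆ ball x0 (R / 3 ^ (k + 1)) := by
        apply ball_subset_ball
        apply div_le_div_of_nonneg_left hR.le (by positivity)
        exact pow_le_pow_right₀ (by norm_num) hk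
      obtain ⟨C', hC'⟩ := poincare hP hP' (h30 (k + 1)) hθ.1.continuous hθ.2.1 (hθ.2.2.trans hsub) hθi
      have h33 : 3 * (R / 3 ^ (k + 1)) = R / 3 ^ k := by
        rw [pow_succ]; field_simp
      rw [h33] at hC'
      have hsub2 : ball x0 (R / 3 ^ (k + 1)) ⊆ ball x0 (R / 3 ^ k) := by
        apply ball_subset_ball
        linarith [h30 (k + 1)]
      refine ⟨C + C' * (d * C), fun F hF l h1 h2 => ?_⟩
      set M := nm P (ball x0 R) (gm ℓ F)
      by_cases hl : ℓ ≤ l.length + k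
      · refine (nm_mono hsub2).trans ((hC F hF l hl h2).trans ?_)
        gcongr
        exact_mod_cast le_self_add
      · have hlt : l.length < ℓ := by omega
        have hH := (hF.mono (ball_subset_ball (h3 k))).resid hP isBounded_ball (hQ.sm (F []))
        refine (hC' _ (fun i x => F (i :: l) x - pdl (i :: l) (Q (F [])) x) (hH.mem l h2)
          (fun i => hH.mem (i :: l) (by simp; omega)) (fun i => hH.wd l i hlt) ?_).trans ?_
        · exact hQ0 F (hF.mono (ball_subset_ball (h3 ℓ))) l (by omega) hlt
        · calc _ ≤ (C' : ℝ≥0∞) * ∑ i : Fin d, (C : ℝ≥0∞) * M := by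
                gcongr with i _
                exact hC F hF (i :: l) (by simp; omega) (by simp; omega)
            _ = ((C' * (d * C) : ℝ≥0) : ℝ≥0∞) * M := by
                rw [Finset.sum_const, Finset.card_univ, Fintype.card_fin, nsmul_eq_mul]
                push_cast
                ring
            _ ≤ _ := by
                gcongr
                exact_mod_cast le_add_self
  obtain ⟨C, hC⟩ := key ℓ le_rfl
  exact ⟨C, fun F hF l hl => hC F hF l (by omega) hl⟩

/-- Propagation of bounds from a small ball to a large ball. -/
lemma propagate {P : ℝ≥0∞} (hP : 1 ≤ P) (hP' : P ≠ ⊤) {y c : Rd d} {s : ℝ} (hs : 0 < s) (ℓ : ℕ) {R R' : ℝ}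
    (hsub : ball y s ⊆ ball c R') (hR : R' < R) :
    ∃ C : ℝ≥0, ∀ H : List (Fin d) → Rd d → ℝ, Jet P (ball c R) ℓ H → ∀ M : ℝ≥0∞,
      (∀ l, l.length ≤ ℓ → nm P (ball y s) (H l) ≤ M) → (∀ l, l.length = ℓ → nm P (ball c R) (H l) ≤ M) →
      ∀ l, l.length ≤ ℓ → nm P (ball c R') (H l) ≤ C * M := by
  have key : ∀ k, ∀ R R' : ℝ, ball y s ⊆ ball c R' → R' < R → ∃ C : ℝ≥0, ∀ H : List (Fin d) → Rd d → ℝ,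
      Jet P (ball c R) ℓ H → ∀ M : ℝ≥0∞,
      (∀ l, l.length ≤ ℓ → nm P (ball y s) (H l) ≤ M) → (∀ l, l.length = ℓ → nm P (ball c R) (H l) ≤ M) →
      ∀ l, ℓ ≤ l.length + k → l.length ≤ ℓ → nm P (ball c R') (H l) ≤ C * M := by
    intro k
    induction k with
    | zero =>
      intro R R' hsub hR
      refine ⟨1, fun H hH M h1 h2 l h3 h4 => ?_⟩
      simp only [ENNReal.coe_one, one_mul]
      exact (nm_mono (ball_subset_ball hR.le)).trans (h2 l (by omega))
    | succ k ih =>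
      intro R R' hsub hR
      have hm1 : R' < (R + R') / 2 := by linarith
      have hm2 : (R + R') / 2 < R := by linarith
      have hsub' := hsub.trans (ball_subset_ball hm1.le)
      obtain ⟨C, hC⟩ := ih R ((R + R') / 2) hsub' hm2
      obtain ⟨C', hC'⟩ := firstOrder hP hP' hs hsub' hm1
      refine ⟨C + C' * (1 + d * C), fun H hH M h1 h2 l h3 h4 => ?_⟩
      by_cases hl : ℓ ≤ l.length + k
      · refine (nm_mono (ball_subset_ball hm1.le)).trans ((hC H hH M h1 h2 l hl h4).trans ?_)
        gcongr
        exact_mod_cast le_self_add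
      · have hlt : l.length < ℓ := by omega
        have hH' := hH.mono (ball_subset_ball hm2.le)
        refine (hC' _ (fun i => H (i :: l)) (hH'.mem l h4)
          (fun i => hH'.mem (i :: l) (by simp; omega)) (fun i => hH'.wd l i hlt)).trans ?_
        calc _ ≤ (C' : ℝ≥0∞) * (M + ∑ i : Fin d, (C : ℝ≥0∞) * M) := by
                gcongr with i _
                · exact h1 l h4
                · exact hC H hH M h1 h2 (i :: l) (by simp; omega) (by simp; omega)
            _ = ((C' * (1 + d * C) : ℝ≥0) : ℝ≥0∞) * M := by
                rw [Finset.sum_const, Finset.card_univ, Fintype.card_fin, nsmul_eq_mul]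
                push_cast
                ring
            _ ≤ _ := by
                gcongr
                exact_mod_cast le_add_self
  obtain ⟨C, hC⟩ := key ℓ R R' hsub hR
  exact ⟨C, fun H hH M h1 h2 l hl => hC H hH M h1 h2 l (by omega) hl⟩

/-- Sets on which the polynomial approximates the jet. -/
def Good (P : ℝ≥0∞) (D : Set (Rd d)) (ℓ : ℕ) (Q : (Rd d → ℝ) → Rd d → ℝ) (S : Set (Rd d)) : Prop :=
  ∃ C : ℝ≥0, ∀ F, Jet P D ℓ F → ∀ l : List (Fin d), l.length ≤ ℓ →
    nm P S (fun x => F l x - pdl l (Q (F [])) x) ≤ C * nm P D (gm ℓ F)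

lemma Good.mono {P : ℝ≥0∞} {D : Set (Rd d)} {ℓ : ℕ} {Q : (Rd d → ℝ) → Rd d → ℝ} {S T : Set (Rd d)}
    (h : Good P D ℓ Q S) (hT : T ⊆ S) : Good P D ℓ Q T := by
  obtain ⟨C, hC⟩ := h
  exact ⟨C, fun F hF l hl => (nm_mono hT).trans (hC F hF l hl)⟩

lemma chain {P : ℝ≥0∞} (hP : 1 ≤ P) (hP' : P ≠ ⊤) {D : Set (Rd d)} (hD : IsOpen D) (hDc : IsConnected D) (ℓ : ℕ) :
    ∃ (Q : (Rd d → ℝ) → Rd d → ℝ) (B : Set (Rd d)), B ⊆ D ∧ Pr P B ℓ Q ∧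
      ∀ y ∈ D, ∃ s : ℝ, 0 < s ∧ ball y s ⊆ D ∧ Good P D ℓ Q (ball y s) := by
  obtain ⟨x0, hx0⟩ := hDc.nonempty
  obtain ⟨R, hR, hRD⟩ := Metric.isOpen_iff.1 hD x0 hx0
  obtain ⟨Q, r, hr, hrR, hQ, C, hC⟩ := good0 hP hP' x0 hR ℓ
  refine ⟨Q, ball x0 r, (ball_subset_ball hrR).trans hRD, hQ, ?_⟩
  set A : Set (Rd d) := {y | ∃ s : ℝ, 0 < s ∧ ball y s ⊆ D ∧ Good P D ℓ Q (ball y s)} with hA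
  have hAo : IsOpen A := by
    rw [Metric.isOpen_iff]
    rintro y ⟨s, hs, hsD, hsG⟩
    refine ⟨s, hs, fun z hz => ⟨s - dist z y, by simpa using hz, ?_, ?_⟩⟩
    · exact (ball_subset_ball' (by linarith)).trans hsD
    · exact hsG.mono (ball_subset_ball' (by linarith))
  refine hDc.isPreconnected.subset_of_closure_inter_subset hAo ⟨x0, hx0, r, hr, (ball_subset_ball hrR).trans hRD, C, ?_⟩ ?_
  · intro F hF l hl
    refine (hC F (hF.mono hRD) l hl).trans ?_
    gcongr
    exact nm_mono hRD
  · rintro y ⟨hy1, hy2⟩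
    obtain ⟨R, hR, hRD⟩ := Metric.isOpen_iff.1 hD y hy2
    obtain ⟨z, ⟨s, hs, hsD, hsG⟩, hzy⟩ := Metric.mem_closure_iff.1 hy1 (R / 4) (by positivity)
    have hsub : ball z (min s (R / 4)) ⊆ ball y (R / 2) := by
      apply ball_subset_ball'
      rw [dist_comm z y]
      linarith [min_le_right s (R / 4)]
    obtain ⟨C, hC⟩ := propagate hP hP' (lt_min hs (by positivity : 0 < R / 4)) ℓ hsub (by linarith : R / 2 < R)
    obtain ⟨C', hC'⟩ := hsG.mono (ball_subset_ball (min_le_left s (R / 4)))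
    refine ⟨R / 2, by positivity, (ball_subset_ball (by linarith)).trans hRD, C * (C' + 1), fun F hF l hl => ?_⟩
    have hH := (hF.mono hRD).resid hP isBounded_ball (hQ.sm (F []))
    have := hC _ hH ((C' + 1) * nm P D (gm ℓ F)) ?_ ?_ l hl
    · push_cast
      rwa [mul_assoc]
    · intro l hl
      refine (hC' F hF l hl).trans ?_
      gcongr
      exact le_self_add
    · intro l hl
      rw [hQ.top _ l hl.ge]
      simp only [sub_zero]
      refine (nm_mono hRD).trans ?_
      rw [← hl, add_mul, one_mul]
      exact (nm_le_gm F l).trans le_add_self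

end chain

section glue
variable {d : ℕ}

/-- Local extension chart at `x` with radius `ρ`. -/
structure Chart (P : ℝ≥0∞) (D : Set (Rd d)) (ℓ : ℕ) (Q : (Rd d → ℝ) → Rd d → ℝ) (x : Rd d) (ρ : ℝ)
    (E : (Rd d → ℝ) → Rd d → ℝ) (A : ℝ≥0) : Prop where
  pos : 0 < ρ
  add : ∀ f g, ML P D f → ML P D g → E (fun x => f x + g x) = fun x => E f x + E g x
  smul : ∀ (c : ℝ) f, E (fun x => c * f x) = fun x => c * E f x
  ext : ∀ F, Jet P D ℓ F → ∃ G : List (Fin d) → Rd d → ℝ, Jet P (ball x ρ) ℓ G ∧ G [] = E (F []) ∧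
    (∀ y ∈ ball x ρ ∩ D, G [] y = F [] y) ∧ nm P (ball x ρ) (G []) ≤ A * nm P D (F []) ∧
    ∀ l, l.length ≤ ℓ → nm P (ball x ρ) (fun y => G l y - pdl l (Q (F [])) y) ≤ A * nm P D (gm ℓ F)

lemma gm_zero (F : List (Fin d) → Rd d → ℝ) : gm 0 F = fun x => |F [] x| := by
  ext x
  simp [gm]

lemma exists_chart {P : ℝ≥0∞} (hP : 1 ≤ P) (hP' : P ≠ ⊤) {ℓ : ℕ} (hl : 1 ≤ ℓ) {D : Set (Rd d)} (hD : IsOpen D)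
    {Q : (Rd d → ℝ) → Rd d → ℝ} {B : Set (Rd d)} (hBD : B ⊆ D) (hQ : Pr P B ℓ Q)
    (hgood : ∀ y ∈ D, ∃ s : ℝ, 0 < s ∧ ball y s ⊆ D ∧ Good P D ℓ Q (ball y s))
    (x : Rd d) (hlip : x ∈ frontier D → LipschitzGraphAt D x) :
    ∃ ρ E A, Chart P D ℓ Q x ρ E A := by
  by_cases hxD : x ∈ D
  · obtain ⟨s, hs, hsD, C, hC⟩ := hgood x hxD
    refine ⟨s, id, C + 1, hs, fun _ _ _ _ => rfl, fun _ _ => rfl, fun F hF => ⟨F, hF.mono hsD, rfl, fun _ _ => rfl, ?_, ?_⟩⟩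
    · refine (nm_mono hsD).trans ?_
      push_cast
      rw [add_mul, one_mul]
      exact le_add_self
    · intro l hl
      refine (hC F hF l hl).trans ?_
      gcongr
      exact_mod_cast le_self_add
  by_cases hxf : x ∈ closure D
  · have hxfr : x ∈ frontier D := by
      rw [hD.frontier_eq]; exact ⟨hxf, hxD⟩
    obtain ⟨ρ, hρ, E, A, hE⟩ := local_ext hP hP' hl hD hxfr (hlip hxfr)
    obtain ⟨y, hyD, hyx⟩ := Metric.mem_closure_iff.1 hxf (ρ / 4) (by positivity)
    obtain ⟨s, hs, hsD, hsG⟩ := hgood y hyD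
    obtain ⟨C', hC'⟩ := hsG.mono (ball_subset_ball (min_le_left s (ρ / 4)))
    have hsub : ball y (min s (ρ / 4)) ⊆ ball x (ρ / 2) := by
      apply ball_subset_ball'
      rw [dist_comm y x]
      linarith [min_le_right s (ρ / 4)]
    have h2 : ball x (ρ / 2) ⊆ ball x ρ := ball_subset_ball (by linarith)
    obtain ⟨C, hC⟩ := propagate hP hP' (lt_min hs (by positivity : 0 < ρ / 4)) ℓ hsub (by linarith : ρ / 2 < ρ)
    refine ⟨ρ / 2, E, A + C * (C' + A), by positivity, ?_, ?_, fun F hF => ?_⟩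
    · intro f g _ _
      exact E.map_add f g
    · intro c f
      exact E.map_smul c f
    · obtain ⟨G, hG, hG0, hGF, hGn⟩ := hE F hF
      refine ⟨G, hG.mono h2, hG0, fun z hz => hGF [] z ⟨h2 hz.1, hz.2⟩, ?_, ?_⟩
      · refine (nm_mono h2).trans ((hGn [] (by simp)).trans ?_)
        simp only [List.length_nil]
        rw [gm_zero, nm_abs]
        gcongr
        exact_mod_cast le_self_add
      · intro l hl
        have hH := hG.resid hP isBounded_ball (hQ.sm (F []))
        have := hC _ hH ((C' + A) * nm P D (gm ℓ F)) ?_ ?_ l hl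
        · refine this.trans ?_
          rw [← mul_assoc]
          gcongr
          exact_mod_cast le_add_self
        · intro l hl
          rw [add_mul]
          refine le_trans ?_ le_self_add
          refine le_trans (le_of_eq ?_) (hC' F hF l hl)
          apply nm_congr measurableSet_ball
          intro z hz
          rw [hGF l z ⟨h2 (hsub hz), hsD (ball_subset_ball (min_le_left _ _) hz)⟩]
        · intro l hl
          rw [hQ.top _ l hl.ge]
          simp only [sub_zero]
          rw [add_mul]
          refine le_trans ?_ le_add_self
          rw [← hl]
          exact hGn l hl.le
  · obtain ⟨ρ, hρ, hρD⟩ := Metric.isOpen_iff.1 (isClosed_closure (s := D)).isOpen_compl x hxf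
    obtain ⟨C, hC⟩ := hQ.bd (ball x ρ) isBounded_ball
    refine ⟨ρ, Q, C, hρ, fun f g hf hg => hQ.add f g (hf.mono hBD) (hg.mono hBD), hQ.smul,
      fun F hF => ⟨fun l => pdl l (Q (F [])), Jet.smooth P isBounded_ball ℓ (hQ.sm _), rfl, ?_, ?_, ?_⟩⟩
    · rintro y ⟨h1, h2⟩
      exact absurd (subset_closure h2) (hρD h1)
    · have hm := hF.mem [] (by simp)
      refine (hC _ (hm.mono hBD)).trans ?_
      gcongr
      exact nm_mono hBD
    · intro l hl
      simp [nm]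

lemma pdl_bdd {ζ : Rd d → ℝ} (hζ : Sm ζ) (hc : HasCompactSupport ζ) (n : ℕ) :
    ∃ C : ℝ, ∀ a : List (Fin d), a.length ≤ n → ∀ x, |pdl a ζ x| ≤ C := by
  have h1 : ∀ a : List (Fin d), ∃ C, ∀ x, ‖pdl a ζ x‖ ≤ C := fun a =>
    (hζ.pdl a).continuous.bounded_above_of_compact_support (hc.mono' (subset_closure.trans (pdl_zero_off a ζ)))
  choose C hC using h1
  obtain ⟨M, hM⟩ := ((List.finite_length_le (Fin d) n).image C).bddAbove
  exact ⟨M, fun a ha x => (hC a x).trans (hM ⟨a, ha, rfl⟩)⟩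

lemma pdl_sum {ι : Type*} (s : Finset ι) {f : ι → Rd d → ℝ} (hf : ∀ i, Sm (f i)) (l : List (Fin d)) :
    pdl l (fun x => ∑ i ∈ s, f i x) = fun x => ∑ i ∈ s, pdl l (f i) x := by
  induction s using Finset.induction_on with
  | empty => simpa using pdl_zero_fun l
  | insert a s ha ih =>
    simp only [Finset.sum_insert ha]
    rw [pdl_add (hf a) (ContDiff.sum fun i _ => hf i), ih]

open scoped Manifold ContDiff in
lemma exists_pou {O : Set (Rd d)} (hO : Bornology.IsBounded O) {ρ : Rd d → ℝ} (hρ : ∀ x, 0 < ρ x) :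
    ∃ (T : Finset (Rd d)) (ζ : Rd d → Rd d → ℝ), (∀ t, Sm (ζ t)) ∧ (∀ t, tsupport (ζ t) ⊆ ball t (ρ t)) ∧
      (↑T ⊆ closure O) ∧ ∀ x ∈ closure O, ∑ t ∈ T, ζ t x = 1 := by
  have hc : IsCompact (closure O) := hO.isCompact_closure
  obtain ⟨T, hT, hcov⟩ := hc.elim_nhds_subcover (fun x => ball x (ρ x)) (fun x _ => ball_mem_nhds x (hρ x))
  obtain ⟨f, hf⟩ := SmoothPartitionOfUnity.exists_isSubordinate 𝓘(ℝ, Rd d) isClosed_closure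
    (fun t : T => ball (t : Rd d) (ρ t)) (fun t => isOpen_ball) (s := closure O)
    (fun x hx => by simpa using hcov hx)
  refine ⟨T, fun t => if h : t ∈ T then f ⟨t, h⟩ else 0, ?_, ?_, hT, ?_⟩
  · intro t
    by_cases h : t ∈ T
    · simp only [h, dite_true]
      exact (f ⟨t, h⟩).contMDiff.contDiff
    · simp only [h, dite_false]
      exact contDiff_const
  · intro t
    by_cases h : t ∈ T
    · simp only [h, dite_true]
      exact hf ⟨t, h⟩
    · simp only [h, dite_false]
      simp
  · intro x hx
    have := f.sum_eq_one hx
    rw [finsum_eq_sum_of_fintype] at this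
    rw [← this, ← Finset.sum_coe_sort T]
    apply Finset.sum_congr rfl
    intro i _
    simp

end glue

section glue2
variable {d : ℕ}

lemma scalar_ext {P : ℝ≥0∞} (hP : 1 ≤ P) (hP' : P ≠ ⊤) {ℓ : ℕ} (hl : 1 ≤ ℓ) {D O : Set (Rd d)} (hD : IsOpen D)
    (hO : IsOpen O) (hDc : IsConnected D) (hOb : Bornology.IsBounded O)
    (hlip : ∀ x ∈ frontier D ∩ closure O, LipschitzGraphAt D x) :
    ∃ (E : (Rd d → ℝ) → Rd d → ℝ) (C : ℝ≥0),
      (∀ f g, ML P D f → ML P D g → E (fun x => f x + g x) = fun x => E f x + E g x) ∧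
      (∀ (c : ℝ) f, E (fun x => c * f x) = fun x => c * E f x) ∧
      ∀ F, Jet P D ℓ F → ∃ G : List (Fin d) → Rd d → ℝ, Jet P O ℓ G ∧ G [] = E (F []) ∧
        (∀ y ∈ D ∩ O, G [] y = F [] y) ∧ nm P O (G []) ≤ C * nm P D (F []) ∧
        ∀ l, l.length = ℓ → nm P O (G l) ≤ C * nm P D (gm ℓ F) := by
  obtain ⟨Q, B, hBD, hQ, hgood⟩ := chain hP hP' hD hDc ℓ
  have h0 : ∀ x, ∃ ρ : ℝ, 0 < ρ ∧ (x ∈ closure O → ∃ E A, Chart P D ℓ Q x ρ E A) := by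
    intro x
    by_cases hx : x ∈ closure O
    · obtain ⟨ρ, E, A, h⟩ := exists_chart hP hP' hl hD hBD hQ hgood x (fun hxf => hlip x ⟨hxf, hx⟩)
      exact ⟨ρ, h.pos, fun _ => ⟨E, A, h⟩⟩
    · exact ⟨1, one_pos, fun h => absurd h hx⟩
  choose ρ hρ hch using h0
  obtain ⟨T, ζ, hζ, hζs, hTO, hζ1⟩ := exists_pou hOb hρ
  have hch' : ∀ t : Rd d, ∃ E A, t ∈ T → Chart P D ℓ Q t (ρ t) E A := by
    intro t
    by_cases ht : t ∈ T
    · obtain ⟨E, A, h⟩ := hch t (hTO ht)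
      exact ⟨E, A, fun _ => h⟩
    · exact ⟨fun _ _ => 0, 0, fun h => absurd h ht⟩
  choose E A hE using hch'
  have hζc : ∀ t, HasCompactSupport (ζ t) := fun t =>
    (isCompact_closedBall t (ρ t)).of_isClosed_subset (isClosed_tsupport _) ((hζs t).trans ball_subset_closedBall)
  choose M hM using fun t => pdl_bdd (hζ t) (hζc t) ℓ
  have hz : ∀ t a, ∀ x ∈ O, x ∉ ball t (ρ t) → pdl a (ζ t) x = 0 := by
    intro t a x _ hx
    by_contra h
    exact hx (hζs t (pdl_zero_off a (ζ t) (subset_closure h)))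
  set C : ℝ≥0 := ∑ t ∈ T, 2 ^ ℓ * ((M t).toNNReal * A t) with hC
  refine ⟨fun f x => ∑ t ∈ T, ζ t x * E t f x, C, ?_, ?_, ?_⟩
  · intro f g hf hg
    ext x
    rw [← Finset.sum_add_distrib]
    apply Finset.sum_congr rfl
    intro t ht
    rw [(hE t ht).add f g hf hg]
    ring
  · intro c f
    ext x
    rw [Finset.mul_sum]
    apply Finset.sum_congr rfl
    intro t ht
    rw [(hE t ht).smul c f]
    ring
  · intro F hF
    have hG' : ∀ t, ∃ G : List (Fin d) → Rd d → ℝ, t ∈ T → (Jet P (ball t (ρ t)) ℓ G ∧ G [] = E t (F []) ∧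
      (∀ y ∈ ball t (ρ t) ∩ D, G [] y = F [] y) ∧ nm P (ball t (ρ t)) (G []) ≤ A t * nm P D (F []) ∧
      ∀ l, l.length ≤ ℓ → nm P (ball t (ρ t)) (fun y => G l y - pdl l (Q (F [])) y) ≤ A t * nm P D (gm ℓ F)) := by
      intro t
      by_cases ht : t ∈ T
      · obtain ⟨G, hG⟩ := (hE t ht).ext F hF
        exact ⟨G, fun _ => hG⟩
      · exact ⟨fun _ _ => 0, fun h => absurd h ht⟩
    choose G hG using hG'
    have hjet : ∀ t ∈ T, Jet P O ℓ (fun l => Leib l (fun a => pdl a (ζ t)) (G t)) := fun t ht =>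
      Jet.leib hP hO.measurableSet measurableSet_ball (hG t ht).1 (hζ t) (fun x hx => hζs t hx.2)
        (fun a ha x _ => hM t a ha x)
    refine ⟨fun l x => ∑ t ∈ T, Leib l (fun a => pdl a (ζ t)) (G t) x, Jet.sum hP T hjet, ?_, ?_, ?_, ?_⟩
    · ext x
      apply Finset.sum_congr rfl
      intro t ht
      rw [← (hG t ht).2.1]
      rfl
    · rintro y ⟨hyD, hyO⟩
      have : ∀ t ∈ T, Leib [] (fun a => pdl a (ζ t)) (G t) y = ζ t y * F [] y := by
        intro t ht
        change ζ t y * G t [] y = _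
        by_cases hy : y ∈ ball t (ρ t)
        · rw [(hG t ht).2.2.1 y ⟨hy, hyD⟩]
        · have := hz t [] y hyO hy
          change ζ t y = 0 at this
          rw [this, zero_mul, zero_mul]
      simp only
      rw [Finset.sum_congr rfl this, ← Finset.sum_mul, hζ1 y (subset_closure hyO), one_mul]
    · refine (nm_sum_le hP T (fun t ht => (hjet t ht).mem [] (by simp))).trans ?_
      rw [hC]
      push_cast
      rw [Finset.sum_mul]
      apply Finset.sum_le_sum
      intro t ht
      refine ((ML.mul_bdd hO.measurableSet measurableSet_ball (hζ t).continuous (fun x _ => hM t [] (by simp) x)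
        (hz t []) ((hG t ht).1.mem [] (by simp))).2).trans ?_
      calc _ ≤ ((M t).toNNReal : ℝ≥0∞) * (A t * nm P D (F [])) := mul_le_mul' le_rfl (hG t ht).2.2.2.1
        _ = 1 * (((M t).toNNReal : ℝ≥0∞) * A t) * nm P D (F []) := by rw [one_mul, mul_assoc]
        _ ≤ _ := by
          gcongr
          exact one_le_pow₀ (by norm_num)
    · intro l hll
      have hres : ∀ t ∈ T, Jet P (ball t (ρ t)) ℓ (fun l y => G t l y - pdl l (Q (F [])) y) := fun t ht =>
        (hG t ht).1.resid hP isBounded_ball (hQ.sm (F []))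
      have hb : ∀ t ∈ T, ML P O (Leib l (fun a => pdl a (ζ t)) (fun l y => G t l y - pdl l (Q (F [])) y)) ∧
          nm P O (Leib l (fun a => pdl a (ζ t)) (fun l y => G t l y - pdl l (Q (F [])) y)) ≤
          2 ^ l.length * (((M t).toNNReal : ℝ≥0∞) * (A t * nm P D (gm ℓ F))) := by
        intro t ht
        apply Leib_ML hP
        intro a b hab
        have := ML.mul_bdd hO.measurableSet measurableSet_ball ((hζ t).pdl a).continuous (fun x _ => hM t a (by omega) x)
          (hz t a) ((hres t ht).mem b (by omega))
        exact ⟨this.1, this.2.trans (mul_le_mul' le_rfl ((hG t ht).2.2.2.2 b (by omega)))⟩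
      have heq : ∀ x ∈ O, ∑ t ∈ T, Leib l (fun a => pdl a (ζ t)) (G t) x =
          ∑ t ∈ T, Leib l (fun a => pdl a (ζ t)) (fun l y => G t l y - pdl l (Q (F [])) y) x := by
        intro x hx
        simp only [Leib_sub_right]
        rw [Finset.sum_sub_distrib, ← Leib_sum_left, Leib_one, hQ.top _ l hll.ge, sub_zero]
        · exact hζ1 x (subset_closure hx)
        · intro a ha
          rw [← congrFun (pdl_sum T hζ a) x]
          have hloc : ∀ᶠ z in 𝓝 x, ∑ t ∈ T, ζ t z = 1 := by
            filter_upwards [hO.mem_nhds hx] with z hz using hζ1 z (subset_closure hz)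
          simpa [ha] using (pdl_const_loc hloc a).self_of_nhds
      rw [nm_congr hO.measurableSet heq]
      refine (nm_sum_le hP T (fun t ht => (hb t ht).1)).trans ?_
      rw [hC]
      push_cast
      rw [Finset.sum_mul]
      apply Finset.sum_le_sum
      intro t ht
      refine (hb t ht).2.trans ?_
      rw [hll]
      simp only [mul_assoc]
      exact le_rfl

end glue2

section bridge
variable {d N : ℕ}

lemma sqrt_sum_sq_le {ι : Type*} (s : Finset ι) (a : ι → ℝ) : Real.sqrt (∑ i ∈ s, a i ^ 2) ≤ ∑ i ∈ s, |a i| := by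
  rw [Real.sqrt_le_left (Finset.sum_nonneg fun i _ => abs_nonneg _)]
  induction s using Finset.induction_on with
  | empty => simp
  | insert i s hi ih =>
    rw [Finset.sum_insert hi, Finset.sum_insert hi, ← sq_abs (a i)]
    have h1 := abs_nonneg (a i)
    have h2 : 0 ≤ ∑ i ∈ s, |a i| := Finset.sum_nonneg fun i _ => abs_nonneg _
    nlinarith [mul_nonneg h1 h2]

lemma le_sqrt_sum_sq {ι : Type*} (s : Finset ι) (a : ι → ℝ) {i : ι} (hi : i ∈ s) : |a i| ≤ Real.sqrt (∑ i ∈ s, a i ^ 2) := by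
  apply Real.abs_le_sqrt
  exact Finset.single_le_sum (f := fun i => a i ^ 2) (fun i _ => sq_nonneg _) hi

lemma eN_le (ξ : Vec N) : eN ξ ≤ ∑ c, |ξ c| := sqrt_sum_sq_le _ _

lemma le_eN (ξ : Vec N) (c : Fin N) : |ξ c| ≤ eN ξ := le_sqrt_sum_sq _ _ (Finset.mem_univ c)

lemma eN_nonneg' (ξ : Vec N) : 0 ≤ eN ξ := Real.sqrt_nonneg _

lemma MemLpOn.comp {p : ℝ} {U : Set (Rd d)} {w : Rd d → Vec N} (h : MemLpOn p U w) (c : Fin N) :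
    ML (ENNReal.ofReal p) U (fun x => w x c) := by
  refine MemLp.of_le h ?_ (ae_of_all _ fun x => norm_le_pi_norm (w x) c)
  exact (continuous_apply c).comp_aestronglyMeasurable h.1

lemma MemLpOn.of_comp {p : ℝ} {U : Set (Rd d)} {w : Rd d → Vec N} (h : ∀ c, ML (ENNReal.ofReal p) U (fun x => w x c)) :
    MemLpOn p U w := memLp_pi_iff.2 h

lemma set_int_eq {U : Set (Rd d)} {φ : Rd d → ℝ} (hφ : tsupport φ ⊆ U) (f : Rd d → ℝ) :
    ∫ x in U, f x * φ x = ∫ x, f x * φ x := by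
  apply setIntegral_eq_integral_of_forall_compl_eq_zero
  intro x hx
  rw [image_eq_zero_of_notMem_tsupport (fun h => hx (hφ h)), mul_zero]

lemma isWeak_iff {m : ℕ} {U : Set (Rd d)} {j : Fin m → Fin d} {w g : Rd d → Vec N} :
    IsWeakDerivOn U j w g ↔ ∀ φ, Tst U φ → ∀ c, ∫ x, w x c * pdl (List.ofFn j) φ x = (-1) ^ m * ∫ x, g x c * φ x := by
  unfold IsWeakDerivOn
  constructor
  · rintro h φ hφ c
    have := h φ hφ.1 hφ.2.1 hφ.2.2 c
    simp_rw [pdl_iterated hφ.1] at this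
    rwa [set_int_eq (hφ.pdl _).2.2, set_int_eq hφ.2.2] at this
  · intro h φ h1 h2 h3 c
    have hφ : Tst U φ := ⟨h1, h2, h3⟩
    have := h φ hφ c
    simp_rw [pdl_iterated hφ.1]
    rwa [set_int_eq (hφ.pdl _).2.2, set_int_eq hφ.2.2]

lemma wDeriv_spec {ℓ : ℕ} {p : ℝ} {U : Set (Rd d)} {w : Rd d → Vec N} (h : MemW ℓ p U w) {m : ℕ} (hm : m ≤ ℓ) (j : Fin m → Fin d) :
    MemLpOn p U (wDeriv p U j w) ∧ IsWeakDerivOn U j w (wDeriv p U j w) := by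
  have h1 := h.2 m hm j
  unfold wDeriv
  rw [dif_pos h1]
  exact h1.choose_spec

/-- The jet associated with a Sobolev function. -/
def fj (p : ℝ) (U : Set (Rd d)) (w : Rd d → Vec N) (c : Fin N) : List (Fin d) → Rd d → ℝ
  | [] => fun x => w x c
  | i :: l => fun x => wDeriv p U (i :: l).get w x c

lemma fj_int {ℓ : ℕ} {p : ℝ} {U : Set (Rd d)} {w : Rd d → Vec N} (h : MemW ℓ p U w) (c : Fin N)
    (l : List (Fin d)) (hl : l.length ≤ ℓ) {φ : Rd d → ℝ} (hφ : Tst U φ) :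
    ∫ x, fj p U w c l x * φ x = (-1) ^ l.length * ∫ x, w x c * pdl l φ x := by
  cases l with
  | nil => simp [fj, pdl]
  | cons i l =>
    have := isWeak_iff.1 (wDeriv_spec h hl (i :: l).get).2 φ hφ c
    rw [List.ofFn_get] at this
    rw [this, ← mul_assoc, ← mul_pow]
    simp [fj]

lemma fj_jet {ℓ : ℕ} {p : ℝ} {U : Set (Rd d)} {w : Rd d → Vec N} (h : MemW ℓ p U w) (c : Fin N) :
    Jet (ENNReal.ofReal p) U ℓ (fj p U w c) := by
  constructor
  · intro l hl
    cases l with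
    | nil => exact h.1.comp c
    | cons i l => exact (wDeriv_spec h hl (i :: l).get).1.comp c
  · intro l i hl φ hφ
    rw [fj_int h c l hl.le (hφ.pd i), fj_int h c (i :: l) hl hφ, pdl_pd hφ.1]
    simp only [List.length_cons]
    ring

lemma W_of_jet {ℓ : ℕ} {p : ℝ} {U : Set (Rd d)} {w : Rd d → Vec N} {G : Fin N → List (Fin d) → Rd d → ℝ}
    (hG : ∀ c, Jet (ENNReal.ofReal p) U ℓ (G c)) (h0 : ∀ c, G c [] = fun x => w x c) {m : ℕ} (hm : m ≤ ℓ) (j : Fin m → Fin d) :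
    MemLpOn p U (fun x c => G c (List.ofFn j) x) ∧ IsWeakDerivOn U j w (fun x c => G c (List.ofFn j) x) := by
  refine ⟨MemLpOn.of_comp fun c => (hG c).mem _ (by simpa using hm), isWeak_iff.2 fun φ hφ c => ?_⟩
  rw [jet_int (hG c) _ (by simpa using hm) hφ, h0 c, List.length_ofFn, ← mul_assoc, ← mul_pow]
  simp

lemma memW_of_jet {ℓ : ℕ} {p : ℝ} {U : Set (Rd d)} {w : Rd d → Vec N} {G : Fin N → List (Fin d) → Rd d → ℝ}
    (hG : ∀ c, Jet (ENNReal.ofReal p) U ℓ (G c)) (h0 : ∀ c, G c [] = fun x => w x c) : MemW ℓ p U w := by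
  refine ⟨MemLpOn.of_comp fun c => ?_, fun m hm j => ⟨_, W_of_jet hG h0 hm j⟩⟩
  rw [← h0 c]
  exact (hG c).mem [] (by simp)

lemma wDeriv_ae {ℓ : ℕ} {p : ℝ} (hp : 1 ≤ ENNReal.ofReal p) {U : Set (Rd d)} (hU : IsOpen U) {w : Rd d → Vec N} {G : Fin N → List (Fin d) → Rd d → ℝ}
    (hG : ∀ c, Jet (ENNReal.ofReal p) U ℓ (G c)) (h0 : ∀ c, G c [] = fun x => w x c) {m : ℕ} (hm : m ≤ ℓ) (j : Fin m → Fin d)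
    (c : Fin N) : (fun x => wDeriv p U j w x c) =ᵐ[volume.restrict U] G c (List.ofFn j) := by
  have h1 := wDeriv_spec (memW_of_jet hG h0) hm j
  have h2 := W_of_jet hG h0 hm j
  refine ae_eq_of_test hp hU (h1.1.comp c) (h2.1.comp c) fun φ hφ => ?_
  have h3 := (isWeak_iff.1 h1.2 φ hφ c).symm.trans (isWeak_iff.1 h2.2 φ hφ c)
  exact mul_left_cancel₀ (pow_ne_zero m (by norm_num)) h3

lemma nm_eN_le {P : ℝ≥0∞} (hP : 1 ≤ P) {U : Set (Rd d)} {w : Rd d → Vec N} (h : ∀ c, ML P U (fun x => w x c)) :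
    nm P U (fun x => eN (w x)) ≤ ∑ c, nm P U (fun x => w x c) := by
  calc nm P U (fun x => eN (w x)) ≤ nm P U (fun x => ∑ c, |w x c|) := by
        apply eLpNorm_mono
        intro x
        rw [Real.norm_eq_abs, abs_of_nonneg (eN_nonneg' _)]
        exact (eN_le _).trans (le_abs_self _)
    _ ≤ ∑ c, nm P U (fun x => |w x c|) := nm_sum_le hP _ (fun c _ => (h c).abs)
    _ = _ := by simp only [nm_abs]

lemma le_nm_eN {P : ℝ≥0∞} {U : Set (Rd d)} (w : Rd d → Vec N) (c : Fin N) :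
    nm P U (fun x => w x c) ≤ nm P U (fun x => eN (w x)) := by
  apply eLpNorm_mono
  intro x
  exact (le_eN _ c).trans (le_abs_self _)

lemma ML_eN {p : ℝ} {U : Set (Rd d)} {w : Rd d → Vec N} (h : MemLpOn p U w) :
    ML (ENNReal.ofReal p) U (fun x => eN (w x)) := by
  have hs : ML (ENNReal.ofReal p) U (fun x => ∑ c, |w x c|) := ML.sum _ (fun c _ => (h.comp c).abs)
  refine MemLp.of_le hs ?_ (ae_of_all _ fun x => ?_)
  · have : Continuous (eN : Vec N → ℝ) := by unfold eN; fun_prop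
    exact this.comp_aestronglyMeasurable h.1
  · rw [Real.norm_eq_abs, abs_of_nonneg (eN_nonneg' _)]
    exact (eN_le _).trans (le_abs_self _)

lemma nm_grad_le {P : ℝ≥0∞} (hP : 1 ≤ P) {U : Set (Rd d)} {ι : Type*} [Fintype ι] {w : ι → Rd d → Vec N}
    (h : ∀ j, ML P U (fun x => eN (w j x))) :
    nm P U (fun x => Real.sqrt (∑ j, eN (w j x) ^ 2)) ≤ ∑ j, nm P U (fun x => eN (w j x)) := by
  calc _ ≤ nm P U (fun x => ∑ j, |eN (w j x)|) := by
        apply eLpNorm_mono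
        intro x
        rw [Real.norm_eq_abs, abs_of_nonneg (Real.sqrt_nonneg _)]
        exact (sqrt_sum_sq_le _ _).trans (le_abs_self _)
    _ ≤ ∑ j, nm P U (fun x => |eN (w j x)|) := nm_sum_le hP _ (fun j _ => (h j).abs)
    _ = _ := by simp only [nm_abs]

lemma le_nm_grad {P : ℝ≥0∞} {U : Set (Rd d)} {ι : Type*} [Fintype ι] (w : ι → Rd d → Vec N) (j : ι) :
    nm P U (fun x => eN (w j x)) ≤ nm P U (fun x => Real.sqrt (∑ j, eN (w j x) ^ 2)) := by
  apply eLpNorm_mono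
  intro x
  exact (le_sqrt_sum_sq _ (fun j => eN (w j x)) (Finset.mem_univ j)).trans (le_abs_self _)

end bridge

/-- Sobolev extension from `D` to `O` controlling separately the `L^p`
norms of the function and of its highest-order gradient. -/
theorem sobolev_extension
    {d N : ℕ} (ℓ : ℕ) (hl : 1 ≤ ℓ) (p : ℝ) (hp : 1 < p)
    (D O : Set (Rd d)) (hDo : IsOpen D) (hOo : IsOpen O) (hDconn : IsConnected D)
    (hObd : Bornology.IsBounded O)
    (hlip : ∀ x ∈ frontier D ∩ closure O, LipschitzGraphAt D x) :
    ∃ (E : (Rd d → Vec N) → (Rd d → Vec N)) (c : ℝ), 0 < c ∧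
      -- `E` is linear (on `W^{ℓ,p}(D;ℝ^N)`)
      (∀ u v : Rd d → Vec N, MemW ℓ p D u → MemW ℓ p D v →
        E (fun x => u x + v x) =ᵐ[volume.restrict O] fun x => E u x + E v x) ∧
      (∀ (t : ℝ) (u : Rd d → Vec N), MemW ℓ p D u →
        E (fun x => t • u x) =ᵐ[volume.restrict O] fun x => t • E u x) ∧
      ∀ u : Rd d → Vec N, MemW ℓ p D u →
        MemW ℓ p O (E u) ∧
        -- (1) `E u = u` a.e. in `D ∩ O`
        (∀ᵐ x ∂volume.restrict (D ∩ O), E u x = u x) ∧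
        -- (2) `‖E u‖_{L^p(O)} ≤ c ‖u‖_{L^p(D)}`
        LpNormOn p O (E u) ≤ c * LpNormOn p D u ∧
        -- (3) `‖∇^ℓ (E u)‖_{L^p(O)} ≤ c ‖∇^ℓ u‖_{L^p(D)}`
        gradLp ℓ p O (E u) ≤ c * gradLp ℓ p D u := by
  have hP : 1 ≤ ENNReal.ofReal p := by
    rw [← ENNReal.ofReal_one]
    exact ENNReal.ofReal_le_ofReal hp.le
  obtain ⟨E, C, hadd, hsmul, hE⟩ := scalar_ext hP ENNReal.ofReal_ne_top hl hDo hOo hDconn hObd hlip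
  set P := ENNReal.ofReal p with hPdef
  set K : ℝ≥0 := (d ^ ℓ * (N * (C * d ^ ℓ))) + N * C + 1 with hK
  refine ⟨fun u x c => E (fun y => u y c) x, K, by rw [hK]; positivity, ?_, ?_, ?_⟩
  · intro u v hu hv
    refine Eventually.of_forall fun x => ?_
    ext c
    exact congrFun (hadd _ _ (hu.1.comp c) (hv.1.comp c)) x
  · intro t u hu
    refine Eventually.of_forall fun x => ?_
    ext c
    exact congrFun (hsmul t _) x
  · intro u hu
    choose G hG hG0 hGu hGn hGt using fun c => hE (fj p D u c) (fj_jet hu c)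
    have h0 : ∀ c, G c [] = fun x => (fun x c => E (fun y => u y c) x : Rd d → Vec N) x c := hG0
    have hW := memW_of_jet hG h0
    refine ⟨hW, ?_, ?_, ?_⟩
    · rw [ae_restrict_iff' (hDo.inter hOo).measurableSet]
      refine ae_of_all _ fun x hx => ?_
      ext c
      have := hGu c x hx
      rw [hG0 c] at this
      exact this
    · unfold LpNormOn
      rw [← ENNReal.coe_toReal, ← ENNReal.toReal_mul]
      refine ENNReal.toReal_mono (ENNReal.mul_ne_top ENNReal.coe_ne_top (ML_eN hu.1).nm_ne_top) ?_
      refine (nm_eN_le hP (fun c => hW.1.comp c)).trans ?_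
      calc _ ≤ ∑ c : Fin N, (C : ℝ≥0∞) * nm P D (fun x => eN (u x)) := by
            apply Finset.sum_le_sum
            intro c _
            have := hGn c
            rw [hG0 c] at this
            exact this.trans (mul_le_mul' le_rfl (le_nm_eN u c))
        _ = ((N * C : ℝ≥0) : ℝ≥0∞) * nm P D (fun x => eN (u x)) := by
            rw [Finset.sum_const, Finset.card_univ, Fintype.card_fin, nsmul_eq_mul]
            push_cast
            ring
        _ ≤ _ := by
            refine mul_le_mul' (ENNReal.coe_le_coe.2 ?_) le_rfl
            rw [hK]
            exact le_add_self.trans le_self_add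
    · unfold gradLp
      have hfin : nm P D (fun x => Real.sqrt (∑ j : Fin ℓ → Fin d, eN (wDeriv p D j u x) ^ 2)) ≠ ⊤ := by
        refine ne_top_of_le_ne_top ?_ (nm_grad_le hP (fun j => ML_eN (wDeriv_spec hu le_rfl j).1))
        exact ENNReal.sum_ne_top.2 fun j _ => (ML_eN (wDeriv_spec hu le_rfl j).1).nm_ne_top
      rw [← ENNReal.coe_toReal, ← ENNReal.toReal_mul]
      refine ENNReal.toReal_mono (ENNReal.mul_ne_top ENNReal.coe_ne_top hfin) ?_
      refine (nm_grad_le hP (fun j => ML_eN (wDeriv_spec hW le_rfl j).1)).trans ?_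
      change _ ≤ (K : ℝ≥0∞) * nm P D (fun x => Real.sqrt (∑ j : Fin ℓ → Fin d, eN (wDeriv p D j u x) ^ 2))
      set S := nm P D (fun x => Real.sqrt (∑ j : Fin ℓ → Fin d, eN (wDeriv p D j u x) ^ 2)) with hS
      have hgm : ∀ c, nm P D (gm ℓ (fj p D u c)) ≤ (d : ℝ≥0∞) ^ ℓ * S := by
        intro c
        refine nm_gm_le hP (fun l hl => (fj_jet hu c).mem l hl.le) ?_
        intro l hll
        rw [hS]
        clear_value S K
        subst hll
        cases l with
        | nil => simp at hl
        | cons i l =>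
          exact (le_nm_eN _ c).trans (le_nm_grad (fun j : Fin (i :: l).length → Fin d => wDeriv p D j u) (i :: l).get)
      calc _ ≤ ∑ j : Fin ℓ → Fin d, ∑ c : Fin N, (C : ℝ≥0∞) * ((d : ℝ≥0∞) ^ ℓ * S) := by
            apply Finset.sum_le_sum
            intro j _
            refine (nm_eN_le hP (fun c => (wDeriv_spec hW le_rfl j).1.comp c)).trans ?_
            apply Finset.sum_le_sum
            intro c _
            have h1 : nm P O (fun x => wDeriv p O j (fun x c => E (fun y => u y c) x : Rd d → Vec N) x c) = nm P O (G c (List.ofFn j)) :=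
              eLpNorm_congr_ae (wDeriv_ae hP hOo hG h0 le_rfl j c)
            rw [h1]
            exact (hGt c _ (by simp)).trans (mul_le_mul' le_rfl (hgm c))
        _ = ((d ^ ℓ * (N * (C * d ^ ℓ)) : ℝ≥0) : ℝ≥0∞) * S := by
            simp only [Finset.sum_const, Finset.card_univ, Fintype.card_fin, nsmul_eq_mul, Fintype.card_pi, Finset.prod_const]
            push_cast
            ring
        _ ≤ _ := by
            refine mul_le_mul' (ENNReal.coe_le_coe.2 ?_) le_rfl
            rw [hK, add_assoc]
            exact le_self_add

end HC
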